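/- Let d ≥ 2, 1 ≤ p < ∞, a ∈ ℝ and m ∈ ℕ. (i) For the truncated smooth cone K with vertex set M = {0} (Case I) there is a linear operator E, defined on locally integrable functions on K, such that Eu = u almost everywhere on K and E is bounded from 𝒦^m_{a,p}(K,{0}) to 𝒦^m_{a,p}(ℝ^d,{0}) (in fact Stein's extension operator works simultaneously for all m, a, p). (ii) For the specific nonsmooth cone P with edge Γ (Case II) the same operator is bounded from 𝒦^m_{a,p}(P,Γ) to 𝒦^m_{a,p}(ℝ^d,ℝ_*). (iii) For the unit cube I with face M_ℓ, 1 ≤ ℓ < d (Case III), the same operator is bounded from 𝒦^m_{a,p}(I,M_ℓ) to 𝒦^m_{a,p}(ℝ^d,ℝ^ℓ_*). -/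

import Mathlib

open MeasureTheory Metric Set Filter
open scoped Topology ENNReal NNReal

noncomputable section

/-- `d`-dimensional Euclidean space. -/
abbrev Ed (d : ℕ) : Type := EuclideanSpace ℝ (Fin d)

/-- The finite set of all multi-indices `α : Fin d → ℕ` with `|α| = ∑ i, α i ≤ m`. -/
def multiIdx (d m : ℕ) : Finset (Fin d → ℕ) :=
  (Fintype.piFinset fun _ : Fin d => Finset.range (m + 1)).filter fun α => ∑ i, α i ≤ m

/-- First-order partial derivative in the `i`-th coordinate direction. -/
def pderivI (d : ℕ) (i : Fin d) (f : Ed d → ℝ) : Ed d → ℝ :=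
  fun x => fderiv ℝ f x (EuclideanSpace.single i 1)

/-- Iterated partial derivative `∂^α`. -/
def pderivA (d : ℕ) (α : Fin d → ℕ) (f : Ed d → ℝ) : Ed d → ℝ :=
  ((List.finRange d).foldr (fun i g => (pderivI d i)^[α i] ∘ g) id) f

/-- Smooth compactly supported test functions with support inside `Ω`. -/
def IsTestFun (d : ℕ) (Ω : Set (Ed d)) (φ : Ed d → ℝ) : Prop :=
  ContDiff ℝ (⊤ : ℕ∞) φ ∧ HasCompactSupport φ ∧ tsupport φ ⊆ Ω

/-- `v` is the `α`-th weak (distributional) derivative of `u` on `Ω`. -/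
def HasWeakDerivOn (d : ℕ) (Ω : Set (Ed d)) (α : Fin d → ℕ) (u v : Ed d → ℝ) : Prop :=
  LocallyIntegrableOn u Ω volume ∧ LocallyIntegrableOn v Ω volume ∧
    ∀ φ : Ed d → ℝ, IsTestFun d Ω φ →
      ∫ x in Ω, u x * pderivA d α φ x = (-1 : ℝ) ^ (∑ i, α i) * ∫ x in Ω, v x * φ x

/-- `D` is a family of weak derivatives of `u` on `Ω` for all multi-indices of order `≤ m`. -/
def IsWeakDerivFamily (d : ℕ) (Ω : Set (Ed d)) (m : ℕ) (u : Ed d → ℝ)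
    (D : (Fin d → ℕ) → Ed d → ℝ) : Prop :=
  ∀ α ∈ multiIdx d m, HasWeakDerivOn d Ω α u (D α)

/-- `x ↦ (ρ(x)^(|α|-a) |v(x)|)^p`, the integrand in the Kondratiev norm. -/
def kIntegrand (d : ℕ) (ρ : Ed d → ℝ) (a p : ℝ) (α : Fin d → ℕ) (v : Ed d → ℝ) : Ed d → ℝ :=
  fun x => (ρ x ^ (((∑ i, α i : ℕ) : ℝ) - a) * |v x|) ^ p

/-- The Kondratiev norm computed from a family `D` of weak derivatives. -/
def KnormP (d : ℕ) (Ω : Set (Ed d)) (ρ : Ed d → ℝ) (m : ℕ) (a p : ℝ)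
    (D : (Fin d → ℕ) → Ed d → ℝ) : ℝ :=
  (∑ α ∈ multiIdx d m, ∫ x in Ω, kIntegrand d ρ a p α (D α) x) ^ (1 / p)

/-- `D` witnesses membership of `u` in the Kondratiev space `𝒦^m_{a,p}(Ω, M)`
    (with weight function `ρ`). -/
def KMemData (d : ℕ) (Ω : Set (Ed d)) (ρ : Ed d → ℝ) (m : ℕ) (a p : ℝ)
    (u : Ed d → ℝ) (D : (Fin d → ℕ) → Ed d → ℝ) : Prop :=
  IsWeakDerivFamily d Ω m u D ∧
    ∀ α ∈ multiIdx d m, IntegrableOn (kIntegrand d ρ a p α (D α)) Ω volume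

/-- Membership in the Kondratiev space `𝒦^m_{a,p}(Ω, M)` with weight `ρ`, `p < ∞`. -/
def MemK (d : ℕ) (Ω : Set (Ed d)) (ρ : Ed d → ℝ) (m : ℕ) (a p : ℝ) (u : Ed d → ℝ) : Prop :=
  ∃ D, KMemData d Ω ρ m a p u D

open Classical in
/-- The Kondratiev norm of `u` (computed from a choice of weak derivative family;
    it is a.e. independent of this choice). -/
def Knorm (d : ℕ) (Ω : Set (Ed d)) (ρ : Ed d → ℝ) (m : ℕ) (a p : ℝ) (u : Ed d → ℝ) : ℝ :=
  if h : MemK d Ω ρ m a p u then KnormP d Ω ρ m a p h.choose else 0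

/-- `x ↦ ρ(x)^(|α|-a) v(x)`, the function whose `L_∞` norm enters the norm for `p = ∞`. -/
def kIntegrandInf (d : ℕ) (ρ : Ed d → ℝ) (a : ℝ) (α : Fin d → ℕ) (v : Ed d → ℝ) : Ed d → ℝ :=
  fun x => ρ x ^ (((∑ i, α i : ℕ) : ℝ) - a) * v x

/-- `D` witnesses membership of `u` in `𝒦^m_{a,∞}(Ω, M)`. -/
def KMemDataInf (d : ℕ) (Ω : Set (Ed d)) (ρ : Ed d → ℝ) (m : ℕ) (a : ℝ)
    (u : Ed d → ℝ) (D : (Fin d → ℕ) → Ed d → ℝ) : Prop :=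
  IsWeakDerivFamily d Ω m u D ∧
    ∀ α ∈ multiIdx d m,
      eLpNorm (kIntegrandInf d ρ a α (D α)) ⊤ (volume.restrict Ω) < ⊤

/-- Membership in `𝒦^m_{a,∞}(Ω, M)`. -/
def MemKInf (d : ℕ) (Ω : Set (Ed d)) (ρ : Ed d → ℝ) (m : ℕ) (a : ℝ) (u : Ed d → ℝ) : Prop :=
  ∃ D, KMemDataInf d Ω ρ m a u D

/-- The `𝒦^m_{a,∞}` norm computed from a family `D` of weak derivatives. -/
def KnormInfP (d : ℕ) (Ω : Set (Ed d)) (ρ : Ed d → ℝ) (m : ℕ) (a : ℝ)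
    (D : (Fin d → ℕ) → Ed d → ℝ) : ℝ :=
  ∑ α ∈ multiIdx d m, (eLpNorm (kIntegrandInf d ρ a α (D α)) ⊤ (volume.restrict Ω)).toReal

open Classical in
/-- The `𝒦^m_{a,∞}(Ω, M)` norm of `u`. -/
def KnormInf (d : ℕ) (Ω : Set (Ed d)) (ρ : Ed d → ℝ) (m : ℕ) (a : ℝ) (u : Ed d → ℝ) : ℝ :=
  if h : MemKInf d Ω ρ m a u then KnormInfP d Ω ρ m a h.choose else 0

/-- The subspace `ℝ^ℓ_* = {x : x₁ = ⋯ = x_{d-ℓ} = 0}` of `ℝ^d`. -/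
def RStar (d ℓ : ℕ) : Set (Ed d) := {x | ∀ i : Fin d, (i : ℕ) < d - ℓ → x i = 0}

/-- The weight `ρ(x) = min(1, |x'|)` for the model case `(ℝ^d, ℝ^ℓ_*)`. -/
def rhoModel (d ℓ : ℕ) (x : Ed d) : ℝ :=
  min 1 (Real.sqrt (∑ i ∈ Finset.univ.filter (fun i : Fin d => (i : ℕ) < d - ℓ), (x i) ^ 2))

/-- The model domain `ℝ^d ∖ ℝ^ℓ_*`. -/
def ModelDomain (d ℓ : ℕ) : Set (Ed d) := (RStar d ℓ)ᶜ

/-- Membership in the model Kondratiev space `𝒦^m_{a,p}(ℝ^d, ℝ^ℓ_*)`, `p < ∞`. -/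
def MemKM (d ℓ m : ℕ) (a p : ℝ) (u : Ed d → ℝ) : Prop :=
  MemK d (ModelDomain d ℓ) (rhoModel d ℓ) m a p u

/-- The norm of the model Kondratiev space `𝒦^m_{a,p}(ℝ^d, ℝ^ℓ_*)`, `p < ∞`. -/
def KnormM (d ℓ m : ℕ) (a p : ℝ) (u : Ed d → ℝ) : ℝ :=
  Knorm d (ModelDomain d ℓ) (rhoModel d ℓ) m a p u

/-- Membership in the model Kondratiev space `𝒦^m_{a,∞}(ℝ^d, ℝ^ℓ_*)`. -/
def MemKMInf (d ℓ m : ℕ) (a : ℝ) (u : Ed d → ℝ) : Prop :=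
  MemKInf d (ModelDomain d ℓ) (rhoModel d ℓ) m a u

/-- The norm of the model Kondratiev space `𝒦^m_{a,∞}(ℝ^d, ℝ^ℓ_*)`. -/
def KnormMInf (d ℓ m : ℕ) (a : ℝ) (u : Ed d → ℝ) : ℝ :=
  KnormInf d (ModelDomain d ℓ) (rhoModel d ℓ) m a u

/-- The infinite rotationally symmetric smooth cone with vertex `0`, axis the `k`-th
coordinate direction and opening angle `γ`. -/
def smoothConeInf (d : ℕ) (k : Fin d) (γ : ℝ) : Set (Ed d) :=
  {x | 0 < ‖x‖ ∧ ‖x‖ * Real.cos (γ / 2) < x k}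

/-- The open unit cube `(0,1)^d`. -/
def unitCube (d : ℕ) : Set (Ed d) := {x | ∀ i, 0 < x i ∧ x i < 1}

/-- The segment `Γ = {(0,…,0,x_k) : 0 ≤ x_k ≤ 1}` on the `k`-th coordinate axis. -/
def gammaSeg (d : ℕ) (k : Fin d) : Set (Ed d) :=
  {x | (∀ i, i ≠ k → x i = 0) ∧ 0 ≤ x k ∧ x k ≤ 1}

/-- `|(x_i)_{i ≠ k}|`, the distance of `x` to the `k`-th coordinate axis. -/
def rhoAxis (d : ℕ) (k : Fin d) (x : Ed d) : ℝ :=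
  Real.sqrt (∑ i ∈ Finset.univ.filter (fun i => i ≠ k), (x i) ^ 2)

/-- `|x'| = |(x_1,…,x_{d-ℓ})|`, the distance of `x` to `ℝ^ℓ_*`. -/
def rhoPrime (d ℓ : ℕ) (x : Ed d) : ℝ :=
  Real.sqrt (∑ i ∈ Finset.univ.filter (fun i : Fin d => (i : ℕ) < d - ℓ), (x i) ^ 2)

/-- The face `M_ℓ = {x ∈ ∂((0,1)^d) : x_1 = ⋯ = x_{d-ℓ} = 0}` of the unit cube. -/
def cubeFace (d ℓ : ℕ) : Set (Ed d) :=
  {x ∈ frontier (unitCube d) | ∀ i : Fin d, (i : ℕ) < d - ℓ → x i = 0}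

/-- A (pointwise) linear operator on functions. -/
def IsLinearOp (d : ℕ) (E : (Ed d → ℝ) → Ed d → ℝ) : Prop :=
  (∀ u v, E (u + v) = E u + E v) ∧ ∀ (c : ℝ) (u), E (c • u) = c • E u


open scoped ContDiff


/-! ### Partial derivatives and test functions -/

section Basics
variable {d : ℕ}

theorem pderivI_contDiffOn {Ω : Set (Ed d)} (hΩ : IsOpen Ω) {f : Ed d → ℝ}
    (hf : ContDiffOn ℝ ∞ f Ω) (i : Fin d) : ContDiffOn ℝ ∞ (pderivI d i f) Ω := by
  have h := hf.fderiv_of_isOpen hΩ (m := ∞) (by simp)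
  exact h.clm_apply contDiffOn_const

theorem pderivI_contDiff {f : Ed d → ℝ} (hf : ContDiff ℝ ∞ f) (i : Fin d) :
    ContDiff ℝ ∞ (pderivI d i f) := by
  have h := hf.fderiv_right (m := ∞) (by simp)
  exact h.clm_apply contDiff_const

theorem tsupport_pderivI (i : Fin d) (f : Ed d → ℝ) :
    tsupport (pderivI d i f) ⊆ tsupport f := by
  refine (closure_mono ?_).trans (tsupport_fderiv_subset (𝕜 := ℝ) (f := f))
  intro x hx
  simp only [Function.mem_support, pderivI] at hx ⊢
  intro h; apply hx; simp [h]

theorem IsTestFun.pd {Ω : Set (Ed d)} {φ : Ed d → ℝ} (h : IsTestFun d Ω φ) (i : Fin d) :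
    IsTestFun d Ω (pderivI d i φ) :=
  ⟨pderivI_contDiff h.1 i, h.2.1.mono' ((subset_tsupport _).trans (tsupport_pderivI i φ)),
    (tsupport_pderivI i φ).trans h.2.2⟩

theorem diffAt {Ω : Set (Ed d)} (hΩ : IsOpen Ω) {f : Ed d → ℝ}
    (hf : ContDiffOn ℝ ∞ f Ω) {x : Ed d} (hx : x ∈ Ω) : DifferentiableAt ℝ f x :=
  (hf.contDiffAt (hΩ.mem_nhds hx)).differentiableAt (by simp)

theorem pderivI_mul {f g : Ed d → ℝ} {x : Ed d} (hf : DifferentiableAt ℝ f x)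
    (hg : DifferentiableAt ℝ g x) (i : Fin d) :
    pderivI d i (fun y => f y * g y) x = f x * pderivI d i g x + pderivI d i f x * g x := by
  simp only [pderivI]; rw [fderiv_fun_mul hf hg]; simp [mul_comm]

theorem pderivI_comm {f : Ed d → ℝ} (hf : ContDiff ℝ ∞ f) (i j : Fin d) :
    pderivI d i (pderivI d j f) = pderivI d j (pderivI d i f) := by
  have key : ∀ (i j : Fin d) (x : Ed d), pderivI d i (pderivI d j f) x =
      fderiv ℝ (fderiv ℝ f) x (EuclideanSpace.single i 1) (EuclideanSpace.single j 1) := by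
    intro i j x
    have hd : DifferentiableAt ℝ (fderiv ℝ f) x :=
      ((hf.fderiv_right (m := ∞) (by simp)).differentiable (by simp)) x
    unfold pderivI
    rw [fderiv_clm_apply hd (differentiableAt_const _)]
    simp
  funext x
  rw [key, key]
  have hs : IsSymmSndFDerivAt ℝ f x := hf.contDiffAt.isSymmSndFDerivAt (by simp; exact WithTop.coe_le_coe.2 le_top)
  exact hs _ _

/-- a smooth function on `Ω` times a test function on `Ω`. -/
theorem IsTestFun.mul_left {Ω : Set (Ed d)} (hΩ : IsOpen Ω) {f φ : Ed d → ℝ}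
    (hf : ContDiffOn ℝ ∞ f Ω) (h : IsTestFun d Ω φ) :
    IsTestFun d Ω (fun x => f x * φ x) := by
  have hsub : tsupport (fun x => f x * φ x) ⊆ tsupport φ := by
    apply closure_mono
    intro x hx
    simp only [Function.mem_support] at hx ⊢
    exact right_ne_zero_of_mul hx
  refine ⟨?_, h.2.1.mono' ((subset_tsupport _).trans hsub), hsub.trans h.2.2⟩
  rw [contDiff_iff_contDiffAt]
  intro x
  by_cases hx : x ∈ tsupport φ
  · exact (hf.contDiffAt (hΩ.mem_nhds (h.2.2 hx))).mul h.1.contDiffAt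
  · have : (fun x => f x * φ x) =ᶠ[𝓝 x] fun _ => 0 := by
      have := notMem_tsupport_iff_eventuallyEq.1 hx
      filter_upwards [this] with y hy
      simp [hy]
    exact contDiffAt_const.congr_of_eventuallyEq this

theorem IsTestFun.eq_zero {Ω : Set (Ed d)} {φ : Ed d → ℝ} (h : IsTestFun d Ω φ) {x : Ed d}
    (hx : x ∉ Ω) : φ x = 0 :=
  image_eq_zero_of_notMem_tsupport fun hh => hx (h.2.2 hh)

theorem IsTestFun.integrable {Ω : Set (Ed d)} {φ : Ed d → ℝ} (h : IsTestFun d Ω φ) :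
    Integrable φ volume :=
  h.1.continuous.integrable_of_hasCompactSupport h.2.1

theorem IsTestFun.mono {Ω Ω' : Set (Ed d)} {φ : Ed d → ℝ} (h : IsTestFun d Ω φ) (hs : Ω ⊆ Ω') :
    IsTestFun d Ω' φ := ⟨h.1, h.2.1, h.2.2.trans hs⟩

theorem IsTestFun.setIntegral_mul {Ω : Set (Ed d)} {φ : Ed d → ℝ} (h : IsTestFun d Ω φ)
    (u : Ed d → ℝ) : ∫ x in Ω, u x * φ x = ∫ x, u x * φ x := by
  apply setIntegral_eq_integral_of_forall_compl_eq_zero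
  intro x hx
  rw [h.eq_zero hx, mul_zero]

/-- integration by parts with smooth functions, one of which is a test function. -/
theorem integral_by_parts {Ω : Set (Ed d)} (hΩ : IsOpen Ω) {f φ : Ed d → ℝ}
    (hf : ContDiffOn ℝ ∞ f Ω) (h : IsTestFun d Ω φ) (i : Fin d) :
    ∫ x in Ω, f x * pderivI d i φ x = - ∫ x in Ω, pderivI d i f x * φ x := by
  have hT := h.mul_left hΩ hf
  have h1 : ∫ x, pderivI d i (fun x => f x * φ x) x = 0 := by
    have := integral_mul_fderiv_eq_neg_fderiv_mul_of_integrable (μ := (volume : Measure (Ed d)))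
      (f := fun _ : Ed d => (1 : ℝ)) (g := fun x => f x * φ x) (v := EuclideanSpace.single i 1)
      (by simp) (by simp only [one_mul]; exact (hT.pd i).integrable) (by simpa using hT.integrable)
      (by fun_prop) (fun x _ => hT.1.differentiable (by simp) x)
    simpa [pderivI] using this
  have hz : ∀ x ∉ Ω, pderivI d i (fun x => f x * φ x) x = 0 :=
    fun x hx => (hT.pd i).eq_zero hx
  rw [← setIntegral_eq_integral_of_forall_compl_eq_zero hz] at h1
  have h2 : ∫ x in Ω, pderivI d i (fun x => f x * φ x) x =
      ∫ x in Ω, (f x * pderivI d i φ x + pderivI d i f x * φ x) := by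
    apply setIntegral_congr_fun hΩ.measurableSet
    intro x hx
    exact pderivI_mul (diffAt hΩ hf hx) ((h.1.differentiable (by simp)) x) i
  rw [h2, integral_add] at h1
  · linarith
  · exact ((h.pd i).mul_left hΩ hf).integrable.integrableOn
  · exact (h.mul_left hΩ (pderivI_contDiffOn hΩ hf i)).integrable.integrableOn

theorem pderivI_eq_of_eventuallyEq {f g : Ed d → ℝ} {x : Ed d} (h : f =ᶠ[𝓝 x] g) (i : Fin d) :
    pderivI d i f x = pderivI d i g x := by
  unfold pderivI
  rw [h.fderiv_eq]

end Basics


/-! ### The recursive boundedness predicate -/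

section Core
variable {d : ℕ}

/-- Weak first order derivative on `Ω`. -/
def WD (Ω : Set (Ed d)) (i : Fin d) (u v : Ed d → ℝ) : Prop :=
  ∀ φ, IsTestFun d Ω φ → ∫ x in Ω, u x * pderivI d i φ x = -∫ x in Ω, v x * φ x

/-- Weighted `L_P` bound. -/
def L0 (Ω : Set (Ed d)) (w : Ed d → ℝ) (P : ℝ≥0∞) (s : ℝ) (u : Ed d → ℝ) (N : ℝ≥0) : Prop :=
  AEStronglyMeasurable u (volume.restrict Ω) ∧
    eLpNorm (fun x => w x ^ s * u x) P (volume.restrict Ω) ≤ N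

/-- Recursive Kondratiev bound. -/
def KB (Ω : Set (Ed d)) (w : Ed d → ℝ) (P : ℝ≥0∞) : ℕ → ℝ → (Ed d → ℝ) → ℝ≥0 → Prop
  | 0, s, u, N => L0 Ω w P s u N
  | m + 1, s, u, N => L0 Ω w P s u N ∧ ∀ i, ∃ v, WD Ω i u v ∧ KB Ω w P m (s + 1) v N

/-- An open set with a positive continuous weight. -/
structure GoodW (Ω : Set (Ed d)) (w : Ed d → ℝ) : Prop where
  op : IsOpen Ω
  cont : ContinuousOn w Ω
  pos : ∀ x ∈ Ω, 0 < w x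

theorem GoodW.mono {Ω Ω' : Set (Ed d)} {w : Ed d → ℝ} (h : GoodW Ω w) (ho : IsOpen Ω')
    (hs : Ω' ⊆ Ω) : GoodW Ω' w := ⟨ho, h.cont.mono hs, fun x hx => h.pos x (hs hx)⟩

theorem GoodW.rpow {Ω : Set (Ed d)} {w : Ed d → ℝ} (h : GoodW Ω w) (s : ℝ) :
    ContinuousOn (fun x => w x ^ s) Ω :=
  h.cont.rpow_const fun x hx => Or.inl (h.pos x hx).ne'

theorem L0.mono {Ω : Set (Ed d)} {w : Ed d → ℝ} {P : ℝ≥0∞} {s : ℝ} {u : Ed d → ℝ} {N N' : ℝ≥0}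
    (h : L0 Ω w P s u N) (hN : N ≤ N') : L0 Ω w P s u N' :=
  ⟨h.1, h.2.trans (by exact_mod_cast hN)⟩

theorem KB.l0 {Ω : Set (Ed d)} {w : Ed d → ℝ} {P : ℝ≥0∞} {m : ℕ} {s : ℝ} {u : Ed d → ℝ} {N : ℝ≥0}
    (h : KB Ω w P m s u N) : L0 Ω w P s u N := by
  cases m with
  | zero => exact h
  | succ m => exact h.1

theorem KB.mono {Ω : Set (Ed d)} {w : Ed d → ℝ} {P : ℝ≥0∞} {m : ℕ} {s : ℝ} {u : Ed d → ℝ}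
    {N N' : ℝ≥0} (h : KB Ω w P m s u N) (hN : N ≤ N') : KB Ω w P m s u N' := by
  induction m generalizing s u with
  | zero => exact L0.mono h hN
  | succ m ih =>
    refine ⟨h.1.mono hN, fun i => ?_⟩
    obtain ⟨v, hv, hk⟩ := h.2 i
    exact ⟨v, hv, ih hk⟩

theorem KB.pred {Ω : Set (Ed d)} {w : Ed d → ℝ} {P : ℝ≥0∞} {m : ℕ} {s : ℝ} {u : Ed d → ℝ}
    {N : ℝ≥0} (h : KB Ω w P (m + 1) s u N) : KB Ω w P m s u N := by
  induction m generalizing s u with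
  | zero => exact h.1
  | succ m ih =>
    refine ⟨h.1, fun i => ?_⟩
    obtain ⟨v, hv, hk⟩ := h.2 i
    exact ⟨v, hv, ih hk⟩

theorem L0.congr {Ω : Set (Ed d)} {w : Ed d → ℝ} {P : ℝ≥0∞} {s : ℝ} {u u' : Ed d → ℝ} {N : ℝ≥0}
    (h : L0 Ω w P s u N) (he : u =ᵐ[volume.restrict Ω] u') : L0 Ω w P s u' N := by
  refine ⟨h.1.congr he, ?_⟩
  rw [← eLpNorm_congr_ae (f := fun x => w x ^ s * u x)]
  · exact h.2
  · filter_upwards [he] with x hx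
    rw [hx]

theorem WD.congr {Ω : Set (Ed d)} {i : Fin d} {u u' v : Ed d → ℝ}
    (h : WD Ω i u v) (he : u =ᵐ[volume.restrict Ω] u') : WD Ω i u' v := by
  intro φ hφ
  rw [← h φ hφ]
  apply integral_congr_ae
  filter_upwards [he] with x hx
  rw [hx]

theorem WD.congr_right {Ω : Set (Ed d)} {i : Fin d} {u v v' : Ed d → ℝ}
    (h : WD Ω i u v) (he : v =ᵐ[volume.restrict Ω] v') : WD Ω i u v' := by
  intro φ hφ
  rw [h φ hφ]
  congr 1
  apply integral_congr_ae
  filter_upwards [he] with x hx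
  rw [hx]

theorem KB.congr {Ω : Set (Ed d)} {w : Ed d → ℝ} {P : ℝ≥0∞} {m : ℕ} {s : ℝ} {u u' : Ed d → ℝ}
    {N : ℝ≥0} (h : KB Ω w P m s u N) (he : u =ᵐ[volume.restrict Ω] u') : KB Ω w P m s u' N := by
  cases m with
  | zero => exact L0.congr h he
  | succ m =>
    refine ⟨h.1.congr he, fun i => ?_⟩
    obtain ⟨v, hv, hk⟩ := h.2 i
    exact ⟨v, hv.congr he, hk⟩

theorem GoodW.aesm {Ω : Set (Ed d)} {w : Ed d → ℝ} (h : GoodW Ω w) {f : Ed d → ℝ}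
    (hf : ContinuousOn f Ω) : AEStronglyMeasurable f (volume.restrict Ω) :=
  hf.aestronglyMeasurable h.op.measurableSet

/-- quantitative local integrability up to the boundary -/
theorem L0.lint_le {U Ω : Set (Ed d)} {w : Ed d → ℝ} (hU : GoodW U w) (hΩ : MeasurableSet Ω)
    (hs : Ω ⊆ U) {P : ℝ≥0∞} (hP : 1 ≤ P) (s : ℝ) {K : Set (Ed d)} (hK : IsCompact K)
    (hKU : K ⊆ U) : ∃ C : ℝ≥0, ∀ u N, L0 Ω w P s u N →
      ∫⁻ x in K ∩ Ω, ‖u x‖ₑ ≤ C * N := by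
  obtain ⟨A, hA⟩ := hK.exists_bound_of_continuousOn ((hU.rpow (-s)).mono hKU)
  have hfin : volume (K ∩ Ω) ≠ ⊤ :=
    ((measure_mono inter_subset_left).trans_lt hK.measure_lt_top).ne
  set B : ℝ≥0∞ := (volume (K ∩ Ω)) ^ ((1 : ℝ) - 1 / P.toReal) with hB
  have hBf : B ≠ ⊤ := by
    apply ENNReal.rpow_ne_top_of_nonneg _ hfin
    by_cases hPt : P = ⊤
    · simp [hPt]
    · have : 1 ≤ P.toReal := by
        rw [← ENNReal.toReal_one]
        exact ENNReal.toReal_mono hPt hP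
      rw [sub_nonneg, div_le_one (by linarith)]
      exact this
  refine ⟨A.toNNReal * B.toNNReal, fun u N h => ?_⟩
  have hmeas : MeasurableSet (K ∩ Ω) := hK.measurableSet.inter hΩ
  have hms : AEStronglyMeasurable (fun x => w x ^ s * u x) (volume.restrict (K ∩ Ω)) := by
    refine (((hU.rpow s).mono (inter_subset_right.trans hs)).aestronglyMeasurable hmeas).mul ?_
    exact h.1.mono_measure (Measure.restrict_mono inter_subset_right le_rfl)
  have h1 : ∫⁻ x in K ∩ Ω, ‖u x‖ₑ ≤ A.toNNReal * ∫⁻ x in K ∩ Ω, ‖w x ^ s * u x‖ₑ := by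
    rw [← lintegral_const_mul'' _ hms.enorm]
    apply setLIntegral_mono_ae' hmeas
    refine Eventually.of_forall fun x hx => ?_
    have hw : 0 < w x := hU.pos x (hKU hx.1)
    have h2 : u x = w x ^ (-s) * (w x ^ s * u x) := by
      rw [← mul_assoc, ← Real.rpow_add hw]; simp
    conv_lhs => rw [h2, enorm_mul]
    gcongr
    rw [← ofReal_norm]
    exact ENNReal.ofReal_le_ofReal (hA x hx.1)
  have h3 : ∫⁻ x in K ∩ Ω, ‖w x ^ s * u x‖ₑ ≤ N * B := by
    rw [← eLpNorm_one_eq_lintegral_enorm]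
    refine (eLpNorm_le_eLpNorm_mul_rpow_measure_univ hP hms).trans ?_
    simp only [Measure.restrict_apply_univ, ENNReal.toReal_one, div_one]
    gcongr
    · exact (eLpNorm_mono_measure _ (Measure.restrict_mono inter_subset_right le_rfl)).trans h.2
  calc _ ≤ _ := h1
    _ ≤ A.toNNReal * (N * B) := by gcongr
    _ = _ := by
      push_cast
      rw [ENNReal.coe_toNNReal hBf]; ring

theorem L0.integrableOn {U Ω : Set (Ed d)} {w : Ed d → ℝ} (hU : GoodW U w) (hΩ : MeasurableSet Ω)
    (hs : Ω ⊆ U) {P : ℝ≥0∞} (hP : 1 ≤ P) {s : ℝ} {K : Set (Ed d)} (hK : IsCompact K)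
    (hKU : K ⊆ U) {u : Ed d → ℝ} {N : ℝ≥0} (h : L0 Ω w P s u N) : IntegrableOn u (K ∩ Ω) := by
  obtain ⟨C, hC⟩ := L0.lint_le hU hΩ hs hP s hK hKU
  refine ⟨h.1.mono_measure (Measure.restrict_mono inter_subset_right le_rfl), ?_⟩
  exact (hC u N h).trans_lt (by
    rw [← ENNReal.coe_mul]; exact ENNReal.coe_lt_top)

/-- products with compactly supported continuous functions are integrable -/
theorem L0.integrable_mul {U Ω : Set (Ed d)} {w : Ed d → ℝ} (hU : GoodW U w)
    (hΩ : MeasurableSet Ω)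
    (hs : Ω ⊆ U) {P : ℝ≥0∞} (hP : 1 ≤ P) {s : ℝ} {φ : Ed d → ℝ} (hφ : Continuous φ)
    (hc : HasCompactSupport φ) (hKU : tsupport φ ⊆ U)
    {u : Ed d → ℝ} {N : ℝ≥0} (h : L0 Ω w P s u N) : IntegrableOn (fun x => u x * φ x) Ω := by
  have h1 := h.integrableOn hU hΩ hs hP hc hKU
  have hm : MeasurableSet (tsupport φ ∩ Ω) := hc.measurableSet.inter hΩ
  have h2 : IntegrableOn (fun x => u x * φ x) (tsupport φ ∩ Ω) :=
    h1.mul_continuousOn_of_subset (K := tsupport φ) hφ.continuousOn hm hc inter_subset_left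
  refine h2.of_forall_sdiff_eq_zero hΩ fun x hx => ?_
  have : x ∉ tsupport φ := fun hh => hx.2 ⟨hh, hx.1⟩
  simp [image_eq_zero_of_notMem_tsupport this]

theorem L0.integrable_test {Ω : Set (Ed d)} {w : Ed d → ℝ} (hU : GoodW Ω w)
    {P : ℝ≥0∞} (hP : 1 ≤ P) {s : ℝ} {φ : Ed d → ℝ} (hφ : IsTestFun d Ω φ)
    {u : Ed d → ℝ} {N : ℝ≥0} (h : L0 Ω w P s u N) : IntegrableOn (fun x => u x * φ x) Ω :=
  h.integrable_mul hU hU.op.measurableSet subset_rfl hP hφ.1.continuous hφ.2.1 hφ.2.2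

theorem L0.add {Ω : Set (Ed d)} {w : Ed d → ℝ} (hU : GoodW Ω w)
    {P : ℝ≥0∞} (hP : 1 ≤ P) {s : ℝ} {u v : Ed d → ℝ} {N N' : ℝ≥0}
    (h : L0 Ω w P s u N) (h' : L0 Ω w P s v N') : L0 Ω w P s (u + v) (N + N') := by
  refine ⟨h.1.add h'.1, ?_⟩
  have he : (fun x => w x ^ s * (u + v) x) = (fun x => w x ^ s * u x) + fun x => w x ^ s * v x := by
    funext x; simp [mul_add]
  rw [he]
  refine (eLpNorm_add_le ((hU.aesm (hU.rpow s)).mul h.1) ((hU.aesm (hU.rpow s)).mul h'.1) hP).trans ?_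
  push_cast
  exact add_le_add h.2 h'.2

theorem KB.add {Ω : Set (Ed d)} {w : Ed d → ℝ} (hU : GoodW Ω w)
    {P : ℝ≥0∞} (hP : 1 ≤ P) {m : ℕ} {s : ℝ} {u v : Ed d → ℝ} {N N' : ℝ≥0}
    (h : KB Ω w P m s u N) (h' : KB Ω w P m s v N') : KB Ω w P m s (u + v) (N + N') := by
  induction m generalizing s u v with
  | zero => exact L0.add hU hP h h'
  | succ m ih =>
    refine ⟨h.1.add hU hP h'.1, fun i => ?_⟩
    obtain ⟨u1, hu, hk⟩ := h.2 i
    obtain ⟨v1, hv, hk'⟩ := h'.2 i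
    refine ⟨u1 + v1, ?_, ih hk hk'⟩
    intro φ hφ
    simp only [Pi.add_apply, add_mul]
    rw [integral_add (h.1.integrable_test hU hP (hφ.pd i)) (h'.1.integrable_test hU hP (hφ.pd i)),
      integral_add (hk.l0.integrable_test hU hP hφ) (hk'.l0.integrable_test hU hP hφ),
      hu φ hφ, hv φ hφ]
    ring

theorem KB.zero {Ω : Set (Ed d)} {w : Ed d → ℝ} {P : ℝ≥0∞} {m : ℕ} {s : ℝ} :
    KB Ω w P m s (0 : Ed d → ℝ) 0 := by
  have h0 : ∀ s, L0 Ω w P s (0 : Ed d → ℝ) 0 := fun s =>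
    ⟨aestronglyMeasurable_zero, by simp⟩
  induction m generalizing s with
  | zero => exact h0 s
  | succ m ih =>
    exact ⟨h0 s, fun i => ⟨0, fun φ _ => by simp, ih⟩⟩

theorem KB.sum {Ω : Set (Ed d)} {w : Ed d → ℝ} (hU : GoodW Ω w)
    {P : ℝ≥0∞} (hP : 1 ≤ P) {m : ℕ} {s : ℝ} {ι : Type*} (F : Finset ι) {u : ι → Ed d → ℝ}
    {N : ι → ℝ≥0} (h : ∀ j ∈ F, KB Ω w P m s (u j) (N j)) :
    KB Ω w P m s (∑ j ∈ F, u j) (∑ j ∈ F, N j) := by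
  classical
  induction F using Finset.induction_on with
  | empty => simpa using KB.zero
  | insert a F ha ih =>
    rw [Finset.sum_insert ha, Finset.sum_insert ha]
    exact KB.add hU hP (h a (by simp)) (ih fun j hj => h j (by simp [hj]))

/-- bounded operators on the whole scale -/
def Bdd (Ω : Set (Ed d)) (w : Ed d → ℝ) (Ω' : Set (Ed d)) (w' : Ed d → ℝ)
    (T : (Ed d → ℝ) →ₗ[ℝ] (Ed d → ℝ)) : Prop :=
  ∀ P : ℝ≥0∞, 1 ≤ P → P ≠ ⊤ → ∀ (m : ℕ) (s : ℝ), ∃ C : ℝ≥0, ∀ u N,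
    KB Ω w P m s u N → KB Ω' w' P m s (T u) (C * N)

theorem Bdd.comp {Ω Ω' Ω'' : Set (Ed d)} {w w' w'' : Ed d → ℝ}
    {T S : (Ed d → ℝ) →ₗ[ℝ] (Ed d → ℝ)} (hS : Bdd Ω' w' Ω'' w'' S) (hT : Bdd Ω w Ω' w' T) :
    Bdd Ω w Ω'' w'' (S ∘ₗ T) := by
  intro P h1 h2 m s
  obtain ⟨C, hC⟩ := hT P h1 h2 m s
  obtain ⟨C', hC'⟩ := hS P h1 h2 m s
  refine ⟨C' * C, fun u N h => ?_⟩
  have := hC' _ _ (hC u N h)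
  rwa [mul_assoc]

theorem Bdd.add {Ω Ω' : Set (Ed d)} {w w' : Ed d → ℝ} (hU : GoodW Ω' w')
    {T S : (Ed d → ℝ) →ₗ[ℝ] (Ed d → ℝ)} (hS : Bdd Ω w Ω' w' S) (hT : Bdd Ω w Ω' w' T) :
    Bdd Ω w Ω' w' (S + T) := by
  intro P h1 h2 m s
  obtain ⟨C, hC⟩ := hT P h1 h2 m s
  obtain ⟨C', hC'⟩ := hS P h1 h2 m s
  refine ⟨C' + C, fun u N h => ?_⟩
  rw [add_mul]
  exact KB.add hU h1 (hC' u N h) (hC u N h)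

end Core


/-! ### Symbols and cut-off operators -/

section Cut
variable {d : ℕ}

/-- iterated partial derivatives along a list -/
def pdL : List (Fin d) → (Ed d → ℝ) → Ed d → ℝ
  | [], f => f
  | i :: l, f => pdL l (pderivI d i f)

/-- Smooth functions on `Ω` of order `r` with respect to the weight `w`. -/
def KSym (Ω : Set (Ed d)) (w : Ed d → ℝ) (r : ℝ) (χ : Ed d → ℝ) : Prop :=
  ContDiffOn ℝ ∞ χ Ω ∧ ∀ l : List (Fin d), ∃ C : ℝ, 0 ≤ C ∧ ∀ x ∈ Ω,
    |pdL l χ x| ≤ C * w x ^ (r - l.length)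

theorem KSym.pd {Ω : Set (Ed d)} {w : Ed d → ℝ} {r : ℝ} {χ : Ed d → ℝ} (h : KSym Ω w r χ)
    (ho : IsOpen Ω) (i : Fin d) : KSym Ω w (r - 1) (pderivI d i χ) := by
  refine ⟨pderivI_contDiffOn ho h.1 i, fun l => ?_⟩
  obtain ⟨C, hC, hb⟩ := h.2 (i :: l)
  refine ⟨C, hC, fun x hx => ?_⟩
  have := hb x hx
  simp only [pdL, List.length_cons, Nat.cast_add, Nat.cast_one] at this
  rwa [show r - 1 - (l.length : ℝ) = r - (l.length + 1) by ring]

theorem KSym.bound {Ω : Set (Ed d)} {w : Ed d → ℝ} {r : ℝ} {χ : Ed d → ℝ} (h : KSym Ω w r χ) :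
    ∃ C : ℝ, 0 ≤ C ∧ ∀ x ∈ Ω, |χ x| ≤ C * w x ^ r := by
  simpa [pdL] using h.2 []

theorem KSym.of_closed {Ω : Set (Ed d)} {w : Ed d → ℝ} (Q : ℝ → (Ed d → ℝ) → Prop)
    (h0 : ∀ r χ, Q r χ → ∃ C : ℝ, 0 ≤ C ∧ ∀ x ∈ Ω, |χ x| ≤ C * w x ^ r)
    (h1 : ∀ r χ, Q r χ → ∀ i, Q (r - 1) (pderivI d i χ)) {r : ℝ} {χ : Ed d → ℝ} (hQ : Q r χ)
    (hs : ContDiffOn ℝ ∞ χ Ω) : KSym Ω w r χ := by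
  refine ⟨hs, fun l => ?_⟩
  clear hs
  induction l generalizing r χ with
  | nil => simpa [pdL] using h0 r χ hQ
  | cons i l ih =>
    obtain ⟨C, hC, hb⟩ := ih (h1 r χ hQ i)
    refine ⟨C, hC, fun x hx => ?_⟩
    have := hb x hx
    simp only [pdL, List.length_cons, Nat.cast_add, Nat.cast_one]
    rwa [show r - ((l.length : ℝ) + 1) = r - 1 - l.length by ring]

theorem pderivI_congr_on {Ω : Set (Ed d)} (ho : IsOpen Ω) {f g : Ed d → ℝ} (h : EqOn f g Ω)
    (i : Fin d) : EqOn (pderivI d i f) (pderivI d i g) Ω := fun _ hx =>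
  pderivI_eq_of_eventuallyEq (h.eventuallyEq_of_mem (ho.mem_nhds hx)) i

theorem KSym.congr {Ω : Set (Ed d)} {w : Ed d → ℝ} {r : ℝ} {χ χ' : Ed d → ℝ} (h : KSym Ω w r χ)
    (ho : IsOpen Ω) (he : EqOn χ' χ Ω) : KSym Ω w r χ' := by
  refine KSym.of_closed (fun r f => ∃ g, KSym Ω w r g ∧ EqOn f g Ω) ?_ ?_ ⟨χ, h, he⟩ (h.1.congr he)
  · rintro r f ⟨g, hg, hfg⟩
    obtain ⟨C, hC, hb⟩ := hg.bound
    exact ⟨C, hC, fun x hx => by rw [hfg hx]; exact hb x hx⟩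
  · rintro r f ⟨g, hg, hfg⟩ i
    exact ⟨_, hg.pd ho i, pderivI_congr_on ho hfg i⟩

theorem KSym.mono {Ω Ω' : Set (Ed d)} {w : Ed d → ℝ} {r : ℝ} {χ : Ed d → ℝ} (h : KSym Ω w r χ)
    (hs : Ω' ⊆ Ω) : KSym Ω' w r χ := by
  refine ⟨h.1.mono hs, fun l => ?_⟩
  obtain ⟨C, hC, hb⟩ := h.2 l
  exact ⟨C, hC, fun x hx => hb x (hs hx)⟩

theorem KSym.add {Ω : Set (Ed d)} {w : Ed d → ℝ} {r : ℝ} {χ χ' : Ed d → ℝ} (h : KSym Ω w r χ)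
    (h' : KSym Ω w r χ') (ho : IsOpen Ω) : KSym Ω w r (fun x => χ x + χ' x) := by
  refine KSym.of_closed (fun r f => ∃ g g', KSym Ω w r g ∧ KSym Ω w r g' ∧
      EqOn f (fun x => g x + g' x) Ω) ?_ ?_
    ⟨χ, χ', h, h', fun x _ => rfl⟩ (h.1.add h'.1)
  · rintro r f ⟨g, g', hg, hg', hfg⟩
    obtain ⟨C, hC, hb⟩ := hg.bound
    obtain ⟨C', hC', hb'⟩ := hg'.bound
    refine ⟨C + C', by positivity, fun x hx => ?_⟩
    rw [hfg hx, add_mul]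
    exact (abs_add_le _ _).trans (add_le_add (hb x hx) (hb' x hx))
  · rintro r f ⟨g, g', hg, hg', hfg⟩ i
    refine ⟨_, _, hg.pd ho i, hg'.pd ho i, fun x hx => ?_⟩
    rw [pderivI_congr_on ho hfg i hx]
    simp only [pderivI]
    rw [fderiv_fun_add (diffAt ho hg.1 hx) (diffAt ho hg'.1 hx)]
    rfl

theorem KSym.const_mul {Ω : Set (Ed d)} {w : Ed d → ℝ} {r : ℝ} {χ : Ed d → ℝ} (h : KSym Ω w r χ)
    (ho : IsOpen Ω) (c : ℝ) : KSym Ω w r (fun x => c * χ x) := by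
  refine KSym.of_closed (fun r f => ∃ g, KSym Ω w r g ∧
      EqOn f (fun x => c * g x) Ω) ?_ ?_
    ⟨χ, h, fun x _ => rfl⟩ (contDiffOn_const.mul h.1)
  · rintro r f ⟨g, hg, hfg⟩
    obtain ⟨C, hC, hb⟩ := hg.bound
    refine ⟨|c| * C, by positivity, fun x hx => ?_⟩
    rw [hfg hx, abs_mul, mul_assoc]
    exact mul_le_mul_of_nonneg_left (hb x hx) (abs_nonneg _)
  · rintro r f ⟨g, hg, hfg⟩ i
    refine ⟨_, hg.pd ho i, fun x hx => ?_⟩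
    rw [pderivI_congr_on ho hfg i hx]
    simp only [pderivI]
    rw [fderiv_const_mul (diffAt ho hg.1 hx)]
    rfl

theorem KSym.const {Ω : Set (Ed d)} {w : Ed d → ℝ} (c : ℝ) :
    KSym Ω w 0 (fun _ => c) := by
  refine KSym.of_closed (fun r f => (r = 0 ∧ ∃ c, f = fun _ => c) ∨ f = fun _ => 0) ?_ ?_
    (Or.inl ⟨rfl, c, rfl⟩) contDiffOn_const
  · rintro r f (⟨rfl, c, rfl⟩ | rfl)
    · exact ⟨|c|, abs_nonneg _, fun x _ => by simp⟩
    · exact ⟨0, le_rfl, fun x _ => by simp⟩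
  · rintro r f (⟨rfl, c, rfl⟩ | rfl) i
    · right; funext x; simp [pderivI]
    · right; funext x; simp [pderivI]

/-- multiplication by a cut-off, extended by zero -/
def cutL (Ω : Set (Ed d)) (χ : Ed d → ℝ) : (Ed d → ℝ) →ₗ[ℝ] (Ed d → ℝ) where
  toFun u := Ω.indicator fun x => χ x * u x
  map_add' u v := by
    funext x; by_cases hx : x ∈ Ω <;> simp [hx, mul_add]
  map_smul' c u := by
    funext x; by_cases hx : x ∈ Ω <;> simp [hx]; ring

theorem cutL_of_mem {Ω : Set (Ed d)} {χ u : Ed d → ℝ} {x : Ed d} (hx : x ∈ Ω) :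
    cutL Ω χ u x = χ x * u x := by simp [cutL, hx]

theorem cutL_of_notMem {Ω : Set (Ed d)} {χ u : Ed d → ℝ} {x : Ed d} (hx : x ∉ Ω) :
    cutL Ω χ u x = 0 := by simp [cutL, hx]

theorem rpow_le_of_comp {a b A : ℝ} (ha : 0 < a) (hb : 0 < b) (hA : 1 ≤ A) (h1 : a ≤ A * b)
    (h2 : b ≤ A * a) (s : ℝ) : a ^ s ≤ A ^ |s| * b ^ s := by
  have hA0 : 0 < A := by linarith
  rcases le_total 0 s with hs | hs
  · rw [abs_of_nonneg hs, ← Real.mul_rpow hA0.le hb.le]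
    exact Real.rpow_le_rpow ha.le h1 hs
  · rw [abs_of_nonpos hs, Real.rpow_neg hA0.le, ← Real.inv_rpow hA0.le,
      ← Real.mul_rpow (by positivity) hb.le]
    refine Real.rpow_le_rpow_of_nonpos (by positivity) ?_ hs
    rw [inv_mul_le_iff₀ hA0]; exact h2

theorem L0.cut {Ω Ω' : Set (Ed d)} {w w' : Ed d → ℝ} (hΩ : GoodW Ω w) (hΩ' : GoodW Ω' w')
    {χ : Ed d → ℝ} (hχ : ContinuousOn χ Ω') (hsup : Ω' ∩ tsupport χ ⊆ Ω) {A : ℝ} (hA : 1 ≤ A)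
    (hw : ∀ x ∈ Ω' ∩ tsupport χ, w x ≤ A * w' x ∧ w' x ≤ A * w x)
    {r B : ℝ} (hB : 0 ≤ B) (hb : ∀ x ∈ Ω', |χ x| ≤ B * w' x ^ r) {P : ℝ≥0∞} {s : ℝ}
    {u : Ed d → ℝ} {N : ℝ≥0} (h : L0 Ω w P s u N) :
    L0 Ω' w' P (s - r) (cutL Ω χ u) ((A ^ |s| * B).toNNReal * N) := by
  have hA0 : 0 < A := by linarith
  constructor
  · change AEStronglyMeasurable (Ω.indicator fun x => χ x * u x) _
    rw [aestronglyMeasurable_indicator_iff hΩ.op.measurableSet,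
      Measure.restrict_restrict hΩ.op.measurableSet]
    refine AEStronglyMeasurable.mul ?_ ?_
    · exact (hχ.mono inter_subset_right).aestronglyMeasurable
        (hΩ.op.measurableSet.inter hΩ'.op.measurableSet)
    · exact h.1.mono_measure (Measure.restrict_mono inter_subset_left le_rfl)
  · have h1 : eLpNorm (fun x => w' x ^ (s - r) * cutL Ω χ u x) P (volume.restrict Ω') ≤
        (A ^ |s| * B).toNNReal • eLpNorm (Ω.indicator fun x => w x ^ s * u x) P
          (volume.restrict Ω') := by
      apply eLpNorm_le_nnreal_smul_eLpNorm_of_ae_le_mul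
      filter_upwards [ae_restrict_mem hΩ'.op.measurableSet] with x hx
      rw [← NNReal.coe_le_coe]
      push_cast
      rw [Real.coe_toNNReal _ (by positivity)]
      by_cases hxs : x ∈ tsupport χ
      · have hxΩ := hsup ⟨hx, hxs⟩
        rw [cutL_of_mem hxΩ, indicator_of_mem hxΩ]
        simp only [Real.norm_eq_abs, abs_mul]
        have hp := hΩ.pos x hxΩ
        have hp' := hΩ'.pos x hx
        rw [abs_of_pos (Real.rpow_pos_of_pos hp _), abs_of_pos (Real.rpow_pos_of_pos hp' _)]
        have e1 : w' x ^ (s - r) * |χ x| ≤ B * w' x ^ s := by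
          calc w' x ^ (s - r) * |χ x| ≤ w' x ^ (s - r) * (B * w' x ^ r) := by
                gcongr; exact hb x hx
            _ = B * (w' x ^ (s - r) * w' x ^ r) := by ring
            _ = B * w' x ^ s := by rw [← Real.rpow_add hp']; simp
        have e2 := rpow_le_of_comp hp' hp hA (hw x ⟨hx, hxs⟩).2 (hw x ⟨hx, hxs⟩).1 s
        calc w' x ^ (s - r) * (|χ x| * |u x|) = w' x ^ (s - r) * |χ x| * |u x| := by ring
          _ ≤ B * w' x ^ s * |u x| := by gcongr
          _ ≤ B * (A ^ |s| * w x ^ s) * |u x| := by gcongr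
          _ = _ := by ring
      · have : cutL Ω χ u x = 0 := by
          by_cases hxΩ : x ∈ Ω
          · rw [cutL_of_mem hxΩ, image_eq_zero_of_notMem_tsupport hxs, zero_mul]
          · exact cutL_of_notMem hxΩ
        rw [this]; simp; positivity
    refine h1.trans ?_
    rw [ENNReal.smul_def, smul_eq_mul]
    push_cast
    gcongr
    refine (eLpNorm_mono_measure _ Measure.restrict_le_self).trans ?_
    rw [eLpNorm_indicator_eq_eLpNorm_restrict hΩ.op.measurableSet]
    exact h.2

theorem IsTestFun.cut_mul {Ω Ω' : Set (Ed d)} (hΩ' : IsOpen Ω')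
    {χ : Ed d → ℝ} (hχ : ContDiffOn ℝ ∞ χ Ω') (hsup : Ω' ∩ tsupport χ ⊆ Ω) {φ : Ed d → ℝ}
    (hφ : IsTestFun d Ω' φ) : IsTestFun d Ω (fun x => χ x * φ x) := by
  have h := hφ.mul_left hΩ' hχ
  refine ⟨h.1, h.2.1, fun x hx => hsup ⟨h.2.2 hx, ?_⟩⟩
  exact tsupport_mul_subset_left hx

theorem cutL_integral {Ω Ω' : Set (Ed d)} (hΩ' : IsOpen Ω')
    {χ : Ed d → ℝ} (hχ : ContDiffOn ℝ ∞ χ Ω') (hsup : Ω' ∩ tsupport χ ⊆ Ω) {φ : Ed d → ℝ}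
    (hφ : IsTestFun d Ω' φ) (u : Ed d → ℝ) :
    ∫ x in Ω', cutL Ω χ u x * φ x = ∫ x in Ω, u x * (χ x * φ x) := by
  have h := hφ.cut_mul hΩ' hχ hsup
  rw [h.setIntegral_mul, hφ.setIntegral_mul]
  congr 1
  funext x
  by_cases hx : x ∈ Ω
  · rw [cutL_of_mem hx]; ring
  · rw [cutL_of_notMem hx, h.eq_zero hx]; simp

theorem KB.cut {Ω Ω' : Set (Ed d)} {w w' : Ed d → ℝ} (hΩ : GoodW Ω w) (hΩ' : GoodW Ω' w')
    {A : ℝ} (hA : 1 ≤ A) {P : ℝ≥0∞} (hP : 1 ≤ P) (m : ℕ) :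
    ∀ {χ : Ed d → ℝ} {r : ℝ} (_ : KSym Ω' w' r χ) (_ : Ω' ∩ tsupport χ ⊆ Ω)
    (_ : ∀ x ∈ Ω' ∩ tsupport χ, w x ≤ A * w' x ∧ w' x ≤ A * w x) (s : ℝ), ∃ C : ℝ≥0,
    ∀ u N, KB Ω w P m s u N → KB Ω' w' P m (s - r) (cutL Ω χ u) (C * N) := by
  induction m with
  | zero =>
    intro χ r hχ hsup hw s
    obtain ⟨B, hB, hb⟩ := hχ.bound
    exact ⟨_, fun u N h => L0.cut hΩ hΩ' hχ.1.continuousOn hsup hA hw hB hb h⟩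
  | succ m ih =>
    intro χ r hχ hsup hw s
    obtain ⟨B, hB, hb⟩ := hχ.bound
    obtain ⟨C1, hC1⟩ := ih hχ hsup hw (s + 1)
    have hsub : ∀ i, Ω' ∩ tsupport (pderivI d i χ) ⊆ Ω' ∩ tsupport χ := fun i =>
      inter_subset_inter_right _ (tsupport_pderivI i χ)
    choose C2 hC2 using fun i => ih (hχ.pd hΩ'.op i) ((hsub i).trans hsup)
      (fun x hx => hw x (hsub i hx)) s
    refine ⟨(A ^ |s| * B).toNNReal + (C1 + ∑ i, C2 i), fun u N h => ⟨?_, fun i => ?_⟩⟩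
    · refine (L0.cut hΩ hΩ' hχ.1.continuousOn hsup hA hw hB hb h.1).mono ?_
      gcongr; exact le_self_add
    · obtain ⟨v, hv, hk⟩ := h.2 i
      refine ⟨cutL Ω χ v + cutL Ω (pderivI d i χ) u, ?_, ?_⟩
      · intro φ hφ
        rw [cutL_integral hΩ'.op hχ.1 hsup (hφ.pd i)]
        have hT := hφ.cut_mul hΩ'.op hχ.1 hsup
        have hT2 := hφ.cut_mul hΩ'.op (hχ.pd hΩ'.op i).1 ((hsub i).trans hsup)
        have hT3 := (hφ.pd i).cut_mul hΩ'.op hχ.1 hsup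
        have e1 := hv _ hT
        have e2 : ∫ x in Ω, u x * pderivI d i (fun x => χ x * φ x) x =
            (∫ x in Ω, u x * (χ x * pderivI d i φ x)) +
              ∫ x in Ω, u x * (pderivI d i χ x * φ x) := by
          rw [← integral_add (h.1.integrable_test hΩ hP hT3) (h.1.integrable_test hΩ hP hT2)]
          congr 1
          funext x
          rw [← mul_add]
          congr 1
          by_cases hx : x ∈ tsupport φ
          · exact pderivI_mul (diffAt hΩ'.op hχ.1 (hφ.2.2 hx)) (hφ.1.differentiable (by simp) x) i
          · have h0 : (fun x => χ x * φ x) =ᶠ[𝓝 x] fun _ => 0 := by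
              filter_upwards [notMem_tsupport_iff_eventuallyEq.1 hx] with y hy
              simp [hy]
            rw [pderivI_eq_of_eventuallyEq h0,
              image_eq_zero_of_notMem_tsupport hx,
              image_eq_zero_of_notMem_tsupport fun hh => hx (tsupport_pderivI i φ hh)]
            simp [pderivI]
        have e3 : ∫ x in Ω', (cutL Ω χ v + cutL Ω (pderivI d i χ) u) x * φ x =
            (∫ x in Ω, v x * (χ x * φ x)) + ∫ x in Ω, u x * (pderivI d i χ x * φ x) := by
          rw [← cutL_integral hΩ'.op hχ.1 hsup hφ, ← cutL_integral hΩ'.op (hχ.pd hΩ'.op i).1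
            ((hsub i).trans hsup) hφ, ← integral_add]
          · simp [add_mul]
          · exact (hC1 v N hk).l0.integrable_test hΩ' hP hφ
          · exact (hC2 i u N h.pred).l0.integrable_test hΩ' hP hφ
        rw [e3]
        linarith
      · have k1 := hC1 v N hk
        have k2 := hC2 i u N h.pred
        rw [show s + 1 - r = s - r + 1 by ring] at k1
        rw [show s - (r - 1) = s - r + 1 by ring] at k2
        refine (k1.add hΩ' hP k2).mono ?_
        rw [← add_mul]
        refine mul_le_mul_left ?_ N
        have : C2 i ≤ ∑ i, C2 i := Finset.single_le_sum (fun _ _ => zero_le) (Finset.mem_univ i)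
        calc C1 + C2 i ≤ C1 + ∑ i, C2 i := by gcongr
          _ ≤ _ := le_add_self

theorem Bdd.cut {Ω Ω' : Set (Ed d)} {w w' : Ed d → ℝ} (hΩ : GoodW Ω w) (hΩ' : GoodW Ω' w')
    {χ : Ed d → ℝ} (hχ : KSym Ω' w' 0 χ) (hsup : Ω' ∩ tsupport χ ⊆ Ω) (A : ℝ) (hA : 1 ≤ A)
    (hw : ∀ x ∈ Ω' ∩ tsupport χ, w x ≤ A * w' x ∧ w' x ≤ A * w x) :
    Bdd Ω w Ω' w' (cutL Ω χ) := by
  intro P hP _ m s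
  obtain ⟨C, hC⟩ := KB.cut hΩ hΩ' hA hP m hχ hsup hw s
  exact ⟨C, fun u N h => by simpa using hC u N h⟩

/-- restriction to a smaller set, with change of weight -/
theorem Bdd.restr {Ω Ω' : Set (Ed d)} {w w' : Ed d → ℝ} (hΩ : GoodW Ω w) (hΩ' : GoodW Ω' w')
    (hsub : Ω' ⊆ Ω) (A : ℝ) (hA : 1 ≤ A) (hw : ∀ x ∈ Ω', w x ≤ A * w' x ∧ w' x ≤ A * w x) :
    Bdd Ω w Ω' w' (LinearMap.id) := by
  have h := Bdd.cut hΩ hΩ' (KSym.const 1) (inter_subset_left.trans hsub) A hA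
    (fun x hx => hw x hx.1)
  intro P hP hP' m s
  obtain ⟨C, hC⟩ := h P hP hP' m s
  refine ⟨C, fun u N hk => (hC u N hk).congr ?_⟩
  filter_upwards [ae_restrict_mem hΩ'.op.measurableSet] with x hx
  rw [cutL_of_mem (hsub hx)]; simp

end Cut


/-! ### Conversion between the two descriptions of the Kondratiev norm -/

section Conv
variable {d : ℕ}

/-- auxiliary iterated derivative along a list with multiplicities -/
def pdA (l : List (Fin d)) (α : Fin d → ℕ) (f : Ed d → ℝ) : Ed d → ℝ :=
  (l.foldr (fun i g => (pderivI d i)^[α i] ∘ g) id) f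

theorem pdA_cons (i : Fin d) (l : List (Fin d)) (α : Fin d → ℕ) (f : Ed d → ℝ) :
    pdA (i :: l) α f = (pderivI d i)^[α i] (pdA l α f) := rfl

theorem iter_contDiff {f : Ed d → ℝ} (hf : ContDiff ℝ ∞ f) (i : Fin d) (n : ℕ) :
    ContDiff ℝ ∞ ((pderivI d i)^[n] f) := by
  induction n with
  | zero => exact hf
  | succ n ih => rw [Function.iterate_succ_apply']; exact pderivI_contDiff ih i

theorem iter_comm {f : Ed d → ℝ} (hf : ContDiff ℝ ∞ f) (i j : Fin d) (n : ℕ) :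
    pderivI d j ((pderivI d i)^[n] f) = (pderivI d i)^[n] (pderivI d j f) := by
  induction n with
  | zero => rfl
  | succ n ih =>
    rw [Function.iterate_succ_apply', Function.iterate_succ_apply',
      pderivI_comm (iter_contDiff hf i n) j i, ih]

theorem pdA_contDiff {f : Ed d → ℝ} (hf : ContDiff ℝ ∞ f) (l : List (Fin d)) (α : Fin d → ℕ) :
    ContDiff ℝ ∞ (pdA l α f) := by
  induction l with
  | nil => exact hf
  | cons i l ih => rw [pdA_cons]; exact iter_contDiff ih i _

theorem pdA_comm {f : Ed d → ℝ} (hf : ContDiff ℝ ∞ f) (l : List (Fin d)) (α : Fin d → ℕ)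
    (j : Fin d) : pderivI d j (pdA l α f) = pdA l α (pderivI d j f) := by
  induction l with
  | nil => rfl
  | cons i l ih => rw [pdA_cons, pdA_cons, iter_comm (pdA_contDiff hf l α), ih]

theorem pdA_congr (f : Ed d → ℝ) (l : List (Fin d)) {α β : Fin d → ℕ}
    (h : ∀ i ∈ l, α i = β i) : pdA l α f = pdA l β f := by
  induction l with
  | nil => rfl
  | cons i l ih =>
    rw [pdA_cons, pdA_cons, h i (by simp), ih fun j hj => h j (by simp [hj])]

theorem pdA_add_single {f : Ed d → ℝ} (hf : ContDiff ℝ ∞ f) (l : List (Fin d)) (hl : l.Nodup)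
    (α : Fin d → ℕ) (i : Fin d) (hi : i ∈ l) :
    pdA l (α + Pi.single i 1) f = pdA l α (pderivI d i f) := by
  induction l with
  | nil => simp at hi
  | cons j l ih =>
    rw [List.nodup_cons] at hl
    rw [pdA_cons, pdA_cons]
    by_cases hij : i = j
    · subst hij
      have hc : pdA l (α + Pi.single i 1) f = pdA l α f := by
        apply pdA_congr
        intro k hk
        have : k ≠ i := fun h => hl.1 (h ▸ hk)
        simp [this]
      rw [hc, ← pdA_comm hf]
      simp only [Pi.add_apply, Pi.single_eq_same, Function.iterate_succ_apply]
    · have hi' : i ∈ l := by simpa [hij] using hi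
      rw [ih hl.2 hi']
      have : j ≠ i := fun h => hij h.symm
      simp [this]

theorem pderivA_add_single {f : Ed d → ℝ} (hf : ContDiff ℝ ∞ f) (α : Fin d → ℕ) (i : Fin d) :
    pderivA d (α + Pi.single i 1) f = pderivA d α (pderivI d i f) :=
  pdA_add_single hf _ (List.nodup_finRange d) α i (by simp)

theorem pderivA_add_single' {f : Ed d → ℝ} (hf : ContDiff ℝ ∞ f) (α : Fin d → ℕ) (i : Fin d) :
    pderivA d (α + Pi.single i 1) f = pderivI d i (pderivA d α f) := by
  rw [pderivA_add_single hf]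
  exact (pdA_comm hf _ α i).symm

theorem pderivA_zero (f : Ed d → ℝ) : pderivA d 0 f = f := by
  change pdA (List.finRange d) 0 f = f
  generalize List.finRange d = l
  induction l with
  | nil => rfl
  | cons i l ih => rw [pdA_cons, ih]; rfl

theorem IsTestFun.pA {Ω : Set (Ed d)} {φ : Ed d → ℝ} (h : IsTestFun d Ω φ) (α : Fin d → ℕ) :
    IsTestFun d Ω (pderivA d α φ) := by
  change IsTestFun d Ω (pdA (List.finRange d) α φ)
  generalize List.finRange d = l
  induction l with
  | nil => exact h
  | cons i l ih =>
    rw [pdA_cons]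
    generalize α i = n
    induction n with
    | zero => exact ih
    | succ n ih' => rw [Function.iterate_succ_apply']; exact ih'.pd i

theorem sum_add_single (α : Fin d → ℕ) (i : Fin d) :
    ∑ j, (α + Pi.single i 1 : Fin d → ℕ) j = (∑ j, α j) + 1 := by
  simp [Finset.sum_add_distrib]

theorem mem_multiIdx {m : ℕ} {α : Fin d → ℕ} : α ∈ multiIdx d m ↔ ∑ i, α i ≤ m := by
  simp only [multiIdx, Finset.mem_filter, Fintype.mem_piFinset, Finset.mem_range]
  refine ⟨fun h => h.2, fun h => ⟨fun i => ?_, h⟩⟩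
  have : α i ≤ ∑ i, α i := Finset.single_le_sum (fun _ _ => Nat.zero_le _) (Finset.mem_univ i)
  omega

theorem ae_unique {Ω : Set (Ed d)} (hΩ : IsOpen Ω) {f g : Ed d → ℝ}
    (hf : LocallyIntegrableOn f Ω) (hg : LocallyIntegrableOn g Ω)
    (h : ∀ φ, IsTestFun d Ω φ → ∫ x in Ω, f x * φ x = ∫ x in Ω, g x * φ x) :
    f =ᵐ[volume.restrict Ω] g := by
  have key := hΩ.ae_eq_zero_of_integral_contDiff_smul_eq_zero (hf.sub hg) (fun φ h1 h2 h3 => by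
    have hT : IsTestFun d Ω φ := ⟨h1, h2, h3⟩
    have e := h φ hT
    rw [hT.setIntegral_mul, hT.setIntegral_mul] at e
    have i1 : ∀ {f : Ed d → ℝ}, LocallyIntegrableOn f Ω → Integrable (fun x => f x * φ x) := by
      intro f hf
      have := (hf.integrableOn_compact_subset h3 h2).mul_continuousOn h1.continuous.continuousOn h2
      refine this.integrable_of_forall_notMem_eq_zero fun x hx => ?_
      simp [image_eq_zero_of_notMem_tsupport hx]
    have : (fun x => φ x • (f - g) x) = fun x => f x * φ x - g x * φ x := by
      funext x; simp; ring
    rw [this, integral_sub (i1 hf) (i1 hg), e, sub_self])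
  rw [Filter.EventuallyEq, ae_restrict_iff' hΩ.measurableSet]
  filter_upwards [key] with x hx hxΩ
  have := hx hxΩ
  simpa [sub_eq_zero] using this

theorem kInt_iff {Ω : Set (Ed d)} {w : Ed d → ℝ} (hU : GoodW Ω w) {p : ℝ} (hp : 1 ≤ p) (a : ℝ)
    (α : Fin d → ℕ) {v : Ed d → ℝ} (hv : AEStronglyMeasurable v (volume.restrict Ω)) (N : ℝ≥0) :
    L0 Ω w (ENNReal.ofReal p) (((∑ i, α i : ℕ) : ℝ) - a) v N ↔
      IntegrableOn (kIntegrand d w a p α v) Ω ∧ ∫ x in Ω, kIntegrand d w a p α v x ≤ (N : ℝ) ^ p := by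
  set s : ℝ := ((∑ i, α i : ℕ) : ℝ) - a with hs
  have hp0 : 0 < p := by linarith
  set f : Ed d → ℝ := fun x => w x ^ s * v x with hf
  have hfm : AEStronglyMeasurable f (volume.restrict Ω) := (hU.aesm (hU.rpow s)).mul hv
  have hP0 : ENNReal.ofReal p ≠ 0 := by simpa using hp0
  have hPt : ENNReal.ofReal p ≠ ⊤ := ENNReal.ofReal_ne_top
  have hPr : (ENNReal.ofReal p).toReal = p := ENNReal.toReal_ofReal hp0.le
  have he : ∀ x ∈ Ω, kIntegrand d w a p α v x = ‖f x‖ ^ p := by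
    intro x hx
    simp only [kIntegrand, hf, Real.norm_eq_abs, abs_mul,
      abs_of_pos (Real.rpow_pos_of_pos (hU.pos x hx) s)]
    rfl
  have hi : IntegrableOn (kIntegrand d w a p α v) Ω ↔ MemLp f (ENNReal.ofReal p)
      (volume.restrict Ω) := by
    rw [← integrable_norm_rpow_iff hfm hP0 hPt, hPr]
    exact integrableOn_congr_fun he hU.op.measurableSet
  rw [hi, setIntegral_congr_fun hU.op.measurableSet he]
  have hnn : 0 ≤ ∫ x in Ω, ‖f x‖ ^ p := integral_nonneg fun x => by positivity
  constructor
  · intro h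
    have hm : MemLp f (ENNReal.ofReal p) (volume.restrict Ω) :=
      ⟨hfm, h.2.trans_lt ENNReal.coe_lt_top⟩
    refine ⟨hm, ?_⟩
    have h2 := h.2
    rw [hm.eLpNorm_eq_integral_rpow_norm hP0 hPt, hPr, ENNReal.ofReal_le_coe] at h2
    rwa [← Real.rpow_inv_le_iff_of_pos hnn N.coe_nonneg hp0]
  · rintro ⟨hm, h2⟩
    refine ⟨hv, ?_⟩
    rw [hm.eLpNorm_eq_integral_rpow_norm hP0 hPt, hPr, ENNReal.ofReal_le_coe]
    rwa [Real.rpow_inv_le_iff_of_pos hnn N.coe_nonneg hp0]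

theorem KMemData.kb {Ω : Set (Ed d)} {w : Ed d → ℝ} (hU : GoodW Ω w) {p : ℝ} (hp : 1 ≤ p) {a : ℝ}
    {m : ℕ} {u : Ed d → ℝ} {D : (Fin d → ℕ) → Ed d → ℝ} (h : KMemData d Ω w m a p u D) :
    KB Ω w (ENNReal.ofReal p) m (-a) u (KnormP d Ω w m a p D).toNNReal := by
  have hp0 : 0 < p := by linarith
  have hnn : ∀ α, 0 ≤ ∫ x in Ω, kIntegrand d w a p α (D α) x := by
    intro α
    apply setIntegral_nonneg hU.op.measurableSet
    intro x hx
    have := (Real.rpow_pos_of_pos (hU.pos x hx) (((∑ i, α i : ℕ) : ℝ) - a)).le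
    unfold kIntegrand
    positivity
  set N := (KnormP d Ω w m a p D).toNNReal with hN
  have hNe : (N : ℝ) = KnormP d Ω w m a p D := by
    rw [hN, Real.coe_toNNReal]
    exact Real.rpow_nonneg (Finset.sum_nonneg fun α _ => hnn α) _
  have hNp : (N : ℝ) ^ p = ∑ α ∈ multiIdx d m, ∫ x in Ω, kIntegrand d w a p α (D α) x := by
    rw [hNe, KnormP, ← Real.rpow_mul (Finset.sum_nonneg fun α _ => hnn α)]
    rw [one_div_mul_cancel hp0.ne', Real.rpow_one]
  have hL : ∀ α ∈ multiIdx d m, L0 Ω w (ENNReal.ofReal p) (((∑ i, α i : ℕ) : ℝ) - a) (D α) N := by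
    intro α hα
    rw [kInt_iff hU hp a α (h.1 α hα).2.1.aestronglyMeasurable]
    refine ⟨h.2 α hα, ?_⟩
    rw [hNp]
    exact Finset.single_le_sum (f := fun α => ∫ x in Ω, kIntegrand d w a p α (D α) x)
      (fun α _ => hnn α) hα
  have main : ∀ j : ℕ, ∀ α : Fin d → ℕ, (∑ i, α i) + j ≤ m →
      KB Ω w (ENNReal.ofReal p) j (((∑ i, α i : ℕ) : ℝ) - a) (D α) N := by
    intro j
    induction j with
    | zero => exact fun α hα => hL α (mem_multiIdx.2 (by omega))
    | succ j ih =>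
      intro α hα
      refine ⟨hL α (mem_multiIdx.2 (by omega)), fun i => ⟨D (α + Pi.single i 1), ?_, ?_⟩⟩
      · intro φ hφ
        have e1 := (h.1 (α + Pi.single i 1)
          (mem_multiIdx.2 (by rw [sum_add_single]; omega))).2.2 φ hφ
        have e2 := (h.1 α (mem_multiIdx.2 (by omega))).2.2 _ (hφ.pd i)
        rw [pderivA_add_single hφ.1, e2, sum_add_single, pow_succ] at e1
        have hne : ((-1 : ℝ) ^ (∑ i, α i)) ≠ 0 := pow_ne_zero _ (by norm_num)
        apply mul_left_cancel₀ hne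
        rw [e1]; ring
      · have := ih (α + Pi.single i 1) (by rw [sum_add_single]; omega)
        rw [sum_add_single] at this
        convert this using 1
        push_cast; ring
  have h0 := main m 0 (by simp)
  have hm0 : (0 : Fin d → ℕ) ∈ multiIdx d m := mem_multiIdx.2 (by simp)
  have hae : D 0 =ᵐ[volume.restrict Ω] u := by
    apply ae_unique hU.op (h.1 0 hm0).2.1 (h.1 0 hm0).1
    intro φ hφ
    have := (h.1 0 hm0).2.2 φ hφ
    rw [pderivA_zero] at this
    simp at this
    exact this.symm
  have := h0.congr hae
  simpa using this

theorem L0.locInt {Ω : Set (Ed d)} {w : Ed d → ℝ} (hU : GoodW Ω w)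
    {P : ℝ≥0∞} (hP : 1 ≤ P) {s : ℝ} {u : Ed d → ℝ} {N : ℝ≥0} (h : L0 Ω w P s u N) :
    LocallyIntegrableOn u Ω := by
  rw [locallyIntegrableOn_iff hU.op.isLocallyClosed]
  intro K hK hKc
  have := h.integrableOn hU hU.op.measurableSet subset_rfl hP hKc hK
  rwa [inter_eq_left.2 hK] at this

theorem KB.exists_family {Ω : Set (Ed d)} {w : Ed d → ℝ} {P : ℝ≥0∞} (m : ℕ) :
    ∀ (s : ℝ) (u : Ed d → ℝ) (N : ℝ≥0), KB Ω w P m s u N →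
    ∃ D : (Fin d → ℕ) → Ed d → ℝ, ∀ α ∈ multiIdx d m,
      L0 Ω w P (s + ((∑ i, α i : ℕ) : ℝ)) (D α) N ∧
      ∀ φ, IsTestFun d Ω φ →
        ∫ x in Ω, u x * pderivA d α φ x = (-1 : ℝ) ^ (∑ i, α i) * ∫ x in Ω, D α x * φ x := by
  induction m with
  | zero =>
    intro s u N h
    refine ⟨fun _ => u, fun α hα => ?_⟩
    have h0 : α = 0 := by
      have := mem_multiIdx.1 hα
      funext i
      have : α i ≤ ∑ i, α i := Finset.single_le_sum (fun _ _ => Nat.zero_le _) (Finset.mem_univ i)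
      simp; omega
    subst h0
    exact ⟨by simpa using! h, fun φ _ => by rw [pderivA_zero]; simp⟩
  | succ m ih =>
    intro s u N h
    choose v hv hk using h.2
    choose D hD using fun i => ih (s + 1) (v i) N (hk i)
    classical
    refine ⟨fun α => if hα : ∃ i, α i ≠ 0 then D hα.choose (α - Pi.single hα.choose 1) else u,
      fun α hα => ?_⟩
    by_cases hne : ∃ i, α i ≠ 0
    · simp only [hne, dif_pos]
      set i := hne.choose with hi
      have hi0 : α i ≠ 0 := hne.choose_spec
      obtain ⟨β, hβ⟩ : ∃ β, β = α - Pi.single i 1 := ⟨_, rfl⟩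
      have hα' : α = β + Pi.single i 1 := by
        rw [hβ]; funext j
        by_cases hj : j = i
        · subst hj; simp; omega
        · simp [hj]
      rw [← hβ]
      have hsum : ∑ j, α j = (∑ j, β j) + 1 := by
        conv_lhs => rw [hα']
        exact sum_add_single β i
      have hβm : β ∈ multiIdx d m := mem_multiIdx.2 (by
        have := mem_multiIdx.1 hα; omega)
      obtain ⟨h1, h2⟩ := hD i β hβm
      rw [hsum]
      constructor
      · convert h1 using 1; push_cast; ring
      · intro φ hφ
        conv_lhs => rw [hα']
        rw [pderivA_add_single' hφ.1, hv i _ (hφ.pA β), h2 φ hφ, pow_succ]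
        ring
    · simp only [hne, dif_neg, not_false_iff]
      have h0 : α = 0 := by
        funext i; by_contra h; exact hne ⟨i, h⟩
      subst h0
      exact ⟨by simpa using! h.1, fun φ _ => by rw [pderivA_zero]; simp⟩

theorem KB.memK {Ω : Set (Ed d)} {w : Ed d → ℝ} (hU : GoodW Ω w) {p : ℝ} (hp : 1 ≤ p) {a : ℝ}
    {m : ℕ} {u : Ed d → ℝ} {N : ℝ≥0} (h : KB Ω w (ENNReal.ofReal p) m (-a) u N) :
    MemK d Ω w m a p u ∧ Knorm d Ω w m a p u ≤ ((multiIdx d m).card : ℝ) ^ (1 / p) * N := by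
  have hp0 : 0 < p := by linarith
  have hP : 1 ≤ ENNReal.ofReal p := by simpa using hp
  obtain ⟨D, hD⟩ := KB.exists_family m _ _ _ h
  have hD' : ∀ α ∈ multiIdx d m, L0 Ω w (ENNReal.ofReal p) (((∑ i, α i : ℕ) : ℝ) - a) (D α) N := by
    intro α hα
    have := (hD α hα).1
    rwa [neg_add_eq_sub] at this
  have hu := h.l0.locInt hU hP
  have hdata : KMemData d Ω w m a p u D := by
    refine ⟨fun α hα => ⟨hu, (hD' α hα).locInt hU hP, (hD α hα).2⟩, fun α hα => ?_⟩
    exact ((kInt_iff hU hp a α (hD' α hα).1 N).1 (hD' α hα)).1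
  have hmem : MemK d Ω w m a p u := ⟨D, hdata⟩
  refine ⟨hmem, ?_⟩
  rw [Knorm, dif_pos hmem]
  have hc := hmem.choose_spec
  set D2 := hmem.choose
  have hle : ∀ α ∈ multiIdx d m, ∫ x in Ω, kIntegrand d w a p α (D2 α) x ≤ (N : ℝ) ^ p := by
    intro α hα
    have hae : D2 α =ᵐ[volume.restrict Ω] D α := by
      apply ae_unique hU.op (hc.1 α hα).2.1 (hdata.1 α hα).2.1
      intro φ hφ
      have e1 := (hc.1 α hα).2.2 φ hφ
      have e2 := (hdata.1 α hα).2.2 φ hφ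
      rw [e1] at e2
      exact mul_left_cancel₀ (pow_ne_zero _ (by norm_num)) e2
    refine le_trans (le_of_eq ?_) ((kInt_iff hU hp a α (hD' α hα).1 N).1 (hD' α hα)).2
    apply integral_congr_ae
    filter_upwards [hae] with x hx
    simp [kIntegrand, hx]
  have hnn : 0 ≤ ∑ α ∈ multiIdx d m, ∫ x in Ω, kIntegrand d w a p α (D2 α) x := by
    apply Finset.sum_nonneg
    intro α _
    apply setIntegral_nonneg hU.op.measurableSet
    intro x hx
    have := (Real.rpow_pos_of_pos (hU.pos x hx) (((∑ i, α i : ℕ) : ℝ) - a)).le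
    unfold kIntegrand
    positivity
  unfold KnormP
  calc _ ≤ (((multiIdx d m).card : ℝ) * (N : ℝ) ^ p) ^ (1 / p) := by
        apply Real.rpow_le_rpow hnn _ (by positivity)
        have := Finset.sum_le_sum hle
        simpa using this
    _ = _ := by
        rw [Real.mul_rpow (by positivity) (by positivity), ← Real.rpow_mul N.coe_nonneg,
          mul_one_div_cancel hp0.ne', Real.rpow_one]

theorem Bdd.transfer {Ω Ω' : Set (Ed d)} {w w' : Ed d → ℝ} (hΩ : GoodW Ω w) (hΩ' : GoodW Ω' w')
    {T : (Ed d → ℝ) →ₗ[ℝ] (Ed d → ℝ)} (hT : Bdd Ω w Ω' w' T) (m : ℕ) (a p : ℝ) (hp : 1 ≤ p) :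
    ∃ C : ℝ, 0 < C ∧ ∀ u, MemK d Ω w m a p u → MemK d Ω' w' m a p (T u) ∧
      Knorm d Ω' w' m a p (T u) ≤ C * Knorm d Ω w m a p u := by
  obtain ⟨C, hC⟩ := hT (ENNReal.ofReal p) (by simpa using hp) ENNReal.ofReal_ne_top m (-a)
  refine ⟨((multiIdx d m).card : ℝ) ^ (1 / p) * C + 1, by positivity, fun u hu => ?_⟩
  have h1 := hu.choose_spec.kb hΩ hp
  have h2 := KB.memK hΩ' hp (hC u _ h1)
  refine ⟨h2.1, h2.2.trans ?_⟩
  have hk : Knorm d Ω w m a p u = KnormP d Ω w m a p hu.choose := by rw [Knorm, dif_pos hu]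
  have hnn : 0 ≤ KnormP d Ω w m a p hu.choose := by
    unfold KnormP
    apply Real.rpow_nonneg
    apply Finset.sum_nonneg
    intro α _
    apply setIntegral_nonneg hΩ.op.measurableSet
    intro x hx
    have := (Real.rpow_pos_of_pos (hΩ.pos x hx) (((∑ i, α i : ℕ) : ℝ) - a)).le
    unfold kIntegrand
    positivity
  rw [hk]
  push_cast
  rw [Real.coe_toNNReal _ hnn, ← mul_assoc]
  gcongr
  linarith

end Conv


/-! ### Change of variables -/

section Chain
variable {d : ℕ}

/-- Diffeomorphisms compatible with the weights. -/
structure Dif (Ω : Set (Ed d)) (w : Ed d → ℝ) (Ω' : Set (Ed d)) (w' : Ed d → ℝ)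
    (Φ Ψ : Ed d → Ed d) : Prop where
  g : GoodW Ω w
  g' : GoodW Ω' w'
  maps : MapsTo Φ Ω Ω'
  maps' : MapsTo Ψ Ω' Ω
  inv : ∀ x ∈ Ω, Ψ (Φ x) = x
  inv' : ∀ y ∈ Ω', Φ (Ψ y) = y
  sm : ContDiffOn ℝ ∞ Φ Ω
  sm' : ContDiffOn ℝ ∞ Ψ Ω'
  sy : ∀ i j, KSym Ω w 0 (pderivI d i fun x => Φ x j)
  sy' : ∀ i j, KSym Ω' w' 0 (pderivI d i fun x => Ψ x j)
  wt : ∃ A : ℝ, 1 ≤ A ∧ ∀ x ∈ Ω, w x ≤ A * w' (Φ x) ∧ w' (Φ x) ≤ A * w x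

theorem Dif.symm {Ω Ω' : Set (Ed d)} {w w' : Ed d → ℝ} {Φ Ψ : Ed d → Ed d}
    (h : Dif Ω w Ω' w' Φ Ψ) : Dif Ω' w' Ω w Ψ Φ where
  g := h.g'
  g' := h.g
  maps := h.maps'
  maps' := h.maps
  inv := h.inv'
  inv' := h.inv
  sm := h.sm'
  sm' := h.sm
  sy := h.sy'
  sy' := h.sy
  wt := by
    obtain ⟨A, hA, hw⟩ := h.wt
    refine ⟨A, hA, fun y hy => ?_⟩
    have := hw (Ψ y) (h.maps' hy)
    rw [h.inv' y hy] at this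
    exact ⟨this.2, this.1⟩

theorem coord_contDiffOn {Ω : Set (Ed d)} {Φ : Ed d → Ed d} (h : ContDiffOn ℝ ∞ Φ Ω) (j : Fin d) :
    ContDiffOn ℝ ∞ (fun x => Φ x j) Ω :=
  (contDiffOn_euclidean.1 h) j

theorem pderivI_coord {Φ : Ed d → Ed d} {x : Ed d} (h : DifferentiableAt ℝ Φ x) (i j : Fin d) :
    pderivI d i (fun x => Φ x j) x = (fderiv ℝ Φ x (EuclideanSpace.single i 1)) j := by
  have h1 : HasFDerivAt (fun x => Φ x j) ((EuclideanSpace.proj j).comp (fderiv ℝ Φ x)) x :=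
    (EuclideanSpace.proj j : Ed d →L[ℝ] ℝ).hasFDerivAt.comp x h.hasFDerivAt
  rw [pderivI, h1.fderiv]
  rfl

theorem pderivI_comp {Φ : Ed d → Ed d} {f : Ed d → ℝ} {x : Ed d} (h : DifferentiableAt ℝ Φ x)
    (hf : DifferentiableAt ℝ f (Φ x)) (i : Fin d) :
    pderivI d i (fun x => f (Φ x)) x =
      ∑ j, pderivI d i (fun x => Φ x j) x * pderivI d j f (Φ x) := by
  have h1 : HasFDerivAt (fun x => f (Φ x)) ((fderiv ℝ f (Φ x)).comp (fderiv ℝ Φ x)) x :=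
    hf.hasFDerivAt.comp x h.hasFDerivAt
  have h2 : fderiv ℝ Φ x (EuclideanSpace.single i 1) =
      ∑ j, (fderiv ℝ Φ x (EuclideanSpace.single i 1)) j • EuclideanSpace.single j (1 : ℝ) := by
    ext k
    simp [Finset.sum_apply, Pi.single_apply]
  simp only [pderivI_coord h]
  rw [pderivI, h1.fderiv, ContinuousLinearMap.comp_apply, h2, map_sum]
  simp only [map_smul, smul_eq_mul, pderivI]
  rw [← h2]

/-- Jacobian determinant -/
def jac (Ψ : Ed d → Ed d) (y : Ed d) : ℝ :=
  Matrix.det (Matrix.of fun i j : Fin d => pderivI d j (fun y => Ψ y i) y)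

theorem jac_eq {Ψ : Ed d → Ed d} {y : Ed d} (h : DifferentiableAt ℝ Ψ y) :
    (fderiv ℝ Ψ y).det = jac Ψ y := by
  have h1 := LinearMap.det_toMatrix (EuclideanSpace.basisFun (Fin d) ℝ).toBasis
    (fderiv ℝ Ψ y : Ed d →ₗ[ℝ] Ed d)
  rw [ContinuousLinearMap.det, ← h1, jac]
  congr 1
  ext i j
  rw [LinearMap.toMatrix_apply]
  simp [pderivI_coord h]

theorem jac_contDiffOn {Ω : Set (Ed d)} (ho : IsOpen Ω) {Ψ : Ed d → Ed d}
    (h : ContDiffOn ℝ ∞ Ψ Ω) : ContDiffOn ℝ ∞ (jac Ψ) Ω := by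
  have : jac Ψ = fun y => ∑ σ : Equiv.Perm (Fin d), ((Equiv.Perm.sign σ : ℤ) : ℝ) *
      ∏ i, pderivI d i (fun y => Ψ y (σ i)) y := by
    funext y
    rw [jac, Matrix.det_apply']
    simp
  rw [this]
  refine ContDiffOn.sum fun σ _ => contDiffOn_const.mul ?_
  refine contDiffOn_prod fun i _ => ?_
  exact pderivI_contDiffOn ho (coord_contDiffOn h _) i

theorem Dif.dAt {Ω Ω' : Set (Ed d)} {w w' : Ed d → ℝ} {Φ Ψ : Ed d → Ed d}
    (h : Dif Ω w Ω' w' Φ Ψ) {x : Ed d} (hx : x ∈ Ω) : DifferentiableAt ℝ Φ x :=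
  (h.sm.contDiffAt (h.g.op.mem_nhds hx)).differentiableAt (by simp)

theorem Dif.jac_ne {Ω Ω' : Set (Ed d)} {w w' : Ed d → ℝ} {Φ Ψ : Ed d → Ed d}
    (h : Dif Ω w Ω' w' Φ Ψ) {y : Ed d} (hy : y ∈ Ω') : jac Ψ y ≠ 0 := by
  rw [← jac_eq (h.symm.dAt hy)]
  have h1 : HasFDerivAt (fun y => Φ (Ψ y)) ((fderiv ℝ Φ (Ψ y)).comp (fderiv ℝ Ψ y)) y :=
    (h.dAt (h.maps' hy)).hasFDerivAt.comp y (h.symm.dAt hy).hasFDerivAt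
  have h2 : HasFDerivAt (fun y => Φ (Ψ y)) (ContinuousLinearMap.id ℝ (Ed d)) y := by
    refine (hasFDerivAt_id y).congr_of_eventuallyEq ?_
    filter_upwards [h.g'.op.mem_nhds hy] with z hz using h.inv' z hz
  have h3 := h1.unique h2
  have h4 : (fderiv ℝ Φ (Ψ y)).det * (fderiv ℝ Ψ y).det = 1 := by
    have : ((fderiv ℝ Φ (Ψ y)).comp (fderiv ℝ Ψ y)).det = 1 := by
      rw [h3]; exact LinearMap.det_id
    rw [← this]
    exact (LinearMap.det_comp _ _).symm
  exact right_ne_zero_of_mul_eq_one h4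

theorem Dif.jac_le {Ω Ω' : Set (Ed d)} {w w' : Ed d → ℝ} {Φ Ψ : Ed d → Ed d}
    (h : Dif Ω w Ω' w' Φ Ψ) : ∃ L : ℝ≥0, ∀ y ∈ Ω', |jac Ψ y| ≤ L := by
  choose C hC hb using fun i j => (h.sy' i j).bound
  set B := ∑ i, ∑ j, C i j
  have hB : ∀ i j, C i j ≤ B := fun i j =>
    (Finset.single_le_sum (fun j _ => hC i j) (Finset.mem_univ j)).trans
      (Finset.single_le_sum (f := fun i => ∑ j, C i j)
        (fun i _ => Finset.sum_nonneg fun j _ => hC i j) (Finset.mem_univ i))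
  have hB0 : 0 ≤ B := Finset.sum_nonneg fun i _ => Finset.sum_nonneg fun j _ => hC i j
  refine ⟨(Nat.factorial (Fintype.card (Fin d)) • B ^ Fintype.card (Fin d)).toNNReal,
    fun y hy => ?_⟩
  rw [Real.coe_toNNReal _ (by positivity)]
  refine Matrix.det_le (A := Matrix.of fun i j : Fin d => pderivI d j (fun y => Ψ y i) y)
    (abv := IsAbsoluteValue.toAbsoluteValue (abs : ℝ → ℝ)) (x := B) fun i j => ?_
  have := hb j i y hy
  simp only [Real.rpow_zero, mul_one] at this
  exact this.trans (hB j i)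

theorem Dif.image {Ω Ω' : Set (Ed d)} {w w' : Ed d → ℝ} {Φ Ψ : Ed d → Ed d}
    (h : Dif Ω w Ω' w' Φ Ψ) : Ψ '' Ω' = Ω := by
  ext x
  constructor
  · rintro ⟨y, hy, rfl⟩; exact h.maps' hy
  · intro hx; exact ⟨Φ x, h.maps hx, h.inv x hx⟩

theorem Dif.injOn {Ω Ω' : Set (Ed d)} {w w' : Ed d → ℝ} {Φ Ψ : Ed d → Ed d}
    (h : Dif Ω w Ω' w' Φ Ψ) : InjOn Ψ Ω' := by
  intro y hy z hz hyz
  rw [← h.inv' y hy, ← h.inv' z hz, hyz]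

theorem Dif.integral {Ω Ω' : Set (Ed d)} {w w' : Ed d → ℝ} {Φ Ψ : Ed d → Ed d}
    (h : Dif Ω w Ω' w' Φ Ψ) (F : Ed d → ℝ) :
    ∫ x in Ω, F x = ∫ y in Ω', |jac Ψ y| * F (Ψ y) := by
  have := integral_image_eq_integral_abs_det_fderiv_smul (volume : Measure (Ed d))
    h.g'.op.measurableSet
    (fun y hy => (h.symm.dAt hy).hasFDerivAt.hasFDerivWithinAt) h.injOn F
  rw [h.image] at this
  rw [this]
  apply setIntegral_congr_fun h.g'.op.measurableSet
  intro y hy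
  simp only [smul_eq_mul]
  rw [jac_eq (h.symm.dAt hy)]

theorem Dif.map_le {Ω Ω' : Set (Ed d)} {w w' : Ed d → ℝ} {Φ Ψ : Ed d → Ed d}
    (h : Dif Ω w Ω' w' Φ Ψ) {L : ℝ≥0} (hL : ∀ y ∈ Ω', |jac Ψ y| ≤ L) :
    Measure.map Φ (volume.restrict Ω) ≤ (L : ℝ≥0∞) • volume.restrict Ω' := by
  have hm : AEMeasurable Φ (volume.restrict Ω) :=
    h.sm.continuousOn.aemeasurable h.g.op.measurableSet
  rw [Measure.le_iff]
  intro S hS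
  rw [Measure.map_apply_of_aemeasurable hm hS, Measure.smul_apply, Measure.restrict_apply hS,
    smul_eq_mul]
  have hsub : Φ ⁻¹' S ∩ Ω ⊆ Ψ '' (S ∩ Ω') := by
    rintro x ⟨hx, hxΩ⟩
    exact ⟨Φ x, ⟨hx, h.maps hxΩ⟩, h.inv x hxΩ⟩
  have hSm : MeasurableSet (S ∩ Ω') := hS.inter h.g'.op.measurableSet
  have h0 : (volume.restrict Ω) (Φ ⁻¹' S) ≤ volume (Φ ⁻¹' S ∩ Ω) := by
    rw [Measure.restrict_apply' h.g.op.measurableSet]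
  refine h0.trans ((measure_mono hsub).trans ?_)
  refine (addHaar_image_le_lintegral_abs_det_fderiv (volume : Measure (Ed d)) hSm
    (f' := fderiv ℝ Ψ)
    (fun y hy => (h.symm.dAt hy.2).hasFDerivAt.hasFDerivWithinAt)).trans ?_
  calc _ ≤ ∫⁻ y in S ∩ Ω', (L : ℝ≥0∞) := by
        apply setLIntegral_mono_ae' hSm
        refine Eventually.of_forall fun y hy => ?_
        rw [jac_eq (h.symm.dAt hy.2), ENNReal.ofReal_le_coe]
        exact hL y hy.2
    _ = _ := by simp

/-- pullback as a linear map -/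
def pullL (Φ : Ed d → Ed d) : (Ed d → ℝ) →ₗ[ℝ] (Ed d → ℝ) where
  toFun u := fun x => u (Φ x)
  map_add' _ _ := rfl
  map_smul' _ _ := rfl

theorem Dif.l0 {Ω Ω' : Set (Ed d)} {w w' : Ed d → ℝ} {Φ Ψ : Ed d → Ed d}
    (h : Dif Ω w Ω' w' Φ Ψ) {P : ℝ≥0∞} (hPt : P ≠ ⊤) (s : ℝ) : ∃ C : ℝ≥0, ∀ u N,
    L0 Ω' w' P s u N → L0 Ω w P s (pullL Φ u) (C * N) := by
  obtain ⟨L, hL⟩ := h.jac_le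
  obtain ⟨A, hA, hw⟩ := h.wt
  have hm : AEMeasurable Φ (volume.restrict Ω) :=
    h.sm.continuousOn.aemeasurable h.g.op.measurableSet
  have hmap := h.map_le hL
  have hac : Measure.map Φ (volume.restrict Ω) ≪ volume.restrict Ω' :=
    (Measure.absolutelyContinuous_of_le hmap).trans
      (Measure.smul_absolutelyContinuous)
  refine ⟨(A ^ |s|).toNNReal * ((L : ℝ≥0∞) ^ (1 / P).toReal).toNNReal, fun u N hu => ?_⟩
  have hA0 : 0 < A := by linarith
  constructor
  · exact (hu.1.mono_ac hac).comp_aemeasurable hm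
  · have h1 : eLpNorm (fun x => w x ^ s * u (Φ x)) P (volume.restrict Ω) ≤
        (A ^ |s|).toNNReal • eLpNorm ((fun y => w' y ^ s * u y) ∘ Φ) P (volume.restrict Ω) := by
      apply eLpNorm_le_nnreal_smul_eLpNorm_of_ae_le_mul
      filter_upwards [ae_restrict_mem h.g.op.measurableSet] with x hx
      rw [← NNReal.coe_le_coe]
      push_cast
      rw [Real.coe_toNNReal _ (by positivity)]
      have p1 := h.g.pos x hx
      have p2 := h.g'.pos _ (h.maps hx)
      simp only [Function.comp, Real.norm_eq_abs, abs_mul]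
      rw [abs_of_pos (Real.rpow_pos_of_pos p1 _), abs_of_pos (Real.rpow_pos_of_pos p2 _),
        ← mul_assoc]
      gcongr
      exact rpow_le_of_comp p1 p2 hA (hw x hx).1 (hw x hx).2 s
    refine h1.trans ?_
    rw [ENNReal.smul_def, smul_eq_mul]
    push_cast
    rw [mul_assoc]
    gcongr
    have hm2 : AEStronglyMeasurable (fun y => w' y ^ s * u y) (Measure.map Φ (volume.restrict Ω)) :=
      ((h.g'.aesm (h.g'.rpow s)).mul hu.1).mono_ac hac
    rw [← eLpNorm_map_measure hm2 hm]
    refine (eLpNorm_mono_measure _ hmap).trans ?_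
    rw [eLpNorm_smul_measure_of_ne_top hPt, smul_eq_mul, ENNReal.coe_toNNReal]
    · gcongr; exact hu.2
    · exact ENNReal.rpow_ne_top_of_nonneg (by positivity) ENNReal.coe_ne_top

theorem Dif.test {Ω Ω' : Set (Ed d)} {w w' : Ed d → ℝ} {Φ Ψ : Ed d → Ed d}
    (h : Dif Ω w Ω' w' Φ Ψ) {f : Ed d → ℝ} (hf : IsTestFun d Ω f) :
    IsTestFun d Ω' (Ω'.indicator fun y => |jac Ψ y| * f (Ψ y)) := by
  have hc : IsCompact (Φ '' tsupport f) :=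
    hf.2.1.isCompact.image_of_continuousOn (h.sm.continuousOn.mono hf.2.2)
  have hsub : Function.support (Ω'.indicator fun y => |jac Ψ y| * f (Ψ y)) ⊆ Φ '' tsupport f := by
    intro y hy
    have hyΩ : y ∈ Ω' := by
      by_contra hn
      exact hy (indicator_of_notMem hn _)
    rw [Function.mem_support, indicator_of_mem hyΩ] at hy
    exact ⟨Ψ y, subset_tsupport _ (right_ne_zero_of_mul hy), h.inv' y hyΩ⟩
  have hts : tsupport (Ω'.indicator fun y => |jac Ψ y| * f (Ψ y)) ⊆ Φ '' tsupport f :=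
    closure_minimal hsub hc.isClosed
  have hin : Φ '' tsupport f ⊆ Ω' := by
    rintro _ ⟨x, hx, rfl⟩; exact h.maps (hf.2.2 hx)
  refine ⟨?_, HasCompactSupport.of_support_subset_isCompact hc hsub, hts.trans hin⟩
  rw [contDiff_iff_contDiffAt]
  intro y
  by_cases hy : y ∈ Ω'
  · have h1 : ContDiffAt ℝ ∞ (fun y => |jac Ψ y| * f (Ψ y)) y := by
      refine ContDiffAt.mul ?_ ?_
      · have := (jac_contDiffOn h.g'.op h.sm').contDiffAt (h.g'.op.mem_nhds hy)
        exact (contDiffAt_abs (h.jac_ne hy)).comp y this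
      · exact (hf.1.contDiffAt).comp y (h.sm'.contDiffAt (h.g'.op.mem_nhds hy))
    refine h1.congr_of_eventuallyEq ?_
    filter_upwards [h.g'.op.mem_nhds hy] with z hz
    rw [indicator_of_mem hz]
  · have hy2 : y ∉ tsupport (Ω'.indicator fun y => |jac Ψ y| * f (Ψ y)) :=
      fun hh => hy (hin (hts hh))
    exact contDiffAt_const.congr_of_eventuallyEq (notMem_tsupport_iff_eventuallyEq.1 hy2)

theorem Dif.integral_test {Ω Ω' : Set (Ed d)} {w w' : Ed d → ℝ} {Φ Ψ : Ed d → Ed d}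
    (h : Dif Ω w Ω' w' Φ Ψ) (f u : Ed d → ℝ) :
    ∫ x in Ω, u (Φ x) * f x = ∫ y in Ω', u y * Ω'.indicator (fun y => |jac Ψ y| * f (Ψ y)) y := by
  rw [h.integral]
  apply setIntegral_congr_fun h.g'.op.measurableSet
  intro y hy
  simp only
  rw [indicator_of_mem hy, h.inv' y hy]
  ring

theorem Dif.wd {Ω Ω' : Set (Ed d)} {w w' : Ed d → ℝ} {Φ Ψ : Ed d → Ed d}
    (h : Dif Ω w Ω' w' Φ Ψ) {P : ℝ≥0∞} (hP : 1 ≤ P) (hPt : P ≠ ⊤) {s s' : ℝ} {u : Ed d → ℝ}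
    {N : ℝ≥0} (hu : L0 Ω' w' P s u N) {v : Fin d → Ed d → ℝ} (hv : ∀ j, L0 Ω' w' P s' (v j) N)
    (hw : ∀ j, WD Ω' j u (v j)) (i : Fin d) :
    WD Ω i (pullL Φ u) (∑ j, fun x => pderivI d i (fun x => Φ x j) x * v j (Φ x)) := by
  intro φ hφ
  have hco : ∀ j, ContDiffOn ℝ ∞ (pderivI d i fun x => Φ x j) Ω := fun j =>
    pderivI_contDiffOn h.g.op (coord_contDiffOn h.sm j) i
  have hφj : ∀ j, IsTestFun d Ω fun x => pderivI d i (fun x => Φ x j) x * φ x := fun j =>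
    hφ.mul_left h.g.op (hco j)
  set G : Fin d → Ed d → ℝ := fun j => Ω'.indicator fun y => |jac Ψ y| *
    (pderivI d i (fun x => Φ x j) (Ψ y) * φ (Ψ y)) with hG
  have hGt : ∀ j, IsTestFun d Ω' (G j) := fun j => h.test (hφj j)
  set g : Ed d → ℝ := Ω'.indicator fun y => |jac Ψ y| * pderivI d i φ (Ψ y) with hg
  have hgt : IsTestFun d Ω' g := h.test (hφ.pd i)
  -- Piola type identity
  have piola : g =ᵐ[volume.restrict Ω'] fun y => ∑ j, pderivI d j (G j) y := by
    apply ae_unique h.g'.op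
    · exact (hgt.1.continuous.locallyIntegrable).locallyIntegrableOn _
    · refine (Continuous.locallyIntegrable ?_).locallyIntegrableOn _
      exact continuous_finset_sum _ fun j _ => ((hGt j).pd j).1.continuous
    · intro ψ hψ
      have hψΦ : ContDiffOn ℝ ∞ (fun x => ψ (Φ x)) Ω := hψ.1.comp_contDiffOn h.sm
      have e1 : ∫ y in Ω', g y * ψ y = ∫ x in Ω, ψ (Φ x) * pderivI d i φ x := by
        rw [h.integral_test]; simp only [mul_comm, hg]
      rw [e1, integral_by_parts h.g.op hψΦ hφ]
      have e2 : ∫ x in Ω, pderivI d i (fun x => ψ (Φ x)) x * φ x =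
          ∑ j, ∫ x in Ω, pderivI d j ψ (Φ x) * (pderivI d i (fun x => Φ x j) x * φ x) := by
        rw [← integral_finset_sum]
        · apply setIntegral_congr_fun h.g.op.measurableSet
          intro x hx
          simp only
          rw [pderivI_comp (h.dAt hx) (hψ.1.differentiable (by simp) _), Finset.sum_mul]
          refine Finset.sum_congr rfl fun j _ => by ring
        · intro j _
          exact ((hφj j).mul_left h.g.op
            ((pderivI_contDiff hψ.1 j).comp_contDiffOn h.sm)).integrable.integrableOn
      rw [e2, ← Finset.sum_neg_distrib]
      have e3 : ∀ j, -∫ x in Ω, pderivI d j ψ (Φ x) * (pderivI d i (fun x => Φ x j) x * φ x) =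
          ∫ y in Ω', pderivI d j (G j) y * ψ y := by
        intro j
        rw [h.integral_test (fun x => pderivI d i (fun x => Φ x j) x * φ x) (pderivI d j ψ)]
        have := integral_by_parts h.g'.op (hψ.1.contDiffOn) (hGt j) j
        rw [← this]
        simp only [mul_comm]
      simp only [e3]
      rw [← integral_finset_sum]
      · simp only [Finset.sum_mul]
      · intro j _
        exact (hψ.mul_left h.g'.op ((hGt j).pd j).1.contDiffOn).integrable.integrableOn
  have e0 : ∫ x in Ω, pullL Φ u x * pderivI d i φ x = ∫ y in Ω', u y * g y :=
    h.integral_test _ _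
  rw [e0]
  have e1 : ∫ y in Ω', u y * g y = ∑ j, ∫ y in Ω', u y * pderivI d j (G j) y := by
    rw [← integral_finset_sum]
    · apply integral_congr_ae
      filter_upwards [piola] with y hy
      rw [hy, Finset.mul_sum]
    · intro j _
      exact hu.integrable_test h.g' hP ((hGt j).pd j)
  rw [e1]
  have e2 : ∫ x in Ω, (∑ j, fun x => pderivI d i (fun x => Φ x j) x * v j (Φ x)) x * φ x =
      ∑ j, ∫ x in Ω, v j (Φ x) * (pderivI d i (fun x => Φ x j) x * φ x) := by
    rw [← integral_finset_sum]
    · congr 1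
      funext x
      rw [Finset.sum_apply, Finset.sum_mul]
      refine Finset.sum_congr rfl fun j _ => by ring
    · intro j _
      obtain ⟨C, hC⟩ := h.l0 hPt s'
      exact (hC _ _ (hv j)).integrable_test h.g hP (hφj j)
  rw [e2, ← Finset.sum_neg_distrib]
  refine Finset.sum_congr rfl fun j _ => ?_
  rw [hw j _ (hGt j), h.integral_test]

theorem Dif.bdd {Ω Ω' : Set (Ed d)} {w w' : Ed d → ℝ} {Φ Ψ : Ed d → Ed d}
    (h : Dif Ω w Ω' w' Φ Ψ) : Bdd Ω' w' Ω w (pullL Φ) := by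
  intro P hP hPt m
  induction m with
  | zero => exact fun s => h.l0 hPt s
  | succ m ih =>
    intro s
    obtain ⟨C0, hC0⟩ := h.l0 hPt s
    obtain ⟨C1, hC1⟩ := ih (s + 1)
    choose C2 hC2 using fun i j => Bdd.cut h.g h.g (h.sy i j) inter_subset_left 1 le_rfl
      (fun x _ => by simp) P hP hPt m (s + 1)
    refine ⟨C0 + ∑ i, ∑ j, C2 i j * C1, fun u N hk => ⟨?_, fun i => ?_⟩⟩
    · exact (hC0 u N hk.1).mono (by gcongr; exact le_self_add)
    · choose v hv hvk using hk.2
      refine ⟨_, h.wd hP hPt hk.1 (fun j => (hvk j).l0) hv i, ?_⟩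
      have hj : ∀ j ∈ Finset.univ, KB Ω w P m (s + 1)
          (fun x => pderivI d i (fun x => Φ x j) x * v j (Φ x)) (C2 i j * (C1 * N)) := by
        intro j _
        refine (hC2 i j _ _ (hC1 _ _ (hvk j))).congr ?_
        filter_upwards [ae_restrict_mem h.g.op.measurableSet] with x hx
        rw [cutL_of_mem hx]; rfl
      refine (KB.sum h.g hP Finset.univ hj).mono ?_
      simp only [← mul_assoc]
      rw [← Finset.sum_mul]
      refine mul_le_mul_left ?_ N
      refine le_trans ?_ le_add_self
      exact Finset.single_le_sum (f := fun i => ∑ j, C2 i j * C1) (fun _ _ => zero_le)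
        (Finset.mem_univ i)

end Chain


/-! ### Reflection coefficients -/

/-- A system of reflection coefficients of infinite order. -/
structure GoodB (lam : ℤ → ℝ) (b : ℤ → ℝ) : Prop where
  pos : ∀ k, 0 < lam k
  sm : ∀ M : ℕ, Summable fun k => |b k| * (max (lam k) (lam k)⁻¹) ^ M
  one : ∀ j : ℕ, HasSum (fun k => b k * (-lam k) ^ j) 1

theorem GoodB.shift {lam b : ℤ → ℝ} (h : GoodB lam b) : GoodB lam (fun k => -lam k * b k) := by
  refine ⟨h.pos, fun M => ?_, fun j => ?_⟩
  · refine Summable.of_nonneg_of_le (fun k => ?_) (fun k => ?_) (h.sm (M + 1))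
    · have := h.pos k
      positivity
    · have := h.pos k
      rw [abs_mul, abs_neg, abs_of_pos this, pow_succ]
      have h1 : lam k ≤ max (lam k) (lam k)⁻¹ := le_max_left _ _
      calc lam k * |b k| * max (lam k) (lam k)⁻¹ ^ M
          = (|b k| * max (lam k) (lam k)⁻¹ ^ M) * lam k := by ring
        _ ≤ (|b k| * max (lam k) (lam k)⁻¹ ^ M) * max (lam k) (lam k)⁻¹ := by gcongr
        _ = _ := by ring
  · have := h.one (j + 1)
    refine this.congr_fun fun k => ?_
    rw [pow_succ]; ring

theorem exists_goodB : ∃ lam b : ℤ → ℝ, GoodB lam b := by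
  set r : ℝ := 1 / 4 with hr
  have hr0 : 0 < r := by norm_num [hr]
  have hr1 : r < 1 := by norm_num [hr]
  set lam : ℤ → ℝ := fun k => r ^ (2 * k) with hlam
  have hlp : ∀ k, 0 < lam k := fun k => zpow_pos hr0 _
  set c : ℤ → ℝ := fun k => (-1) ^ k * r ^ (k * (k + 1)) / (1 + lam k) with hc
  have habs : ∀ k : ℤ, |(-1 : ℝ) ^ k| = 1 := fun k => by
    rcases Int.even_or_odd k with h | h
    · rw [h.neg_one_zpow]; simp
    · rw [h.neg_one_zpow]; simp
  have hcb : ∀ k, |c k| ≤ r ^ (k * (k + 1)) := fun k => by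
    simp only [hc]
    rw [abs_div, abs_mul, habs, one_mul, abs_of_pos (zpow_pos hr0 _), abs_of_pos (by linarith [hlp k])]
    apply div_le_self (zpow_pos hr0 _).le
    linarith [hlp k]
  have hmax : ∀ k, max (lam k) (lam k)⁻¹ ≤ r ^ (-2 * |k|) := fun k => by
    apply max_le
    · exact zpow_le_zpow_right_of_le_one₀ hr0 hr1.le (by have := neg_abs_le k; linarith)
    · simp only [hlam]
      rw [← zpow_neg]
      exact zpow_le_zpow_right_of_le_one₀ hr0 hr1.le (by have := le_abs_self k; linarith)
  have hgg : ∀ t : ℝ, 0 < t → t < 1 →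
      HasSum (fun k : ℤ => t ^ |k|) ((1 - t)⁻¹ + t * (1 - t)⁻¹) := fun t ht0 ht1 => by
    have h1 := hasSum_geometric_of_lt_one ht0.le ht1
    refine HasSum.of_nat_of_neg_add_one (f := fun k : ℤ => t ^ |k|) ?_ ?_
    · simpa using h1
    · refine (h1.mul_left t).congr_fun ?_
      intro n
      have : |-((n : ℤ) + 1)| = ((n + 1 : ℕ) : ℤ) := by
        rw [abs_neg]
        push_cast
        exact abs_of_nonneg (by positivity)
      rw [this, zpow_natCast, pow_succ, mul_comm]
  have hg := hgg r hr0 hr1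
  have hg2 := hgg (r ^ 2) (by positivity) (by norm_num [hr])
  have hsm : ∀ M : ℕ, Summable fun k => |c k| * (max (lam k) (lam k)⁻¹) ^ M := fun M => by
    refine Summable.of_nonneg_of_le (fun k => ?_) (fun k => ?_)
      (hg.summable.mul_left (r ^ (-((M : ℤ) + 1) ^ 2)))
    · have := hlp k
      positivity
    · calc |c k| * max (lam k) (lam k)⁻¹ ^ M ≤ r ^ (k * (k + 1)) * (r ^ (-2 * |k|)) ^ M := by
            have := hlp k
            gcongr
            · exact hcb k
            · exact hmax k
        _ = r ^ (k * (k + 1) + (-2 * |k|) * M) := by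
            rw [zpow_add₀ hr0.ne', zpow_mul _ (-2 * |k|), zpow_natCast]
        _ ≤ r ^ (-((M : ℤ) + 1) ^ 2 + |k|) := by
            apply zpow_le_zpow_right_of_le_one₀ hr0 hr1.le
            have h1 := sq_abs k
            have h2 := neg_abs_le k
            nlinarith [sq_nonneg (|k| - (M + 1))]
        _ = _ := zpow_add₀ hr0.ne' _ _
  have hs : ∀ j : ℕ, Summable fun k => c k * lam k ^ j := fun j => by
    refine Summable.of_norm_bounded (hsm j) fun k => ?_
    rw [Real.norm_eq_abs, abs_mul, abs_of_pos (pow_pos (hlp k) j)]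
    have := hlp k
    gcongr
    exact le_max_left _ _
  set Mo : ℕ → ℝ := fun j => ∑' k, c k * lam k ^ j with hMo
  have hrec : ∀ j, Mo (j + 1) = - Mo j := fun j => by
    have h1 : Mo j + Mo (j + 1) = ∑' k : ℤ, (-1 : ℝ) ^ k * r ^ (k * (k + 1 + 2 * j)) := by
      rw [hMo, ← (hs j).tsum_add (hs (j + 1))]
      refine tsum_congr fun k => ?_
      have h2 : (1 + lam k) ≠ 0 := by linarith [hlp k]
      have h3 : r ^ (k * (k + 1 + 2 * j)) = r ^ (k * (k + 1)) * lam k ^ j := by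
        simp only [hlam]
        rw [← zpow_natCast, ← zpow_mul, ← zpow_add₀ hr0.ne']
        congr 1; ring
      rw [h3]
      simp only [hc]
      field_simp
      ring
    have h2 : ∑' k : ℤ, (-1 : ℝ) ^ k * r ^ (k * (k + 1 + 2 * j)) =
        ∑' k : ℤ, -((-1 : ℝ) ^ k * r ^ (k * (k + 1 + 2 * j))) := by
      rw [← (Equiv.subLeft (-1 - 2 * (j : ℤ))).tsum_eq]
      refine tsum_congr fun k => ?_
      have e1 : (-1 - 2 * (j : ℤ) - k) * (-1 - 2 * (j : ℤ) - k + 1 + 2 * j) = k * (k + 1 + 2 * j) := by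
        ring
      have e2 : (-1 : ℝ) ^ (-1 - 2 * (j : ℤ) - k) = -(-1 : ℝ) ^ k := by
        rcases Int.even_or_odd k with h | h
        · rw [h.neg_one_zpow, Odd.neg_one_zpow]
          obtain ⟨n, hn⟩ := h
          exact ⟨-1 - j - n, by omega⟩
        · rw [h.neg_one_zpow, Even.neg_one_zpow, neg_neg]
          obtain ⟨n, hn⟩ := h
          exact ⟨-1 - j - n, by omega⟩
      simp only [Equiv.subLeft_apply]
      rw [e1, e2, neg_mul]
    rw [tsum_neg] at h2
    linarith
  have hpow : ∀ j, Mo j = (-1) ^ j * Mo 0 := fun j => by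
    induction j with
    | zero => simp
    | succ j ih => rw [hrec, ih, pow_succ]; ring
  have hM0 : Mo 0 ≠ 0 := by
    have hd : HasSum (fun k : ℤ => if k = 0 then (1 : ℝ) else 0) 1 := hasSum_ite_eq 0 1
    have h0 : HasSum c (Mo 0) := by
      have := (hs 0).hasSum
      simp only [pow_zero, mul_one] at this
      simpa [hMo] using this
    have h1 := h0.sub (hd.mul_left (1 / 2))
    have h2 := hg2.sub hd
    have h3 := tsum_of_norm_bounded h2 (f := fun k => c k - 1 / 2 * if k = 0 then (1 : ℝ) else 0) ?_
    · rw [h1.tsum_eq, Real.norm_eq_abs, abs_le] at h3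
      norm_num [hr] at h3
      intro h
      rw [h] at h3
      norm_num at h3
    · intro k
      by_cases hk : k = 0
      · subst hk
        simp [hc, hlam]
        norm_num
      · simp only [hk, if_false, mul_zero, sub_zero]
        rw [Real.norm_eq_abs]
        have e : (r ^ 2) ^ |k| = r ^ (2 * |k|) := by
          rw [zpow_mul]; norm_cast
        rw [e]
        rcases lt_or_gt_of_ne hk with h | h
        · have : c k = (-1) ^ k * r ^ (k * (k - 1)) / (1 + (lam k)⁻¹) := by
            simp only [hc]
            have h3 : r ^ (k * (k + 1)) = r ^ (k * (k - 1)) * lam k := by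
              simp only [hlam]
              rw [← zpow_add₀ hr0.ne']
              congr 1; ring
            rw [h3]
            have h1 := hlp k
            have h2 : (1 + lam k) ≠ 0 := by linarith [hlp k]
            have h2 : (1 + (lam k)⁻¹) ≠ 0 := by positivity
            field_simp
            ring
          rw [this, abs_div, abs_mul, habs, one_mul, abs_of_pos (zpow_pos hr0 _),
            abs_of_pos (by have := inv_pos.2 (hlp k); linarith)]
          refine (div_le_self (zpow_pos hr0 _).le (by have := inv_pos.2 (hlp k); linarith)).trans ?_
          apply zpow_le_zpow_right_of_le_one₀ hr0 hr1.le
          rw [abs_of_neg h]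
          nlinarith
        · refine (hcb k).trans ?_
          apply zpow_le_zpow_right_of_le_one₀ hr0 hr1.le
          rw [abs_of_pos h]
          nlinarith
  refine ⟨lam, fun k => c k / Mo 0, hlp, fun M => ?_, fun j => ?_⟩
  · refine ((hsm M).mul_left |Mo 0|⁻¹).congr fun k => ?_
    change |Mo 0|⁻¹ * (|c k| * max (lam k) (lam k)⁻¹ ^ M) = |c k / Mo 0| * _
    rw [abs_div (c k) (Mo 0), div_eq_mul_inv |c k|]
    generalize |c k| = x
    generalize |Mo 0| = y
    ring
  · have := ((hs j).hasSum.mul_left ((-1) ^ j / Mo 0))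
    have e : (-1) ^ j / Mo 0 * ∑' k, c k * lam k ^ j = 1 := by
      change (-1) ^ j / Mo 0 * Mo j = 1
      rw [hpow j, ← mul_assoc, mul_comm ((-1) ^ j / Mo 0), ← mul_div_assoc, ← mul_pow]
      simp [hM0]
    rw [e] at this
    refine this.congr_fun fun k => ?_
    rw [neg_pow]; ring


/-! ### Infinite sums -/

section Sums
variable {d : ℕ}

theorem L0.tsum_ae {U : Set (Ed d)} {w : Ed d → ℝ} (hU : GoodW U w) {P : ℝ≥0∞} (hP : 1 ≤ P)
    {s : ℝ} {f : ℤ → Ed d → ℝ} {A : ℤ → ℝ≥0} (hA : Summable A)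
    (h : ∀ k, L0 U w P s (f k) (A k)) :
    ∀ᵐ x ∂(volume.restrict U), Summable fun k => f k x := by
  have h1 := summable_norm_of_tsum_eLpNorm_ne_top (μ := volume.restrict U) hP
    (f := fun k x => w x ^ s * f k x) (fun k => (hU.aesm (hU.rpow s)).mul (h k).1) (by
      refine ((ENNReal.tsum_le_tsum fun k => (h k).2).trans_lt ?_).ne
      exact (ENNReal.tsum_coe_ne_top_iff_summable.2 hA).lt_top)
  filter_upwards [h1, ae_restrict_mem hU.op.measurableSet] with x hx hxU
  have h2 := hx.of_norm.mul_left (w x ^ (-s))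
  refine h2.congr fun k => ?_
  rw [← mul_assoc, ← Real.rpow_add (hU.pos x hxU)]
  simp

theorem L0.tsum {U : Set (Ed d)} {w : Ed d → ℝ} (hU : GoodW U w) {P : ℝ≥0∞} (hP : 1 ≤ P)
    {s : ℝ} {f : ℤ → Ed d → ℝ} {A : ℤ → ℝ≥0} (hA : Summable A)
    (h : ∀ k, L0 U w P s (f k) (A k)) {F : Ed d → ℝ}
    (hF : ∀ᵐ x ∂(volume.restrict U), HasSum (fun k => f k x) (F x)) :
    L0 U w P s F (∑' k, A k) := by
  have hm : ∀ S : Finset ℤ, AEStronglyMeasurable (fun x => ∑ k ∈ S, f k x) (volume.restrict U) :=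
    fun S => Finset.aestronglyMeasurable_fun_sum S fun k _ => (h k).1
  refine ⟨aestronglyMeasurable_of_tendsto_ae (u := atTop) hm hF, ?_⟩
  refine Lp.eLpNorm_le_of_ae_tendsto (u := (atTop : Filter (Finset ℤ)))
    (f := fun S x => w x ^ s * ∑ k ∈ S, f k x) (Eventually.of_forall fun S => ?_)
    (fun S => (hU.aesm (hU.rpow s)).mul (hm S)) ?_
  · have he : (fun x => w x ^ s * ∑ k ∈ S, f k x) = ∑ k ∈ S, fun x => w x ^ s * f k x := by
      funext x
      rw [Finset.sum_apply, Finset.mul_sum]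
    rw [he]
    refine (eLpNorm_sum_le (fun k _ => (hU.aesm (hU.rpow s)).mul (h k).1) hP).trans ?_
    refine (Finset.sum_le_sum fun k _ => (h k).2).trans ?_
    rw [← ENNReal.ofNNReal_finsetSum]
    exact_mod_cast hA.sum_le_tsum S (fun _ _ => bot_le)
  · filter_upwards [hF] with x hx
    exact hx.const_mul (w x ^ s)

theorem L0.hasSum_integral {U : Set (Ed d)} {w : Ed d → ℝ} (hU : GoodW U w) {P : ℝ≥0∞}
    (hP : 1 ≤ P) {s : ℝ} {f : ℤ → Ed d → ℝ} {A : ℤ → ℝ≥0} (hA : Summable A)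
    (h : ∀ k, L0 U w P s (f k) (A k)) {F : Ed d → ℝ}
    (hF : ∀ᵐ x ∂(volume.restrict U), HasSum (fun k => f k x) (F x)) {φ : Ed d → ℝ}
    (hφ : IsTestFun d U φ) :
    HasSum (fun k => ∫ x in U, f k x * φ x) (∫ x in U, F x * φ x) := by
  obtain ⟨C, hC⟩ := L0.lint_le hU hU.op.measurableSet subset_rfl hP s hφ.2.1.isCompact hφ.2.2
  obtain ⟨B, hB⟩ := hφ.2.1.isCompact.exists_bound_of_continuousOn hφ.1.continuous.continuousOn
  have hB0 : ∀ x, ‖φ x‖ ≤ |B| := fun x => by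
    by_cases hx : x ∈ tsupport φ
    · exact (hB x hx).trans (le_abs_self B)
    · rw [image_eq_zero_of_notMem_tsupport hx]; simp
  have hb : ∀ k, ∫ x in U, ‖f k x * φ x‖ ≤ |B| * (C * A k) := fun k => by
    have hintg := ((h k).integrable_test hU hP hφ)
    rw [integral_norm_eq_lintegral_enorm hintg.1]
    refine ENNReal.toReal_le_of_le_ofReal (by positivity) ?_
    have : ∫⁻ x in U, ‖f k x * φ x‖ₑ ≤ ‖B‖ₑ * ∫⁻ x in tsupport φ ∩ U, ‖f k x‖ₑ := by
      rw [← lintegral_const_mul' _ _ (by simp)]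
      rw [← lintegral_indicator hU.op.measurableSet,
        ← lintegral_indicator (hφ.2.1.measurableSet.inter hU.op.measurableSet)]
      refine lintegral_mono fun x => ?_
      by_cases hx : x ∈ U
      · by_cases hx' : x ∈ tsupport φ
        · simp only [indicator, hx, hx', mem_inter_iff, and_self, if_true]
          rw [enorm_mul, mul_comm]
          gcongr
          rw [← ofReal_norm, ← ofReal_norm]
          exact ENNReal.ofReal_le_ofReal (hB0 x)
        · simp [indicator, hx, hx', image_eq_zero_of_notMem_tsupport hx']
      · simp [indicator, hx]
    refine this.trans ?_
    refine (mul_le_mul_right (hC _ _ (h k)) _).trans ?_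
    rw [ENNReal.ofReal_mul (abs_nonneg _), ENNReal.ofReal_mul C.coe_nonneg,
      ← ofReal_norm, Real.norm_eq_abs]
    simp
  have h1 := hasSum_integral_of_summable_integral_norm (μ := volume.restrict U)
    (F := fun k x => f k x * φ x) (fun k => (h k).integrable_test hU hP hφ) (by
      refine Summable.of_nonneg_of_le (fun k => by positivity) hb ?_
      exact ((NNReal.summable_coe.2 hA).mul_left _).mul_left _)
  have h2 : ∫ x in U, F x * φ x = ∫ x in U, ∑' k, f k x * φ x := by
    apply integral_congr_ae
    filter_upwards [hF] with x hx
    exact (hx.mul_right (φ x)).tsum_eq.symm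
  rw [h2]
  exact h1

theorem WD.tsum {U : Set (Ed d)} {w : Ed d → ℝ} (hU : GoodW U w) {P : ℝ≥0∞}
    (hP : 1 ≤ P) {s s' : ℝ} {f g : ℤ → Ed d → ℝ} {A B : ℤ → ℝ≥0} (hA : Summable A) (hB : Summable B)
    (h : ∀ k, L0 U w P s (f k) (A k)) (h' : ∀ k, L0 U w P s' (g k) (B k)) {F G : Ed d → ℝ}
    (hF : ∀ᵐ x ∂(volume.restrict U), HasSum (fun k => f k x) (F x))
    (hG : ∀ᵐ x ∂(volume.restrict U), HasSum (fun k => g k x) (G x)) {j : Fin d}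
    (hw : ∀ k, WD U j (f k) (g k)) : WD U j F G := by
  intro φ hφ
  have h1 := L0.hasSum_integral hU hP hA h hF (hφ.pd j)
  have h2 := (L0.hasSum_integral hU hP hB h' hG hφ).neg
  refine h1.unique (h2.congr_fun fun k => ?_)
  exact hw k φ hφ

end Sums


/-! ### Integration by parts up to a flat boundary -/

section Bdry
variable {d : ℕ}

/-- the upper half of a set -/
def upS (U : Set (Ed d)) (i : Fin d) : Set (Ed d) := U ∩ {x | 0 < x i}

theorem cont_coord (i : Fin d) : Continuous fun x : Ed d => x i :=
  (EuclideanSpace.proj i : Ed d →L[ℝ] ℝ).continuous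

theorem contDiff_coord (i : Fin d) : ContDiff ℝ ∞ fun x : Ed d => x i :=
  (EuclideanSpace.proj i : Ed d →L[ℝ] ℝ).contDiff

theorem upS_open {U : Set (Ed d)} (hU : IsOpen U) (i : Fin d) : IsOpen (upS U i) :=
  hU.inter (isOpen_lt continuous_const (cont_coord i))

theorem pderivI_fun_coord {f : ℝ → ℝ} {i j : Fin d} {x : Ed d} (hf : DifferentiableAt ℝ f (x i)) :
    pderivI d j (fun x : Ed d => f (x i)) x = if i = j then deriv f (x i) else 0 := by
  have h1 := hf.hasDerivAt.comp_hasFDerivAt x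
    (EuclideanSpace.proj i : Ed d →L[ℝ] ℝ).hasFDerivAt
  have h2 : fderiv ℝ (fun x : Ed d => f (x i)) x = deriv f (x i) • (EuclideanSpace.proj i : Ed d →L[ℝ] ℝ) :=
    h1.fderiv
  rw [pderivI, h2]
  by_cases h : i = j
  · subst h; simp
  · simp [h]

theorem deriv_smoothTransition_bound : ∃ B : ℝ, 0 ≤ B ∧ ∀ t, |deriv Real.smoothTransition t| ≤ B := by
  have hc : Continuous (deriv Real.smoothTransition) :=
    (Real.smoothTransition.contDiff (n := 1)).continuous_deriv (by norm_num)
  obtain ⟨B, hB⟩ := (isCompact_Icc (a := (0 : ℝ)) (b := 1)).exists_bound_of_continuousOn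
    hc.continuousOn
  refine ⟨|B|, abs_nonneg _, fun t => ?_⟩
  by_cases ht : t ∈ Icc (0 : ℝ) 1
  · exact (hB t ht).trans (le_abs_self _)
  · have : deriv Real.smoothTransition t = 0 := by
      rw [mem_Icc, not_and_or, not_le, not_le] at ht
      rcases ht with ht | ht
      · have : Real.smoothTransition =ᶠ[𝓝 t] fun _ => 0 := by
          filter_upwards [Iio_mem_nhds ht] with y hy
          exact Real.smoothTransition.zero_of_nonpos (le_of_lt hy)
        rw [this.deriv_eq]; simp
      · have : Real.smoothTransition =ᶠ[𝓝 t] fun _ => 1 := by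
          filter_upwards [Ioi_mem_nhds ht] with y hy
          exact Real.smoothTransition.one_of_one_le (le_of_lt hy)
        rw [this.deriv_eq]; simp
    rw [this]; simp

theorem ibp_bdry {U : Set (Ed d)} {W : Ed d → ℝ} (hU : GoodW U W) (i : Fin d) {P : ℝ≥0∞}
    (hP : 1 ≤ P) {s s' : ℝ} {u v : Ed d → ℝ} {N N' : ℝ≥0} (hu : L0 (upS U i) W P s u N)
    (hv : L0 (upS U i) W P s' v N') {j : Fin d} (hw : WD (upS U i) j u v) {Φ : Ed d → ℝ}
    (hΦ : ContDiff ℝ ∞ Φ) (hc : HasCompactSupport Φ) (hs : ∀ x ∈ tsupport Φ, 0 ≤ x i → x ∈ U)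
    (h0 : j = i → ∀ x : Ed d, x i = 0 → Φ x = 0) :
    ∫ x in upS U i, u x * pderivI d j Φ x = -∫ x in upS U i, v x * Φ x := by
  have ho := upS_open hU.op i
  have hm := ho.measurableSet
  have hsub : upS U i ⊆ U := inter_subset_left
  set K : Set (Ed d) := tsupport Φ ∩ {x | 0 ≤ x i} with hK
  have hKc : IsCompact K := hc.isCompact.inter_right (isClosed_le continuous_const (cont_coord i))
  have hKU : K ⊆ U := fun x hx => hs x hx.1 hx.2
  -- dominated convergence
  have dom : ∀ (g : Ed d → ℝ) (S : ℝ) (M : ℝ≥0) (_ : L0 (upS U i) W P S g M) (B : ℝ)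
      (ψ : ℕ → Ed d → ℝ) (ψ' : Ed d → ℝ), (∀ n, Continuous (ψ n)) →
      (∀ n, ∀ x ∈ upS U i, |ψ n x| ≤ B) →
      (∀ n x, x ∉ tsupport Φ → ψ n x = 0) → (∀ x ∈ upS U i, ∀ᶠ n in atTop, ψ n x = ψ' x) →
      Tendsto (fun n => ∫ x in upS U i, g x * ψ n x) atTop (𝓝 (∫ x in upS U i, g x * ψ' x)) := by
    intro g S M hg B ψ ψ' h1 h2 h3 h4
    have hintg := hg.integrableOn hU hm hsub hP hKc hKU
    have hint2 : Integrable (K.indicator g) (volume.restrict (upS U i)) := by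
      rw [integrable_indicator_iff hKc.measurableSet, IntegrableOn,
        Measure.restrict_restrict hKc.measurableSet]
      exact hintg
    refine tendsto_integral_of_dominated_convergence (fun x => B * |K.indicator g x|) (fun n => ?_)
      (hint2.abs.const_mul B) (fun n => ?_) ?_
    · exact hg.1.mul (h1 n).aestronglyMeasurable
    · filter_upwards [ae_restrict_mem hm] with x hx
      by_cases hx' : x ∈ tsupport Φ
      · have : x ∈ K := ⟨hx', (show 0 < x i from hx.2).le⟩
        rw [indicator_of_mem this, Real.norm_eq_abs, abs_mul, mul_comm]
        gcongr
        exact h2 n x hx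
      · rw [h3 n x hx', mul_zero, norm_zero]
        have : 0 ≤ B := (abs_nonneg _).trans (h2 n x hx)
        positivity
    · filter_upwards [ae_restrict_mem hm] with x hx
      apply tendsto_const_nhds.congr'
      filter_upwards [h4 x hx] with n hn
      rw [hn]
  set θ : ℕ → ℝ → ℝ := fun n t => Real.smoothTransition (n * t - 1) with hθ
  have hθs : ∀ n, ContDiff ℝ ∞ (θ n) := fun n =>
    (Real.smoothTransition.contDiff (n := ⊤)).comp ((contDiff_const.mul contDiff_id).sub contDiff_const)
  have hθx : ∀ n, ContDiff ℝ ∞ (fun x : Ed d => θ n (x i)) := fun n =>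
    (hθs n).comp (contDiff_coord i)
  have hθd : ∀ n t, deriv (θ n) t = n * deriv Real.smoothTransition (n * t - 1) := fun n t => by
    have h1 : HasDerivAt Real.smoothTransition (deriv Real.smoothTransition (n * t - 1)) (n * t - 1) :=
      ((Real.smoothTransition.contDiff (n := 1)).differentiable (by norm_num) _).hasDerivAt
    have h2 : HasDerivAt (fun t : ℝ => n * t - 1) (n * 1) t :=
      ((hasDerivAt_id t).const_mul (n : ℝ)).sub_const 1
    have := h1.comp t h2
    have h3 : deriv (θ n) t = _ := this.deriv
    rw [h3]; ring
  have hθ1 : ∀ (n : ℕ) (t : ℝ), 2 ≤ n * t → θ n t = 1 := fun n t h =>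
    Real.smoothTransition.one_of_one_le (by linarith)
  have hev : ∀ x ∈ upS U i, ∀ᶠ n : ℕ in atTop, 2 < n * x i := fun x hx => by
    have hx0 : 0 < x i := hx.2
    obtain ⟨n0, hn0⟩ := exists_nat_gt (2 / x i)
    filter_upwards [eventually_ge_atTop n0] with n hn
    rw [div_lt_iff₀ hx0] at hn0
    have : (n0 : ℝ) ≤ n := by exact_mod_cast hn
    nlinarith
  have htest : ∀ n, IsTestFun d (upS U i) (fun x => θ n (x i) * Φ x) := fun n => by
    have hsub1 : tsupport (fun x => θ n (x i) * Φ x) ⊆ tsupport Φ := by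
      apply closure_mono
      intro x hx hh
      exact hx (by simp [hh])
    refine ⟨(hθx n).mul hΦ, hc.mono' ?_, ?_⟩
    · exact (subset_tsupport _).trans hsub1
    · intro x hx
      have hxi : 0 < x i := by
        by_contra hneg
        push Not at hneg
        have : x ∉ tsupport (fun x => θ n (x i) * Φ x) := by
          rw [notMem_tsupport_iff_eventuallyEq]
          have h1 : ∀ᶠ y : Ed d in 𝓝 x, n * y i < 1 := by
            have : Continuous fun y : Ed d => n * y i := continuous_const.mul (cont_coord i)
            apply this.continuousAt.eventually_lt continuousAt_const
            have : (0 : ℝ) ≤ n := by positivity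
            nlinarith
          filter_upwards [h1] with y hy
          have : θ n (y i) = 0 := Real.smoothTransition.zero_of_nonpos (by linarith)
          simp [this]
        exact this hx
      exact ⟨hs x (hsub1 hx) hxi.le, hxi⟩
  obtain ⟨BΦ, hBΦ⟩ := hc.exists_bound_of_continuous hΦ.continuous
  have hcd : HasCompactSupport (pderivI d j Φ) :=
    hc.mono' ((subset_tsupport _).trans (tsupport_pderivI j Φ))
  obtain ⟨Bd, hBd⟩ := hcd.exists_bound_of_continuous (pderivI_contDiff hΦ j).continuous
  obtain ⟨B, hB0, hB⟩ := deriv_smoothTransition_bound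
  obtain ⟨L, hL⟩ := hΦ.lipschitzWith_of_hasCompactSupport hc (by simp)
  have hθb : ∀ n t, |θ n t| ≤ 1 := fun n t => by
    rw [abs_of_nonneg (Real.smoothTransition.nonneg _)]
    exact Real.smoothTransition.le_one _
  have T1 := dom v s' N' hv BΦ (fun n x => θ n (x i) * Φ x) Φ (fun n => ((hθx n).mul hΦ).continuous)
    (fun n x _ => by
      rw [abs_mul]
      have h1 := hBΦ x
      rw [Real.norm_eq_abs] at h1
      calc |θ n (x i)| * |Φ x| ≤ 1 * |Φ x| := by gcongr; exact hθb _ _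
        _ ≤ BΦ := by rwa [one_mul])
    (fun n x hx => by rw [image_eq_zero_of_notMem_tsupport hx, mul_zero])
    (fun x hx => by
      filter_upwards [hev x hx] with n hn
      rw [hθ1 n _ hn.le, one_mul])
  have T2 := dom u s N hu (Bd + 2 * B * L) (fun n => pderivI d j (fun x => θ n (x i) * Φ x))
    (pderivI d j Φ) (fun n => (pderivI_contDiff ((hθx n).mul hΦ) j).continuous)
    (fun n x hx => by
      have hx0 : 0 < x i := hx.2
      rw [pderivI_mul ((hθx n).differentiable (by simp) x) (hΦ.differentiable (by simp) x),
        pderivI_fun_coord ((hθs n).differentiable (by simp) _)]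
      have e1 : |θ n (x i) * pderivI d j Φ x| ≤ Bd := by
        rw [abs_mul]
        have h1 := hBd x
        rw [Real.norm_eq_abs] at h1
        calc |θ n (x i)| * |pderivI d j Φ x| ≤ 1 * |pderivI d j Φ x| := by gcongr; exact hθb _ _
          _ ≤ Bd := by rwa [one_mul]
      have e2 : |(if i = j then deriv (θ n) (x i) else 0) * Φ x| ≤ 2 * B * L := by
        have hp : 0 ≤ 2 * B * L := by positivity
        by_cases hij : i = j
        · rw [if_pos hij]
          by_cases hn : 2 < n * x i
          · have : θ n =ᶠ[𝓝 (x i)] fun _ => 1 := by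
              have : ∀ᶠ t : ℝ in 𝓝 (x i), 2 < n * t :=
                continuousAt_const.eventually_lt (continuousAt_const.mul continuousAt_id) hn
              filter_upwards [this] with t ht
              exact hθ1 n t ht.le
            rw [this.deriv_eq]
            simpa using hp
          · push Not at hn
            have hΦx : |Φ x| ≤ L * x i := by
              set y : Ed d := x - EuclideanSpace.single i (x i) with hy
              have hyi : y i = 0 := by simp [hy]
              have h1 := hL.dist_le_mul x y
              rw [Real.dist_eq, h0 hij.symm y hyi, sub_zero] at h1
              refine h1.trans ?_
              rw [dist_eq_norm, hy, sub_sub_cancel, EuclideanSpace.norm_single, Real.norm_eq_abs,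
                abs_of_pos hx0]
            rw [hθd, abs_mul, abs_mul, abs_of_nonneg (Nat.cast_nonneg n)]
            calc (n : ℝ) * |deriv Real.smoothTransition (n * x i - 1)| * |Φ x|
                ≤ n * B * (L * x i) := by
                  gcongr
                  exact hB _
              _ = (n * x i) * (B * L) := by ring
              _ ≤ 2 * (B * L) := by gcongr
              _ = _ := by ring
        · rw [if_neg hij]; simpa using hp
      exact (abs_add_le _ _).trans (add_le_add e1 e2))
    (fun n x hx => by
      have h1 : x ∉ tsupport (fun x => θ n (x i) * Φ x) := fun hh => hx (by
        refine closure_mono ?_ hh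
        intro y hy hh
        exact hy (by simp [hh]))
      exact image_eq_zero_of_notMem_tsupport fun hh => h1 (tsupport_pderivI j _ hh))
    (fun x hx => by
      filter_upwards [hev x hx] with n hn
      apply pderivI_eq_of_eventuallyEq
      have : ∀ᶠ y : Ed d in 𝓝 x, 2 < n * y i :=
        continuousAt_const.eventually_lt (continuousAt_const.mul (cont_coord i).continuousAt) hn
      filter_upwards [this] with y hy
      rw [hθ1 n _ hy.le, one_mul])
  refine tendsto_nhds_unique T2 (T1.neg.congr fun n => ?_)
  exact (hw _ (htest n)).symm

end Bdry


/-! ### Anisotropic reflections -/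

section Refl
variable {d : ℕ}

/-- the reflection with dilation factor `lam` in the `i`-th coordinate -/
def Rl (i : Fin d) (lam : ℝ) : Ed d →L[ℝ] Ed d :=
  ContinuousLinearMap.id ℝ (Ed d) -
    (1 + lam) • (EuclideanSpace.proj i : Ed d →L[ℝ] ℝ).smulRight (EuclideanSpace.single i (1 : ℝ))

theorem Rl_apply (i : Fin d) (lam : ℝ) (x : Ed d) (j : Fin d) :
    Rl i lam x j = if j = i then -lam * x i else x j := by
  by_cases h : j = i
  · subst h; simp [Rl]; ring
  · simp [Rl, h]

theorem Rl_self (i : Fin d) (lam : ℝ) (x : Ed d) : Rl i lam x i = -lam * x i := by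
  simp [Rl_apply]

theorem Rl_Rl (i : Fin d) {lam : ℝ} (hl : lam ≠ 0) (x : Ed d) : Rl i lam⁻¹ (Rl i lam x) = x := by
  ext j
  by_cases h : j = i
  · subst h; rw [Rl_self, Rl_self]; field_simp
  · simp [Rl_apply, h]

theorem Rl_Rl' (i : Fin d) {lam : ℝ} (hl : lam ≠ 0) (x : Ed d) : Rl i lam (Rl i lam⁻¹ x) = x := by
  have := Rl_Rl i (inv_ne_zero hl) x
  rwa [inv_inv] at this

theorem Rl_fix (i : Fin d) (lam : ℝ) {x : Ed d} (hx : x i = 0) : Rl i lam x = x := by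
  ext j
  by_cases h : j = i
  · subst h; rw [Rl_self, hx]; simp
  · simp [Rl_apply, h]

/-- the reflection as a homeomorphism -/
def Rh (i : Fin d) {lam : ℝ} (hl : lam ≠ 0) : Ed d ≃ₜ Ed d where
  toFun := Rl i lam
  invFun := Rl i lam⁻¹
  left_inv := Rl_Rl i hl
  right_inv := Rl_Rl' i hl
  continuous_toFun := (Rl i lam).continuous
  continuous_invFun := (Rl i lam⁻¹).continuous

theorem Rl_emb (i : Fin d) {lam : ℝ} (hl : lam ≠ 0) : MeasurableEmbedding (Rl i lam) :=
  (Rh i hl).measurableEmbedding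

theorem Rl_map (i : Fin d) {lam : ℝ} (hl : 0 < lam) :
    Measure.map (Rl i lam) (volume : Measure (Ed d)) = ENNReal.ofReal lam⁻¹ • volume := by
  have h1 : ((Rl i lam : Ed d →L[ℝ] Ed d) : Ed d →ₗ[ℝ] Ed d) =
      LinearMap.transvection (((EuclideanSpace.proj i : Ed d →L[ℝ] ℝ) : Ed d →ₗ[ℝ] ℝ))
        (-(1 + lam) • EuclideanSpace.single i (1 : ℝ)) := by
    ext x j
    by_cases hj : j = i
    · simp [Rl, LinearMap.transvection, hj]; ring
    · simp [Rl, LinearMap.transvection, hj]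
  have h2 : LinearMap.det ((Rl i lam : Ed d →L[ℝ] Ed d) : Ed d →ₗ[ℝ] Ed d) = -lam := by
    rw [h1, LinearMap.transvection.det]
    simp
  have h3 := Measure.map_linearMap_addHaar_eq_smul_addHaar (volume : Measure (Ed d))
    (f := ((Rl i lam : Ed d →L[ℝ] Ed d) : Ed d →ₗ[ℝ] Ed d)) (by rw [h2]; simpa using hl.ne')
  rw [h2] at h3
  rw [inv_neg, abs_neg, abs_of_pos (inv_pos.2 hl)] at h3
  exact h3

theorem Rl_integral (i : Fin d) {lam : ℝ} (hl : 0 < lam) (f : Ed d → ℝ) :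
    ∫ x, f (Rl i lam x) = lam⁻¹ * ∫ x, f x := by
  rw [← (Rl_emb i hl.ne').integral_map f, Rl_map i hl, integral_smul_measure]
  simp [hl.le]

theorem Rl_integrable (i : Fin d) {lam : ℝ} (hl : 0 < lam) {f : Ed d → ℝ}
    (h : Integrable (fun x => f (Rl i lam x))) : Integrable f := by
  have h1 := ((Rl_emb i hl.ne').integrable_map_iff (g := f) (μ := volume)).2 h
  rw [Rl_map i hl] at h1
  have h2 : ENNReal.ofReal lam⁻¹ ≠ 0 := by simpa using hl
  exact (integrable_smul_measure h2 (by simp)).1 h1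

theorem Rl_qmp (i : Fin d) {lam : ℝ} (hl : 0 < lam) :
    Measure.QuasiMeasurePreserving (Rl i lam : Ed d → Ed d) volume volume := by
  refine ⟨(Rl i lam).continuous.measurable, ?_⟩
  rw [Rl_map i hl]
  exact Measure.smul_absolutelyContinuous

/-- Sets and weights compatible with reflections from the upper to the lower half. -/
structure ReflW (U : Set (Ed d)) (W : Ed d → ℝ) (i : Fin d) : Prop where
  g : GoodW U W
  maps : ∀ x ∈ U, x i < 0 → ∀ lam : ℝ, 0 < lam → Rl i lam x ∈ U
  wt : ∀ x ∈ U, x i < 0 → ∀ lam : ℝ, 0 < lam →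
    W (Rl i lam x) ≤ max lam lam⁻¹ * W x ∧ W x ≤ max lam lam⁻¹ * W (Rl i lam x)

theorem one_le_max_inv {lam : ℝ} (hl : 0 < lam) : 1 ≤ max lam lam⁻¹ := by
  rcases le_total 1 lam with h | h
  · exact h.trans (le_max_left _ _)
  · exact ((one_le_inv₀ hl).2 h).trans (le_max_right _ _)

/-- extension by zero from the upper half -/
def upI (U : Set (Ed d)) (i : Fin d) (u : Ed d → ℝ) : Ed d → ℝ := (upS U i).indicator u

theorem L0.up {U : Set (Ed d)} {W : Ed d → ℝ} {i : Fin d} (hU : GoodW U W) {P : ℝ≥0∞} {s : ℝ}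
    {u : Ed d → ℝ} {N : ℝ≥0} (h : L0 (upS U i) W P s u N) : L0 U W P s (upI U i u) N := by
  have hm := (upS_open hU.op i).measurableSet
  have hr : (volume.restrict U).restrict (upS U i) = volume.restrict (upS U i) := by
    rw [Measure.restrict_restrict hm, inter_eq_left.2 (show upS U i ⊆ U from inter_subset_left)]
  refine ⟨(aestronglyMeasurable_indicator_iff hm).2 (by rw [hr]; exact h.1), ?_⟩
  have : (fun x => W x ^ s * upI U i u x) = (upS U i).indicator (fun x => W x ^ s * u x) := by
    funext x
    by_cases hx : x ∈ upS U i <;> simp [upI, hx]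
  rw [this, eLpNorm_indicator_eq_eLpNorm_restrict hm, hr]
  exact h.2

theorem upI_Rl_of_nonneg (U : Set (Ed d)) (i : Fin d) (u : Ed d → ℝ) {lam : ℝ} (hl : 0 < lam)
    {x : Ed d} (hx : 0 ≤ x i) : upI U i u (Rl i lam x) = 0 := by
  refine indicator_of_notMem (fun h => ?_) _
  have h2 : 0 < Rl i lam x i := h.2
  rw [Rl_self] at h2
  nlinarith

theorem L0.refl {U : Set (Ed d)} {W : Ed d → ℝ} {i : Fin d} (hU : ReflW U W i) {P : ℝ≥0∞}
    (hP1 : 1 ≤ P) (hP : P ≠ ⊤) {s : ℝ} {u : Ed d → ℝ} {N : ℝ≥0} (h : L0 (upS U i) W P s u N)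
    {lam : ℝ} (hl : 0 < lam) :
    L0 U W P s (fun x => upI U i u (Rl i lam x))
      (Real.toNNReal ((max lam lam⁻¹) ^ (⌈|s|⌉₊ + 1)) * N) := by
  have hm := (upS_open hU.g.op i).measurableSet
  have hu := h.up hU.g
  have hmu : AEStronglyMeasurable (upI U i u) volume :=
    (aestronglyMeasurable_indicator_iff hm).2 h.1
  have hΛ := one_le_max_inv hl
  set Λ := max lam lam⁻¹ with hΛd
  refine ⟨(hmu.comp_quasiMeasurePreserving (Rl_qmp i hl)).mono_measure Measure.restrict_le_self, ?_⟩
  set G : Ed d → ℝ := (upS U i).indicator (fun x => W x ^ s * u x) with hG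
  have hGm : AEStronglyMeasurable G volume :=
    (aestronglyMeasurable_indicator_iff hm).2
      ((((hU.g.mono (upS_open hU.g.op i) inter_subset_left).aesm
        ((hU.g.rpow s).mono inter_subset_left))).mul h.1)
  have hGn : eLpNorm G P volume ≤ N := by
    rw [hG, eLpNorm_indicator_eq_eLpNorm_restrict hm]; exact h.2
  have hΛs : 0 ≤ Λ ^ |s| := by positivity
  have h1 : eLpNorm (fun x => W x ^ s * upI U i u (Rl i lam x)) P (volume.restrict U) ≤
      (Real.toNNReal (Λ ^ |s|)) • eLpNorm (fun x => G (Rl i lam x)) P (volume.restrict U) := by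
    apply eLpNorm_le_nnreal_smul_eLpNorm_of_ae_le_mul
    filter_upwards [ae_restrict_mem hU.g.op.measurableSet] with x hx
    rw [← NNReal.coe_le_coe, NNReal.coe_mul, Real.coe_toNNReal _ hΛs, coe_nnnorm, coe_nnnorm]
    by_cases hR : Rl i lam x ∈ upS U i
    · have hxi : x i < 0 := by
        have h2 : 0 < Rl i lam x i := hR.2
        rw [Rl_self] at h2
        nlinarith
      obtain ⟨w1, w2⟩ := hU.wt x hx hxi lam hl
      have p1 := hU.g.pos x hx
      have p2 := hU.g.pos _ hR.1
      have := rpow_le_of_comp p1 p2 hΛ w2 w1 s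
      rw [hG, indicator_of_mem hR, upI, indicator_of_mem hR, norm_mul, norm_mul,
        Real.norm_of_nonneg (Real.rpow_nonneg p1.le s), Real.norm_of_nonneg (Real.rpow_nonneg p2.le s),
        ← mul_assoc]
      gcongr
    · rw [upI, indicator_of_notMem hR]
      simp only [mul_zero, norm_zero]
      positivity
  have h2 : eLpNorm (fun x => G (Rl i lam x)) P (volume.restrict U) ≤
      (Real.toNNReal Λ : ℝ≥0∞) * N := by
    refine (eLpNorm_mono_measure _ Measure.restrict_le_self).trans ?_
    have h3 : eLpNorm G P (Measure.map (Rl i lam) volume) =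
        eLpNorm (G ∘ Rl i lam) P volume :=
      (Rl_emb i hl.ne').eLpNorm_map_measure
    rw [Rl_map i hl, eLpNorm_smul_measure_of_ne_top hP] at h3
    change eLpNorm (G ∘ Rl i lam) P volume ≤ _
    rw [← h3, smul_eq_mul]
    gcongr
    have h4 : (0 : ℝ) ≤ (1 / P).toReal := ENNReal.toReal_nonneg
    have h5 : (1 / P).toReal ≤ 1 := by
      have : 1 / P ≤ 1 := by
        rw [one_div]; exact ENNReal.inv_le_one.2 hP1
      simpa using ENNReal.toReal_mono (by simp) this
    have h6 : ENNReal.ofReal lam⁻¹ ≤ ENNReal.ofReal Λ :=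
      ENNReal.ofReal_le_ofReal (le_max_right _ _)
    calc ENNReal.ofReal lam⁻¹ ^ (1 / P).toReal ≤ ENNReal.ofReal Λ ^ (1 / P).toReal :=
          ENNReal.rpow_le_rpow h6 h4
      _ ≤ ENNReal.ofReal Λ ^ (1 : ℝ) :=
          ENNReal.rpow_le_rpow_of_exponent_le (by simpa using hΛ) h5
      _ = _ := by rw [ENNReal.rpow_one]; rfl
  refine h1.trans ?_
  rw [ENNReal.smul_def, smul_eq_mul]
  refine (mul_le_mul' le_rfl h2).trans ?_
  rw [← mul_assoc, ← ENNReal.coe_mul, ← ENNReal.coe_mul, ENNReal.coe_le_coe]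
  refine mul_le_mul' ?_ le_rfl
  rw [← Real.toNNReal_mul hΛs]
  apply Real.toNNReal_le_toNNReal
  rw [pow_succ]
  gcongr
  rw [← Real.rpow_natCast]
  exact Real.rpow_le_rpow_of_exponent_le hΛ (Nat.le_ceil _)

theorem refl_integral {U : Set (Ed d)} {W : Ed d → ℝ} {i : Fin d} (hU : ReflW U W i) {P : ℝ≥0∞}
    (hP1 : 1 ≤ P) (hP : P ≠ ⊤) {s : ℝ} {u : Ed d → ℝ} {N : ℝ≥0} (h : L0 (upS U i) W P s u N)
    {lam : ℝ} (hl : 0 < lam) (κ : ℝ) {φ : Ed d → ℝ} (hφ : Continuous φ) (hc : HasCompactSupport φ)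
    (hs : tsupport φ ⊆ U) :
    ∫ x in U, (upI U i u x + κ * upI U i u (Rl i lam x)) * φ x =
      ∫ x in upS U i, u x * (φ x + κ * lam⁻¹ * φ (Rl i lam⁻¹ x)) := by
  have hm := (upS_open hU.g.op i).measurableSet
  have hz : ∀ x, x ∉ U → φ x = 0 := fun x hx => image_eq_zero_of_notMem_tsupport fun h => hx (hs h)
  have h1 := (h.up hU.g).integrable_mul hU.g hU.g.op.measurableSet subset_rfl hP1 hφ hc hs
  have h2 := (h.refl hU hP1 hP hl).integrable_mul hU.g hU.g.op.measurableSet subset_rfl hP1 hφ hc hs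
  have tot : ∀ f : Ed d → ℝ, IntegrableOn (fun x => f x * φ x) U →
      Integrable (fun x => f x * φ x) := fun f hf =>
    (integrableOn_iff_integrable_of_support_subset (fun x hx => by
      by_contra hxU
      exact hx (by simp [hz x hxU]))).1 hf
  have h1 := tot _ h1
  have h2 := tot _ h2
  have e2 : (fun x => upI U i u (Rl i lam x) * φ x) =
      fun x => (fun y => upI U i u y * φ (Rl i lam⁻¹ y)) (Rl i lam x) := by
    funext x; simp only [Rl_Rl i hl.ne']
  have h3 := Rl_integrable i hl (f := fun y => upI U i u y * φ (Rl i lam⁻¹ y)) (by rw [← e2]; exact h2)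
  rw [setIntegral_eq_integral_of_forall_compl_eq_zero (fun x hx => by rw [hz x hx, mul_zero]),
    ← integral_indicator hm]
  calc ∫ x, (upI U i u x + κ * upI U i u (Rl i lam x)) * φ x
      = ∫ x, (upI U i u x * φ x + κ * (upI U i u (Rl i lam x) * φ x)) := by
        congr 1; funext x; ring
    _ = (∫ x, upI U i u x * φ x) + κ * ∫ x, upI U i u (Rl i lam x) * φ x := by
        rw [integral_add h1 (h2.const_mul κ), integral_const_mul]
    _ = (∫ x, upI U i u x * φ x) + κ * (lam⁻¹ * ∫ x, upI U i u x * φ (Rl i lam⁻¹ x)) := by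
        rw [e2, Rl_integral i hl (fun y => upI U i u y * φ (Rl i lam⁻¹ y))]
    _ = ∫ x, (upI U i u x * φ x + (κ * lam⁻¹) * (upI U i u x * φ (Rl i lam⁻¹ x))) := by
        rw [integral_add h1 (h3.const_mul _), integral_const_mul, mul_assoc]
    _ = _ := by
        congr 1; funext x
        by_cases hx : x ∈ upS U i
        · rw [indicator_of_mem hx, upI, indicator_of_mem hx]; ring
        · rw [indicator_of_notMem hx, upI, indicator_of_notMem hx]; ring

theorem pderivI_comp_Rl (i j : Fin d) (mu : ℝ) {φ : Ed d → ℝ} (hφ : ContDiff ℝ ∞ φ) (x : Ed d) :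
    pderivI d j (fun x => φ (Rl i mu x)) x =
      (if j = i then -mu else 1) * pderivI d j φ (Rl i mu x) := by
  have h1 := ((hφ.differentiable (by simp) (Rl i mu x)).hasFDerivAt).comp x (Rl i mu).hasFDerivAt
  have h2 : fderiv ℝ (fun x => φ (Rl i mu x)) x = _ := h1.fderiv
  rw [pderivI, h2, ContinuousLinearMap.comp_apply, pderivI]
  have h3 : Rl i mu (EuclideanSpace.single j (1 : ℝ)) =
      (if j = i then -mu else 1) • EuclideanSpace.single j (1 : ℝ) := by
    ext l
    rw [Rl_apply]
    by_cases hj : j = i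
    · subst hj
      by_cases hlj : l = j
      · subst hlj; simp
      · simp [hlj]
    · by_cases hlj : l = i
      · subst hlj; simp [hj, Ne.symm hj]
      · simp [hlj, hj]
  rw [h3, map_smul, smul_eq_mul]

theorem WD.refl {U : Set (Ed d)} {W : Ed d → ℝ} {i : Fin d} (hU : ReflW U W i) {P : ℝ≥0∞}
    (hP1 : 1 ≤ P) (hP : P ≠ ⊤) {s s' : ℝ} {u v : Ed d → ℝ} {N N' : ℝ≥0}
    (h : L0 (upS U i) W P s u N) (h' : L0 (upS U i) W P s' v N') {j : Fin d}
    (hw : WD (upS U i) j u v) {lam : ℝ} (hl : 0 < lam) :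
    WD U j (fun x => upI U i u x + upI U i u (Rl i lam x))
      (fun x => upI U i v x + (if j = i then -lam else 1) * upI U i v (Rl i lam x)) := by
  intro φ hφ
  have a1 := refl_integral hU hP1 hP h hl 1 (hφ.pd j).1.continuous (hφ.pd j).2.1 (hφ.pd j).2.2
  have a2 := refl_integral hU hP1 hP h' hl (if j = i then -lam else 1) hφ.1.continuous hφ.2.1 hφ.2.2
  simp only [one_mul] at a1
  rw [a1, a2]
  set c : ℝ := (if j = i then -lam else 1) with hc
  have hl' : lam ≠ 0 := hl.ne'
  have hφs : ContDiff ℝ ∞ φ := hφ.1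
  have hψ : ContDiff ℝ ∞ (fun x => φ (Rl i lam⁻¹ x)) := hφs.comp (Rl i lam⁻¹).contDiff
  have hψc : HasCompactSupport (fun x => φ (Rl i lam⁻¹ x)) :=
    hφ.2.1.comp_homeomorph (Rh i (inv_ne_zero hl'))
  set Φ : Ed d → ℝ := fun x => φ x + c * lam⁻¹ * φ (Rl i lam⁻¹ x) with hΦ
  have key := ibp_bdry hU.g i hP1 h h' hw (Φ := Φ)
    (hφs.add (contDiff_const.mul hψ)) (hφ.2.1.add hψc.mul_left) ?_ ?_
  · rw [← key]
    congr 1; funext x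
    congr 1
    have d1 := hφs.differentiable (by simp) x
    have d2 := hψ.differentiable (by simp) x
    have : pderivI d j Φ x = pderivI d j φ x + c * lam⁻¹ * pderivI d j (fun x => φ (Rl i lam⁻¹ x)) x := by
      simp only [pderivI, hΦ]
      rw [fderiv_fun_add d1 (d2.const_mul _), fderiv_const_mul d2]
      simp
    rw [this, pderivI_comp_Rl i j _ hφs]
    by_cases hj : j = i
    · simp only [hc, hj, if_true]; field_simp
    · simp only [hc, hj, if_false]; ring
  · intro x hx hxi
    have : x ∈ tsupport φ ∪ tsupport (fun x => φ (Rl i lam⁻¹ x)) := by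
      by_contra hx'
      rw [mem_union, not_or, notMem_tsupport_iff_eventuallyEq, notMem_tsupport_iff_eventuallyEq] at hx'
      refine (notMem_tsupport_iff_eventuallyEq.2 ?_) hx
      filter_upwards [hx'.1, hx'.2] with y h1 h2
      simp only [hΦ]
      rw [h1, h2]; simp
    rcases this with h1 | h1
    · exact hφ.2.2 h1
    · have h2 : Rl i lam⁻¹ x ∈ tsupport φ :=
        tsupport_comp_subset_preimage φ (Rl i lam⁻¹).continuous h1
      have h3 := hφ.2.2 h2
      rcases hxi.eq_or_lt with h0 | h0
      · rwa [Rl_fix i _ h0.symm] at h3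
      · have := hU.maps _ h3 (by rw [Rl_self]; have := inv_pos.2 hl; nlinarith) lam hl
        rwa [Rl_Rl' i hl'] at this
  · intro hj x hx
    simp only [hΦ, Rl_fix i _ hx, hc, hj, if_true]
    field_simp; ring

end Refl


/-! ### The extension operator across a flat boundary -/

section ExtOp
variable {d : ℕ}

theorem exists_tsL : ∃ L : (ℤ → ℝ) →ₗ[ℝ] ℝ, ∀ f, Summable f → L f = ∑' k, f k := by
  let S : Submodule ℝ (ℤ → ℝ) :=
    { carrier := {f | Summable f}
      add_mem' := fun ha hb => Summable.add ha hb
      zero_mem' := summable_zero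
      smul_mem' := fun c f hf => Summable.const_smul c hf }
  let T : S →ₗ[ℝ] ℝ :=
    { toFun := fun f => ∑' k, (f : ℤ → ℝ) k
      map_add' := fun f g => Summable.tsum_add f.2 g.2
      map_smul' := fun c f => Summable.tsum_const_smul c f.2 }
  obtain ⟨L, hL⟩ := T.exists_extend
  refine ⟨L, fun f hf => ?_⟩
  have := LinearMap.congr_fun hL (⟨f, hf⟩ : S)
  exact this

/-- a linear extension of summation -/
def tsL : (ℤ → ℝ) →ₗ[ℝ] ℝ := exists_tsL.choose

theorem tsL_eq {f : ℤ → ℝ} {a : ℝ} (h : Summable f) (ha : tsL f = a) : HasSum f a := by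
  rw [← ha, tsL, exists_tsL.choose_spec f h]
  exact h.hasSum

open Classical in
/-- the extension operator -/
def StExt (i : Fin d) (lam b : ℤ → ℝ) : (Ed d → ℝ) →ₗ[ℝ] (Ed d → ℝ) where
  toFun u x := if 0 < x i then u x else if x i < 0 then tsL (fun k => b k * u (Rl i (lam k) x)) else 0
  map_add' u v := by
    funext x
    by_cases h : 0 < x i
    · simp [h]
    · by_cases h' : x i < 0
      · simp only [h, h', if_true, if_false, Pi.add_apply]
        rw [← map_add]
        congr 1
        funext k
        simp [mul_add]
      · simp [h, h']
  map_smul' c u := by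
    funext x
    by_cases h : 0 < x i
    · simp [h]
    · by_cases h' : x i < 0
      · simp only [h, h', if_true, if_false, Pi.smul_apply, RingHom.id_apply]
        rw [← map_smul]
        congr 1
        funext k
        simp [mul_left_comm]
      · simp [h, h']

theorem StExt_pos {i : Fin d} {lam b : ℤ → ℝ} {u : Ed d → ℝ} {x : Ed d} (h : 0 < x i) :
    StExt i lam b u x = u x := by simp [StExt, h]

theorem L0.const_mul {Ω : Set (Ed d)} {w : Ed d → ℝ}
    {P : ℝ≥0∞} {s : ℝ} {u : Ed d → ℝ} {N : ℝ≥0} (c : ℝ)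
    (h : L0 Ω w P s u N) : L0 Ω w P s (fun x => c * u x) (‖c‖₊ * N) := by
  refine ⟨h.1.const_mul c, ?_⟩
  have : (fun x => w x ^ s * (c * u x)) = c • fun x => w x ^ s * u x := by
    funext x; simp; ring
  rw [this, eLpNorm_const_smul, ENNReal.coe_mul]
  exact mul_le_mul' le_rfl h.2

theorem WD.const_mul {Ω : Set (Ed d)} {i : Fin d} {u v : Ed d → ℝ} (c : ℝ)
    (h : WD Ω i u v) : WD Ω i (fun x => c * u x) (fun x => c * v x) := by
  intro φ hφ
  simp only [mul_assoc]
  rw [integral_const_mul, integral_const_mul, h φ hφ, mul_neg]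

theorem ext_hasSum {U : Set (Ed d)} {W : Ed d → ℝ} {i : Fin d} (hU : ReflW U W i) {P : ℝ≥0∞}
    (hP1 : 1 ≤ P) (hP : P ≠ ⊤) {lam b : ℤ → ℝ} (hb : GoodB lam b) (s : ℝ) :
    ∃ C : ℝ≥0, ∀ u N, L0 (upS U i) W P s u N →
    ∃ A : ℤ → ℝ≥0, Summable A ∧ ∑' k, A k = C * N ∧
      (∀ k, L0 U W P s (fun x => b k * (upI U i u x + upI U i u (Rl i (lam k) x))) (A k)) ∧
      ∀ᵐ x ∂(volume.restrict U),
        HasSum (fun k => b k * (upI U i u x + upI U i u (Rl i (lam k) x))) (StExt i lam b u x) := by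
  set B : ℤ → ℝ≥0 := fun k =>
    ‖b k‖₊ * (1 + Real.toNNReal ((max (lam k) (lam k)⁻¹) ^ (⌈|s|⌉₊ + 1))) with hB
  have hBs : Summable B := by
    rw [← NNReal.summable_coe]
    refine ((hb.sm 0).add (hb.sm (⌈|s|⌉₊ + 1))).congr fun k => ?_
    have : 0 ≤ max (lam k) (lam k)⁻¹ := (hb.pos k).le.trans (le_max_left _ _)
    simp only [hB, NNReal.coe_mul, NNReal.coe_add, NNReal.coe_one, coe_nnnorm, Real.norm_eq_abs]
    rw [Real.coe_toNNReal _ (by positivity)]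
    ring
  refine ⟨∑' k, B k, fun u N h => ⟨fun k => B k * N, hBs.mul_right N, ?_, ?_⟩⟩
  · rw [NNReal.tsum_mul_right]
  have hL : ∀ k, L0 U W P s (fun x => b k * (upI U i u x + upI U i u (Rl i (lam k) x))) (B k * N) := by
    intro k
    have := ((h.up hU.g).add hU.g hP1 (h.refl hU hP1 hP (hb.pos k))).const_mul (b k)
    refine L0.mono this (le_of_eq ?_)
    simp only [hB]; ring
  refine ⟨hL, ?_⟩
  filter_upwards [L0.tsum_ae hU.g hP1 (hBs.mul_right N) hL,
    ae_restrict_mem hU.g.op.measurableSet] with x hx hxU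
  rcases lt_trichotomy (x i) 0 with h0 | h0 | h0
  · refine tsL_eq hx ?_
    simp only [StExt, LinearMap.coe_mk, AddHom.coe_mk, h0, not_lt.2 h0.le, if_true, if_false]
    congr 1
    funext k
    have h1 : x ∉ upS U i := fun h => not_lt.2 h0.le h.2
    have h2 : Rl i (lam k) x ∈ upS U i := ⟨hU.maps x hxU h0 _ (hb.pos k), by
      show 0 < Rl i (lam k) x i
      rw [Rl_self]
      have := hb.pos k
      nlinarith⟩
    simp [upI, h1, h2]
  · have h1 : ∀ k, b k * (upI U i u x + upI U i u (Rl i (lam k) x)) = 0 := fun k => by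
      rw [Rl_fix i _ h0]
      have h1 : x ∉ upS U i := fun h => (h0 ▸ (lt_irrefl _) : ¬ (0 < x i)) h.2
      simp [upI, h1]
    simp only [h1, StExt, LinearMap.coe_mk, AddHom.coe_mk, h0, lt_irrefl, if_false]
    exact hasSum_zero
  · rw [StExt_pos h0]
    have h1 : ∀ k, b k * (-lam k) ^ 0 * u x =
        b k * (upI U i u x + upI U i u (Rl i (lam k) x)) := fun k => by
      rw [upI_Rl_of_nonneg U i u (hb.pos k) h0.le]
      have h1 : x ∈ upS U i := ⟨hxU, h0⟩
      simp [upI, h1]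
    have h2 := (hb.one 0).mul_right (u x)
    rw [one_mul] at h2
    exact h2.congr_fun fun k => (h1 k).symm

theorem StExt.bdd {U : Set (Ed d)} {W : Ed d → ℝ} {i : Fin d} (hU : ReflW U W i) {lam b : ℤ → ℝ}
    (hb : GoodB lam b) : Bdd (upS U i) W U W (StExt i lam b) := by
  intro P hP1 hP m
  induction m generalizing b with
  | zero =>
    intro s
    obtain ⟨C, hC⟩ := ext_hasSum hU hP1 hP hb s
    refine ⟨C, fun u N h => ?_⟩
    obtain ⟨A, hA, hAt, hL, hF⟩ := hC u N h
    rw [← hAt]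
    exact L0.tsum hU.g hP1 hA hL hF
  | succ m ih =>
    intro s
    obtain ⟨C, hC⟩ := ext_hasSum hU hP1 hP hb s
    obtain ⟨C1, hC1⟩ := ih hb (s + 1)
    obtain ⟨C2, hC2⟩ := ih hb.shift (s + 1)
    obtain ⟨D1, hD1⟩ := ext_hasSum hU hP1 hP hb (s + 1)
    obtain ⟨D2, hD2⟩ := ext_hasSum hU hP1 hP hb.shift (s + 1)
    refine ⟨C + C1 + C2, fun u N h => ?_⟩
    obtain ⟨A, hA, hAt, hL, hF⟩ := hC u N h.1
    refine ⟨(by rw [← hAt]; exact L0.tsum hU.g hP1 hA hL hF : L0 U W P s _ (C * N)).mono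
      (mul_le_mul' (by rw [add_assoc]; exact le_self_add) le_rfl), fun j => ?_⟩
    obtain ⟨v, hv, hk⟩ := h.2 j
    by_cases hj : j = i
    · refine ⟨StExt i lam (fun k => -lam k * b k) v, ?_, (hC2 v N hk).mono
        (mul_le_mul' le_add_self le_rfl)⟩
      obtain ⟨A', hA', hAt', hL', hF'⟩ := hD2 v N hk.l0
      -- the derivative series written with the original coefficients
      have hg : ∀ᵐ x ∂(volume.restrict U), HasSum (fun k => b k *
          (upI U i v x + (if j = i then -lam k else 1) * upI U i v (Rl i (lam k) x)))
          (StExt i lam (fun k => -lam k * b k) v x) := by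
        have hc : HasSum (fun k => b k * (1 + lam k)) 0 := by
          have h0 := hb.one 0
          have h1 := hb.one 1
          have := h0.sub h1
          simp only [pow_zero, pow_one, sub_self] at this
          exact this.congr_fun fun k => by ring
        filter_upwards [hF'] with x hx
        have := hx.add (hc.mul_right (upI U i v x))
        rw [zero_mul, add_zero] at this
        refine this.congr_fun fun k => ?_
        simp only [hj, if_true]; ring
      have hLg : ∃ A'' : ℤ → ℝ≥0, Summable A'' ∧ ∀ k, L0 U W P (s + 1) (fun x => b k *
          (upI U i v x + (if j = i then -lam k else 1) * upI U i v (Rl i (lam k) x))) (A'' k) := by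
        have hs1 : Summable fun k => ‖b k * (1 + lam k)‖₊ * N := by
          apply Summable.mul_right
          rw [← NNReal.summable_coe]
          refine Summable.of_nonneg_of_le (fun k => NNReal.coe_nonneg _) (fun k => ?_)
            ((hb.sm 0).add (hb.sm 1))
          rw [coe_nnnorm, norm_mul, Real.norm_eq_abs, Real.norm_of_nonneg (by linarith [hb.pos k])]
          rw [← mul_add, pow_zero, pow_one]
          gcongr
          exact le_max_left _ _
        refine ⟨fun k => A' k + ‖b k * (1 + lam k)‖₊ * N, hA'.add hs1, fun k => ?_⟩
        have := (hL' k).add hU.g hP1 ((hk.l0.up hU.g).const_mul (b k * (1 + lam k)))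
        refine L0.congr this (Filter.Eventually.of_forall fun x => ?_)
        simp only [hj, if_true, Pi.add_apply]; ring
      obtain ⟨A'', hA'', hL''⟩ := hLg
      exact WD.tsum hU.g hP1 hA hA'' hL hL'' hF hg
        fun k => (WD.refl hU hP1 hP h.1 hk.l0 hv (hb.pos k)).const_mul (b k)
    · refine ⟨StExt i lam b v, ?_, (hC1 v N hk).mono
        (mul_le_mul' (le_self_add.trans' le_add_self) le_rfl)⟩
      obtain ⟨A', hA', hAt', hL', hF'⟩ := hD1 v N hk.l0
      refine WD.tsum hU.g hP1 hA hA' hL hL' hF hF' fun k => ?_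
      have := (WD.refl hU hP1 hP h.1 hk.l0 hv (hb.pos k)).const_mul (b k)
      simpa only [hj, if_false, one_mul] using this

end ExtOp


/-! ### Extension property and basic operations -/

section HE
variable {d : ℕ}

/-- existence of a bounded linear extension operator -/
def HasExt (Ω : Set (Ed d)) (w : Ed d → ℝ) (Ω' : Set (Ed d)) (w' : Ed d → ℝ) : Prop :=
  ∃ T, Bdd Ω w Ω' w' T ∧ ∀ u, ∀ x ∈ Ω, T u x = u x

theorem HasExt.trans {Ω Ω' Ω'' : Set (Ed d)} {w w' w'' : Ed d → ℝ} (h : HasExt Ω w Ω' w')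
    (h' : HasExt Ω' w' Ω'' w'') (hs : Ω ⊆ Ω') : HasExt Ω w Ω'' w'' := by
  obtain ⟨T, hT, hT'⟩ := h
  obtain ⟨S, hS, hS'⟩ := h'
  refine ⟨S ∘ₗ T, hS.comp hT, fun u x hx => ?_⟩
  rw [LinearMap.comp_apply, hS' _ x (hs hx), hT' u x hx]

theorem HasExt.flat {U : Set (Ed d)} {W : Ed d → ℝ} {i : Fin d} (hU : ReflW U W i) :
    HasExt (upS U i) W U W := by
  obtain ⟨lam, b, hb⟩ := exists_goodB
  exact ⟨StExt i lam b, StExt.bdd hU hb, fun u x hx => StExt_pos hx.2⟩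

theorem HasExt.conj {Ω Ω' V V' : Set (Ed d)} {w w' W W' : Ed d → ℝ} {Φ Ψ : Ed d → Ed d}
    (h : Dif Ω w V W Φ Ψ) (h' : Dif Ω' w' V' W' Φ Ψ) (he : HasExt V W V' W') :
    HasExt Ω w Ω' w' := by
  obtain ⟨T, hT, hT'⟩ := he
  refine ⟨pullL Φ ∘ₗ (T ∘ₗ pullL Ψ), h'.bdd.comp (hT.comp h.symm.bdd), fun u x hx => ?_⟩
  change T (pullL Ψ u) (Φ x) = u x
  rw [hT' _ _ (h.maps hx)]
  change u (Ψ (Φ x)) = u x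
  rw [h.inv x hx]

theorem HasExt.restr {Ω : Set (Ed d)} {w w' : Ed d → ℝ} (hΩ : GoodW Ω w) (hΩ' : GoodW Ω w')
    (A : ℝ) (hA : 1 ≤ A) (hw : ∀ x ∈ Ω, w x ≤ A * w' x ∧ w' x ≤ A * w x) :
    HasExt Ω w Ω w' :=
  ⟨LinearMap.id, Bdd.restr hΩ hΩ' subset_rfl A hA hw, fun _ _ _ => rfl⟩

theorem HasExt.rfl' {Ω : Set (Ed d)} {w : Ed d → ℝ} (hΩ : GoodW Ω w) : HasExt Ω w Ω w :=
  HasExt.restr hΩ hΩ 1 le_rfl fun x _ => by simp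

/-- cutting off an extension -/
theorem HasExt.cut {Ω U Ω' : Set (Ed d)} {w W : Ed d → ℝ} (h : HasExt Ω w U W)
    (hU : GoodW U W) (hΩ' : GoodW Ω' W) (hs : Ω ⊆ U) {χ : Ed d → ℝ} (hχ : KSym Ω' W 0 χ)
    (hsup : Ω' ∩ tsupport χ ⊆ U) (h1 : ∀ x ∈ Ω, χ x = 1) : HasExt Ω w Ω' W := by
  obtain ⟨T, hT, hT'⟩ := h
  refine ⟨cutL U χ ∘ₗ T, (Bdd.cut hU hΩ' hχ hsup 1 le_rfl fun x _ => by simp).comp hT,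
    fun u x hx => ?_⟩
  rw [LinearMap.comp_apply, cutL_of_mem (hs hx), h1 x hx, hT' u x hx, one_mul]

/-- gluing -/
theorem HasExt.glue {Ω Ω' V V' : Set (Ed d)} {w w' v v' : Ed d → ℝ} (hΩ : GoodW Ω w)
    (hΩ' : GoodW Ω' w') (hV : GoodW V v) (hV' : GoodW V' v') (he : HasExt V v V' v')
    (A : ℝ) (hA : 1 ≤ A) {η1 θ η2 : Ed d → ℝ}
    (k1 : KSym Ω' w' 0 η1) (s1 : Ω' ∩ tsupport η1 ⊆ Ω)
    (w1 : ∀ x ∈ Ω' ∩ tsupport η1, w x ≤ A * w' x ∧ w' x ≤ A * w x)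
    (k2 : KSym V v 0 θ) (s2 : V ∩ tsupport θ ⊆ Ω)
    (w2 : ∀ x ∈ V ∩ tsupport θ, w x ≤ A * v x ∧ v x ≤ A * w x)
    (k3 : KSym Ω' w' 0 η2) (s3 : Ω' ∩ tsupport η2 ⊆ V')
    (w3 : ∀ x ∈ Ω' ∩ tsupport η2, v' x ≤ A * w' x ∧ w' x ≤ A * v' x)
    (hVV : V ⊆ V')
    (e1 : ∀ x ∈ Ω, x ∈ V → η1 x + η2 x * θ x = 1)
    (e2 : ∀ x ∈ Ω, x ∉ V → η1 x = 1 ∧ x ∉ V') : HasExt Ω w Ω' w' := by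
  obtain ⟨T, hT, hT'⟩ := he
  refine ⟨cutL Ω η1 + cutL V' η2 ∘ₗ (T ∘ₗ cutL Ω θ), Bdd.add hΩ' (Bdd.cut hΩ hΩ' k1 s1 A hA w1)
    ((Bdd.cut hV' hΩ' k3 s3 A hA w3).comp (hT.comp (Bdd.cut hΩ hV k2 s2 A hA w2))), ?_⟩
  intro u x hx
  rw [LinearMap.add_apply, Pi.add_apply, cutL_of_mem hx, LinearMap.comp_apply, LinearMap.comp_apply]
  by_cases hxV : x ∈ V
  · rw [cutL_of_mem (hVV hxV), hT' _ x hxV, cutL_of_mem hx]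
    have := e1 x hx hxV
    calc η1 x * u x + η2 x * (θ x * u x) = (η1 x + η2 x * θ x) * u x := by ring
      _ = u x := by rw [this, one_mul]
  · obtain ⟨h1, h2⟩ := e2 x hx hxV
    rw [cutL_of_notMem h2, h1]; simp

theorem KSym.union {Ω Ω' : Set (Ed d)} {w : Ed d → ℝ} {r : ℝ} {χ : Ed d → ℝ}
    (h : KSym Ω w r χ) (h' : KSym Ω' w r χ) (ho : IsOpen Ω) (ho' : IsOpen Ω')
    (hw : ∀ x ∈ Ω ∪ Ω', 0 < w x) : KSym (Ω ∪ Ω') w r χ := by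
  refine ⟨fun x hx => ?_, fun l => ?_⟩
  · rcases hx with hx | hx
    · exact (h.1.contDiffAt (ho.mem_nhds hx)).contDiffWithinAt
    · exact (h'.1.contDiffAt (ho'.mem_nhds hx)).contDiffWithinAt
  · obtain ⟨C, hC, hb⟩ := h.2 l
    obtain ⟨C', hC', hb'⟩ := h'.2 l
    refine ⟨C + C', by positivity, fun x hx => ?_⟩
    have := Real.rpow_pos_of_pos (hw x hx) (r - l.length)
    rcases hx with hx | hx
    · refine (hb x hx).trans ?_
      gcongr; linarith
    · refine (hb' x hx).trans ?_
      gcongr; linarith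

theorem KSym.weight {Ω : Set (Ed d)} {w w' : Ed d → ℝ} {r : ℝ} {χ : Ed d → ℝ}
    (h : KSym Ω w r χ) (hr : r ≤ 0) (hw : ∀ x ∈ Ω, 0 < w' x ∧ w' x ≤ w x) : KSym Ω w' r χ := by
  refine ⟨h.1, fun l => ?_⟩
  obtain ⟨C, hC, hb⟩ := h.2 l
  refine ⟨C, hC, fun x hx => (hb x hx).trans ?_⟩
  refine mul_le_mul_of_nonneg_left ?_ hC
  refine Real.rpow_le_rpow_of_nonpos (hw x hx).1 (hw x hx).2 ?_
  have : (0 : ℝ) ≤ l.length := Nat.cast_nonneg _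
  linarith

theorem KSym.of_compact {Ω V K : Set (Ed d)} {w : Ed d → ℝ} {χ : Ed d → ℝ}
    (hV : IsOpen V) (hχ : ContDiffOn ℝ ∞ χ V) (hK : IsCompact K) (hKV : K ⊆ V) (hΩ : Ω ⊆ K)
    (hw : ∀ x ∈ Ω, 0 < w x ∧ w x ≤ 1) : KSym Ω w 0 χ := by
  refine KSym.of_closed (fun r f => r ≤ 0 ∧ ContDiffOn ℝ ∞ f V) ?_ ?_ ⟨le_rfl, hχ⟩
    (hχ.mono (hΩ.trans hKV))
  · rintro r f ⟨hr, hf⟩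
    obtain ⟨C, hC⟩ := hK.exists_bound_of_continuousOn (hf.continuousOn.mono hKV)
    refine ⟨|C|, abs_nonneg _, fun x hx => ?_⟩
    have h1 : 1 ≤ w x ^ r := Real.one_le_rpow_of_pos_of_le_one_of_nonpos (hw x hx).1 (hw x hx).2 hr
    have h2 := (hC x (hΩ hx)).trans (le_abs_self C)
    rw [Real.norm_eq_abs] at h2
    nlinarith [abs_nonneg C]
  · rintro r f ⟨hr, hf⟩ i
    exact ⟨by linarith, pderivI_contDiffOn hV hf i⟩

end HE

section Rho
variable {d : ℕ}

theorem rhoModel_eq (ℓ : ℕ) (x : Ed d) : rhoModel d ℓ x = min 1 (rhoPrime d ℓ x) := rfl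

theorem rhoPrime_nonneg (ℓ : ℕ) (x : Ed d) : 0 ≤ rhoPrime d ℓ x := Real.sqrt_nonneg _

theorem rhoPrime_cont (ℓ : ℕ) : Continuous (rhoPrime d ℓ) := by
  unfold rhoPrime
  refine Real.continuous_sqrt.comp (continuous_finsetSum _ fun i _ => (cont_coord i).pow 2)

theorem rhoModel_cont (ℓ : ℕ) : Continuous (rhoModel d ℓ) :=
  continuous_const.min (rhoPrime_cont ℓ)

theorem rhoPrime_pos {ℓ : ℕ} {x : Ed d} : 0 < rhoPrime d ℓ x ↔ x ∈ ModelDomain d ℓ := by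
  rw [rhoPrime, Real.sqrt_pos, ModelDomain, mem_compl_iff, RStar, mem_setOf_eq]
  constructor
  · intro h hx
    refine h.ne' (Finset.sum_eq_zero fun i hi => ?_)
    rw [hx i (Finset.mem_filter.1 hi).2]; simp
  · intro h
    push Not at h
    obtain ⟨i, hi, hx⟩ := h
    exact Finset.sum_pos' (fun j _ => sq_nonneg _) ⟨i, by simp [hi], by positivity⟩

theorem rhoModel_pos {ℓ : ℕ} {x : Ed d} (h : x ∈ ModelDomain d ℓ) : 0 < rhoModel d ℓ x :=
  lt_min one_pos (rhoPrime_pos.2 h)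

theorem rhoModel_le_one (ℓ : ℕ) (x : Ed d) : rhoModel d ℓ x ≤ 1 := min_le_left _ _

theorem modelDomain_open (ℓ : ℕ) : IsOpen (ModelDomain d ℓ) := by
  have : ModelDomain d ℓ = {x | 0 < rhoPrime d ℓ x} := by ext x; exact rhoPrime_pos.symm
  rw [this]
  exact isOpen_lt continuous_const (rhoPrime_cont ℓ)

theorem rhoPrime_le_mul {ℓ : ℕ} {x y : Ed d} {c : ℝ} (hc : 0 ≤ c)
    (h : ∀ j : Fin d, (j : ℕ) < d - ℓ → |y j| ≤ c * |x j|) : rhoPrime d ℓ y ≤ c * rhoPrime d ℓ x := by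
  rw [rhoPrime, rhoPrime, ← Real.sqrt_sq hc, ← Real.sqrt_mul (sq_nonneg c), Finset.mul_sum]
  apply Real.sqrt_le_sqrt
  refine Finset.sum_le_sum fun j hj => ?_
  have := h j (Finset.mem_filter.1 hj).2
  rw [← mul_pow, ← sq_abs (y j), ← sq_abs (c * x j), abs_mul, abs_of_nonneg hc]
  gcongr

theorem rhoPrime_smul {ℓ : ℕ} {x : Ed d} {t : ℝ} (ht : 0 ≤ t) :
    rhoPrime d ℓ (t • x) = t * rhoPrime d ℓ x := by
  rw [rhoPrime, rhoPrime]
  nth_rewrite 2 [← Real.sqrt_sq ht]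
  rw [← Real.sqrt_mul (sq_nonneg t), Finset.mul_sum]
  simp [mul_pow]

theorem rhoPrime_le_norm (ℓ : ℕ) (x : Ed d) : rhoPrime d ℓ x ≤ ‖x‖ := by
  rw [rhoPrime, EuclideanSpace.norm_eq]
  apply Real.sqrt_le_sqrt
  simp only [Real.norm_eq_abs, sq_abs]
  exact Finset.sum_le_sum_of_subset_of_nonneg (Finset.filter_subset _ _) fun _ _ _ => sq_nonneg _

theorem rhoPrime_zero (x : Ed d) : rhoPrime d 0 x = ‖x‖ := by
  rw [rhoPrime, EuclideanSpace.norm_eq]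
  simp

theorem modelDomain_zero {x : Ed d} : x ∈ ModelDomain d 0 ↔ x ≠ 0 := by
  rw [← rhoPrime_pos, rhoPrime_zero, norm_pos_iff]

theorem min_one_le_mul {a b c : ℝ} (hc : 1 ≤ c) (h : a ≤ c * b) (hb : 0 ≤ b) :
    min 1 a ≤ c * min 1 b := by
  rcases le_total 1 b with h1 | h1
  · rw [min_eq_left h1]; exact (min_le_left _ _).trans (by linarith)
  · rw [min_eq_right h1]; exact (min_le_right _ _).trans h

theorem GoodW.model {Ω : Set (Ed d)} {ℓ : ℕ} (ho : IsOpen Ω) (hs : Ω ⊆ ModelDomain d ℓ) :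
    GoodW Ω (rhoModel d ℓ) :=
  ⟨ho, (rhoModel_cont ℓ).continuousOn, fun _ hx => rhoModel_pos (hs hx)⟩

/-- orthant-like sets -/
def Orth (J : Finset (Fin d)) (ℓ : ℕ) : Set (Ed d) := {x | (∀ j ∈ J, 0 < x j)} ∩ ModelDomain d ℓ

theorem Orth_open (J : Finset (Fin d)) (ℓ : ℕ) : IsOpen (Orth J ℓ) := by
  refine IsOpen.inter ?_ (modelDomain_open ℓ)
  have : {x : Ed d | ∀ j ∈ J, 0 < x j} = ⋂ j ∈ J, {x | 0 < x j} := by ext; simp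
  rw [this]
  exact isOpen_biInter_finset fun j _ => isOpen_lt continuous_const (cont_coord j)

theorem Orth_good (J : Finset (Fin d)) (ℓ : ℕ) : GoodW (Orth J ℓ) (rhoModel d ℓ) :=
  GoodW.model (Orth_open J ℓ) inter_subset_right

theorem Rl_abs_le {i : Fin d} {lam : ℝ} (hl : 0 < lam) (x : Ed d) (j : Fin d) :
    |Rl i lam x j| ≤ max lam lam⁻¹ * |x j| ∧ |x j| ≤ max lam lam⁻¹ * |Rl i lam x j| := by
  rw [Rl_apply]
  have h1 := one_le_max_inv hl
  by_cases hj : j = i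
  · subst hj
    rw [if_pos rfl, abs_mul, abs_neg, abs_of_pos hl]
    refine ⟨mul_le_mul_of_nonneg_right (le_max_left _ _) (abs_nonneg _), ?_⟩
    rw [← mul_assoc]
    have : 1 ≤ max lam lam⁻¹ * lam := by
      calc (1 : ℝ) = lam⁻¹ * lam := by field_simp
        _ ≤ _ := mul_le_mul_of_nonneg_right (le_max_right _ _) hl.le
    nlinarith [abs_nonneg (x j)]
  · rw [if_neg hj]
    have := abs_nonneg (x j)
    constructor <;> nlinarith

theorem Orth_refl {J : Finset (Fin d)} {ℓ : ℕ} {i : Fin d} (hi : i ∉ J) :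
    ReflW (Orth J ℓ) (rhoModel d ℓ) i := by
  have key : ∀ (x : Ed d) (lam : ℝ), 0 < lam →
      rhoPrime d ℓ (Rl i lam x) ≤ max lam lam⁻¹ * rhoPrime d ℓ x ∧
      rhoPrime d ℓ x ≤ max lam lam⁻¹ * rhoPrime d ℓ (Rl i lam x) := fun x lam hl => by
    have h0 : 0 ≤ max lam lam⁻¹ := hl.le.trans (le_max_left _ _)
    exact ⟨rhoPrime_le_mul h0 fun j _ => (Rl_abs_le hl x j).1,
      rhoPrime_le_mul h0 fun j _ => (Rl_abs_le hl x j).2⟩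
  refine ⟨Orth_good J ℓ, fun x hx _ lam hl => ⟨fun j hj => ?_, ?_⟩, fun x hx _ lam hl => ?_⟩
  · rw [Rl_apply, if_neg (fun h : j = i => hi (h ▸ hj))]
    exact hx.1 j hj
  · rw [← rhoPrime_pos]
    have h1 := rhoPrime_pos.2 hx.2
    have h2 := (key x lam hl).2
    have h3 := one_le_max_inv hl
    by_contra h4
    have h5 : rhoPrime d ℓ (Rl i lam x) = 0 := le_antisymm (not_lt.1 h4) (rhoPrime_nonneg _ _)
    rw [h5, mul_zero] at h2
    linarith
  · have h3 := one_le_max_inv hl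
    exact ⟨min_one_le_mul h3 (key x lam hl).1 (rhoPrime_nonneg _ _),
      min_one_le_mul h3 (key x lam hl).2 (rhoPrime_nonneg _ _)⟩

theorem HasExt.orth (J : Finset (Fin d)) (ℓ : ℕ) :
    HasExt (Orth J ℓ) (rhoModel d ℓ) (ModelDomain d ℓ) (rhoModel d ℓ) := by
  classical
  induction J using Finset.induction_on with
  | empty =>
    have : Orth (∅ : Finset (Fin d)) ℓ = ModelDomain d ℓ := by ext x; simp [Orth]
    rw [this]
    exact HasExt.rfl' (GoodW.model (modelDomain_open ℓ) subset_rfl)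
  | insert i J hi ih =>
    have : Orth (insert i J) ℓ = upS (Orth J ℓ) i := by
      ext x
      simp only [Orth, upS, mem_inter_iff, mem_setOf_eq, Finset.forall_mem_insert]
      tauto
    rw [this]
    exact (HasExt.flat (Orth_refl hi)).trans ih inter_subset_left

end Rho


/-! ### Homogeneous functions, and the cone -/

section Homog
variable {d : ℕ}

/-- smooth functions of the first `d - ℓ` variables, homogeneous of degree `r` -/
structure HomF (ℓ : ℕ) (r : ℝ) (f : Ed d → ℝ) : Prop where
  sm : ContDiffOn ℝ ∞ f (ModelDomain d ℓ)
  tr : ∀ x ∈ ModelDomain d ℓ, ∀ y ∈ RStar d ℓ, f (x + y) = f x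
  hom : ∀ x ∈ ModelDomain d ℓ, ∀ t : ℝ, 0 < t → f (t • x) = t ^ r * f x

theorem HomF.pd {ℓ : ℕ} {r : ℝ} {f : Ed d → ℝ} (h : HomF ℓ r f) (i : Fin d) :
    HomF ℓ (r - 1) (pderivI d i f) := by
  have ho := modelDomain_open (d := d) ℓ
  refine ⟨pderivI_contDiffOn ho h.sm i, fun x hx y hy => ?_, fun x hx t ht => ?_⟩
  · have h1 : (fun z => f (z + y)) =ᶠ[𝓝 x] f := by
      filter_upwards [ho.mem_nhds hx] with z hz
      exact h.tr z hz y hy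
    rw [pderivI, ← fderiv_comp_add_right, pderivI, h1.fderiv_eq]
  · have h1 : (fun z => f (t • z)) =ᶠ[𝓝 x] fun z => t ^ r * f z := by
      filter_upwards [ho.mem_nhds hx] with z hz
      exact h.hom z hz t ht
    have htx : t • x ∈ ModelDomain d ℓ := by
      rw [← rhoPrime_pos, rhoPrime_smul ht.le]
      exact mul_pos ht (rhoPrime_pos.2 hx)
    have h2 : HasFDerivAt (fun z : Ed d => t • z) (t • ContinuousLinearMap.id ℝ (Ed d)) x :=
      (hasFDerivAt_id x).const_smul t
    have h3 := (diffAt ho h.sm htx).hasFDerivAt.comp x h2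
    have h4 : HasFDerivAt (fun z => t ^ r * f z) (t ^ r • fderiv ℝ f x) x :=
      (diffAt ho h.sm hx).hasFDerivAt.const_mul (t ^ r)
    have h5 := h4.unique (h3.congr_of_eventuallyEq h1.symm)
    have h6 := congrArg (fun L : Ed d →L[ℝ] ℝ => L (EuclideanSpace.single i 1)) h5
    simp only [ContinuousLinearMap.comp_apply, ContinuousLinearMap.smul_apply, map_smul,
      ContinuousLinearMap.id_apply, smul_eq_mul] at h6
    rw [pderivI, pderivI, Real.rpow_sub ht, Real.rpow_one, div_mul_eq_mul_div, h6]
    field_simp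

theorem HomF.bound {ℓ : ℕ} {r : ℝ} {f : Ed d → ℝ} (h : HomF ℓ r f) :
    ∃ C : ℝ, 0 ≤ C ∧ ∀ x ∈ ModelDomain d ℓ, |f x| ≤ C * rhoPrime d ℓ x ^ r := by
  set K : Set (Ed d) := sphere 0 1 ∩ {x | 1 ≤ rhoPrime d ℓ x} with hK
  have hKc : IsCompact K :=
    (isCompact_sphere _ _).inter_right (isClosed_le continuous_const (rhoPrime_cont ℓ))
  have hKM : K ⊆ ModelDomain d ℓ := fun x hx => rhoPrime_pos.1 (one_pos.trans_le hx.2)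
  obtain ⟨C, hC⟩ := hKc.exists_bound_of_continuousOn (h.sm.continuousOn.mono hKM)
  refine ⟨|C|, abs_nonneg _, fun x hx => ?_⟩
  set y : Ed d := WithLp.toLp 2 fun j => if (j : ℕ) < d - ℓ then x j else 0 with hy
  have hyx : rhoPrime d ℓ y = rhoPrime d ℓ x := by
    unfold rhoPrime
    congr 1
    refine Finset.sum_congr rfl fun j hj => ?_
    have := (Finset.mem_filter.1 hj).2
    simp [hy, this]
  have hyn : ‖y‖ = rhoPrime d ℓ x := by
    rw [EuclideanSpace.norm_eq, rhoPrime, Finset.sum_filter]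
    congr 1
    refine Finset.sum_congr rfl fun j _ => ?_
    by_cases hj : (j : ℕ) < d - ℓ <;> simp [hy, hj]
  have hyM : y ∈ ModelDomain d ℓ := by rw [← rhoPrime_pos, hyx]; exact rhoPrime_pos.2 hx
  have hxy : f x = f y := by
    have := h.tr y hyM (x - y) (fun j hj => by simp [hy, hj])
    rwa [add_sub_cancel] at this
  have hρ := rhoPrime_pos.2 hx
  set ρ := rhoPrime d ℓ x with hρd
  have he : ρ⁻¹ • y ∈ K := by
    constructor
    · rw [mem_sphere_zero_iff_norm, norm_smul, hyn, Real.norm_of_nonneg (inv_nonneg.2 hρ.le)]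
      field_simp
    · show 1 ≤ rhoPrime d ℓ (ρ⁻¹ • y)
      rw [rhoPrime_smul (inv_nonneg.2 hρ.le), hyx]
      exact le_of_eq (by field_simp)
  have h1 := h.hom _ (hKM he) ρ hρ
  rw [smul_smul, mul_inv_cancel₀ hρ.ne', one_smul] at h1
  have h2 := (hC _ he).trans (le_abs_self C)
  rw [Real.norm_eq_abs] at h2
  have h3 := Real.rpow_nonneg hρ.le r
  rw [hxy, h1, abs_mul, abs_of_nonneg h3, mul_comm]
  exact mul_le_mul_of_nonneg_right h2 h3

theorem HomF.ksym {ℓ : ℕ} {r : ℝ} {f : Ed d → ℝ} (h : HomF ℓ r f) (hr : r ≤ 0) :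
    KSym (ModelDomain d ℓ) (rhoModel d ℓ) r f := by
  refine KSym.of_closed (fun r f => r ≤ 0 ∧ HomF ℓ r f) ?_ ?_ ⟨hr, h⟩ h.sm
  · rintro r f ⟨hr, hf⟩
    obtain ⟨C, hC, hb⟩ := hf.bound
    refine ⟨C, hC, fun x hx => (hb x hx).trans ?_⟩
    exact mul_le_mul_of_nonneg_left (Real.rpow_le_rpow_of_nonpos (rhoModel_pos hx)
      (min_le_right _ _) hr) hC
  · rintro r f ⟨hr, hf⟩ i
    exact ⟨by linarith, hf.pd i⟩

theorem rhoPrime_smooth (ℓ : ℕ) : ContDiffOn ℝ ∞ (rhoPrime d ℓ) (ModelDomain d ℓ) := by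
  intro x hx
  have h1 : ContDiffAt ℝ ∞ (fun x : Ed d =>
      ∑ i ∈ Finset.univ.filter (fun i : Fin d => (i : ℕ) < d - ℓ), (x i) ^ 2) x :=
    ContDiffAt.sum fun i _ => ((contDiff_coord i).contDiffAt).pow 2
  have h2 := rhoPrime_pos.2 hx
  rw [rhoPrime, Real.sqrt_pos] at h2
  exact (h1.sqrt h2.ne').contDiffWithinAt

theorem rhoPrime_hom (ℓ : ℕ) : HomF ℓ 1 (rhoPrime d ℓ) := by
  refine ⟨rhoPrime_smooth ℓ, fun x _ y hy => ?_, fun x _ t ht => ?_⟩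
  · unfold rhoPrime
    congr 1
    refine Finset.sum_congr rfl fun j hj => ?_
    have := hy j (Finset.mem_filter.1 hj).2
    simp [this]
  · rw [rhoPrime_smul ht.le, Real.rpow_one]

theorem quot_hom {η : ℝ → ℝ} (hη : ContDiff ℝ ∞ η) (k : Fin d) :
    HomF 0 0 (fun x : Ed d => η (x k / ‖x‖)) := by
  refine ⟨?_, fun x _ y hy => ?_, fun x hx t ht => ?_⟩
  · intro x hx
    have hx0 : x ≠ 0 := modelDomain_zero.1 hx
    have h1 : ContDiffAt ℝ ∞ (fun x : Ed d => x k / ‖x‖) x :=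
      (contDiff_coord k).contDiffAt.div (contDiffAt_norm ℝ hx0) (norm_ne_zero_iff.2 hx0)
    exact (hη.contDiffAt.comp x h1).contDiffWithinAt
  · have : y = 0 := by
      ext j; exact hy j (by have := j.2; omega)
    rw [this, add_zero]
  · simp only [norm_smul, Real.norm_of_nonneg ht.le, PiLp.smul_apply, smul_eq_mul, Real.rpow_zero,
      one_mul]
    rw [mul_div_mul_left _ _ ht.ne']

/-- shear along the `k`-th axis -/
def shear (k : Fin d) (c : ℝ) (x : Ed d) : Ed d :=
  x + EuclideanSpace.single k (c * rhoPrime d 1 x)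

theorem shear_apply (k : Fin d) (c : ℝ) (x : Ed d) (j : Fin d) :
    shear k c x j = x j + (if j = k then c else 0) * rhoPrime d 1 x := by
  by_cases h : j = k <;> simp [shear, h]

theorem rhoPrime_shear {k : Fin d} (hk : (k : ℕ) = d - 1) (c : ℝ) (x : Ed d) :
    rhoPrime d 1 (shear k c x) = rhoPrime d 1 x := by
  unfold rhoPrime
  congr 1
  refine Finset.sum_congr rfl fun j hj => ?_
  have h1 := (Finset.mem_filter.1 hj).2
  have : j ≠ k := fun h => by rw [h, hk] at h1; omega
  rw [shear_apply, if_neg this]; simp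

theorem shear_shear {k : Fin d} (hk : (k : ℕ) = d - 1) (c : ℝ) (x : Ed d) :
    shear k c (shear k (-c) x) = x := by
  ext j
  rw [shear_apply, rhoPrime_shear hk, shear_apply]
  by_cases h : j = k <;> simp [h]

theorem shear_smooth (k : Fin d) (c : ℝ) : ContDiffOn ℝ ∞ (shear k c) (ModelDomain d 1) := by
  rw [contDiffOn_euclidean]
  intro j
  simp only [shear_apply]
  exact ((contDiff_coord j).contDiffOn).add (contDiffOn_const.mul (rhoPrime_smooth 1))

theorem shear_sym (k : Fin d) (c : ℝ) (i j : Fin d) :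
    KSym (ModelDomain d 1) (rhoModel d 1) 0 (pderivI d i fun x => shear k c x j) := by
  have ho := modelDomain_open (d := d) 1
  have h1 : KSym (ModelDomain d 1) (rhoModel d 1) 0 (pderivI d i (rhoPrime d 1)) := by
    have := (rhoPrime_hom (d := d) 1).pd i
    rw [sub_self] at this
    exact this.ksym le_rfl
  have h2 : KSym (ModelDomain d 1) (rhoModel d 1) 0 (pderivI d i fun x => x j) := by
    refine (KSym.const (if j = i then 1 else 0)).congr ho fun x _ => ?_
    have := pderivI_fun_coord (f := fun t => t) (i := j) (j := i) (x := x) differentiableAt_id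
    simpa using this
  refine (h2.add (h1.const_mul ho (if j = k then c else 0)) ho).congr ho fun x hx => ?_
  simp only [shear_apply, pderivI]
  rw [fderiv_fun_add ((contDiff_coord j).differentiable (by simp) x)
    ((diffAt ho (rhoPrime_smooth 1) hx).const_mul _),
    fderiv_const_mul (diffAt ho (rhoPrime_smooth 1) hx)]
  by_cases h : j = k <;> simp [h]

theorem shear_dif {k : Fin d} (hk : (k : ℕ) = d - 1) (c : ℝ) {Q Q' : Set (Ed d)} (hQ : IsOpen Q)
    (hQ' : IsOpen Q') (hs : Q ⊆ ModelDomain d 1) (hs' : Q' ⊆ ModelDomain d 1)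
    (hm : MapsTo (shear k (-c)) Q Q') (hm' : MapsTo (shear k c) Q' Q) :
    Dif Q (rhoModel d 1) Q' (rhoModel d 1) (shear k (-c)) (shear k c) where
  g := GoodW.model hQ hs
  g' := GoodW.model hQ' hs'
  maps := hm
  maps' := hm'
  inv x _ := shear_shear hk c x
  inv' x _ := by
    have := shear_shear hk (-c) x
    rwa [neg_neg] at this
  sm := (shear_smooth k _).mono hs
  sm' := (shear_smooth k _).mono hs'
  sy i j := (shear_sym k _ i j).mono hs
  sy' i j := (shear_sym k _ i j).mono hs'
  wt := ⟨1, le_rfl, fun x _ => by simp [rhoModel_eq, rhoPrime_shear hk]⟩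

theorem shear_orth {k : Fin d} (hk : (k : ℕ) = d - 1) (c : ℝ) {J : Finset (Fin d)} (hJ : k ∉ J) :
    MapsTo (shear k c) (Orth J 1) (Orth J 1) := by
  intro x hx
  refine ⟨fun j hj => ?_, ?_⟩
  · rw [shear_apply, if_neg (fun h : j = k => hJ (h ▸ hj))]
    simpa using hx.1 j hj
  · rw [← rhoPrime_pos, rhoPrime_shear hk]
    exact rhoPrime_pos.2 hx.2

theorem HasExt.cone {k : Fin d} (hk : (k : ℕ) = d - 1) (c : ℝ) {J : Finset (Fin d)} (hJ : k ∉ J) :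
    HasExt (Orth J 1 ∩ {x | c * rhoPrime d 1 x < x k}) (rhoModel d 1) (Orth J 1) (rhoModel d 1) := by
  refine HasExt.conj (V := upS (Orth J 1) k) (V' := Orth J 1) (Φ := shear k (-c)) (Ψ := shear k c)
    (shear_dif hk c ?_ (upS_open (Orth_open J 1) k) ?_ ?_ ?_ ?_)
    (shear_dif hk c (Orth_open J 1) (Orth_open J 1) inter_subset_right inter_subset_right
      (shear_orth hk _ hJ) (shear_orth hk _ hJ)) (HasExt.flat (Orth_refl hJ))
  · exact (Orth_open J 1).inter (isOpen_lt (continuous_const.mul (rhoPrime_cont 1)) (cont_coord k))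
  · exact inter_subset_left.trans inter_subset_right
  · exact inter_subset_left.trans inter_subset_right
  · intro x hx
    refine ⟨shear_orth hk _ hJ hx.1, ?_⟩
    have h2 : c * rhoPrime d 1 x < x k := hx.2
    show 0 < shear k (-c) x k
    rw [shear_apply, if_pos rfl]; linarith
  · intro x hx
    refine ⟨shear_orth hk _ hJ hx.1, ?_⟩
    have h2 : 0 < x k := hx.2
    show c * rhoPrime d 1 (shear k c x) < shear k c x k
    rw [rhoPrime_shear hk, shear_apply, if_pos rfl]; linarith

end Homog


/-! ### Extension across a lid transversal to dilations -/

section Lid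
variable {d : ℕ}

theorem Dif.mono {Q Q1 R R1 : Set (Ed d)} {w W : Ed d → ℝ} {Φ Ψ : Ed d → Ed d}
    (h : Dif Q w R W Φ Ψ) (ho : IsOpen Q1) (ho' : IsOpen R1) (hs : Q1 ⊆ Q) (hs' : R1 ⊆ R)
    (hm : MapsTo Φ Q1 R1) (hm' : MapsTo Ψ R1 Q1) : Dif Q1 w R1 W Φ Ψ where
  g := h.g.mono ho hs
  g' := h.g'.mono ho' hs'
  maps := hm
  maps' := hm'
  inv x hx := h.inv x (hs hx)
  inv' x hx := h.inv' x (hs' hx)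
  sm := h.sm.mono hs
  sm' := h.sm'.mono hs'
  sy i j := (h.sy i j).mono hs
  sy' i j := (h.sy' i j).mono hs'
  wt := by
    obtain ⟨A, hA, hw⟩ := h.wt
    exact ⟨A, hA, fun x hx => hw x (hs hx)⟩

/-- normalise the `i`-th coordinate to one -/
def zc (i : Fin d) (z : Ed d) : Ed d := z + (1 - z i) • EuclideanSpace.single i 1

theorem zc_apply (i : Fin d) (z : Ed d) (j : Fin d) : zc i z j = if j = i then 1 else z j := by
  by_cases h : j = i
  · subst h; simp [zc]
  · simp [zc, h]

theorem zc_self (i : Fin d) (z : Ed d) : zc i z i = 1 := by rw [zc_apply, if_pos rfl]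

theorem zc_contDiff (i : Fin d) : ContDiff ℝ ∞ (zc i : Ed d → Ed d) :=
  contDiff_id.add ((contDiff_const.sub (contDiff_coord i)).smul contDiff_const)

theorem zc_Rl (i : Fin d) (lam : ℝ) (z : Ed d) : zc i (Rl i lam z) = zc i z := by
  ext j
  rw [zc_apply, zc_apply, Rl_apply]
  by_cases h : j = i <;> simp [h]

def lidPhi (i : Fin d) (g : Ed d → ℝ) (x : Ed d) : Ed d :=
  (x i)⁻¹ • x + (-Real.log (g x) - 1) • EuclideanSpace.single i 1

def lidPsi (i : Fin d) (g : Ed d → ℝ) (z : Ed d) : Ed d :=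
  (Real.exp (-z i) * (g (zc i z))⁻¹) • zc i z

structure LidD (i : Fin d) (ℓ : ℕ) (g : Ed d → ℝ) (U : Set (Ed d)) (R δ : ℝ) : Prop where
  gs : ContDiffOn ℝ ∞ g {x | 0 < x i}
  gp : ∀ x : Ed d, 0 < x i → 0 < g x
  gh : ∀ x : Ed d, 0 < x i → ∀ t : ℝ, 0 < t → g (t • x) = t * g x
  uo : IsOpen U
  ui : ∀ x ∈ U, 0 < x i
  um : U ⊆ ModelDomain d ℓ
  ub : ∀ x ∈ U, ‖x‖ ≤ R
  ud : ∀ x ∈ U, ∀ t : ℝ, 0 < t → t ≤ 1 → t • x ∈ U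
  hδ : 0 < δ
  hU : ∀ x ∈ U, Real.exp (-2) < g x → δ ≤ x i

variable {i : Fin d} {ℓ : ℕ} {g : Ed d → ℝ} {U : Set (Ed d)} {R δ : ℝ}

theorem half_open (i : Fin d) : IsOpen {x : Ed d | 0 < x i} := isOpen_lt continuous_const (cont_coord i)

theorem lidPhi_self {x : Ed d} (hx : 0 < x i) : lidPhi i g x i = -Real.log (g x) := by
  simp only [lidPhi, PiLp.add_apply, PiLp.smul_apply, smul_eq_mul, PiLp.single_apply]
  rw [inv_mul_cancel₀ hx.ne']; simp

theorem zc_lidPhi {x : Ed d} (hx : 0 < x i) : zc i (lidPhi i g x) = (x i)⁻¹ • x := by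
  ext j
  rw [zc_apply]
  by_cases h : j = i
  · subst h; simp [hx.ne']
  · simp [h, lidPhi]

namespace LidD

theorem log_smooth (h : LidD i ℓ g U R δ) : ContDiffOn ℝ ∞ (fun x => -Real.log (g x)) {x | 0 < x i} :=
  (h.gs.log fun x hx => (h.gp x hx).ne').neg

theorem phi_smooth (h : LidD i ℓ g U R δ) : ContDiffOn ℝ ∞ (lidPhi i g) {x | 0 < x i} := by
  unfold lidPhi
  have h1 : ContDiffOn ℝ ∞ (fun x : Ed d => (x i)⁻¹) {x | 0 < x i} :=
    (contDiff_coord i).contDiffOn.inv fun x hx => ne_of_gt hx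
  exact ContDiffOn.add (ContDiffOn.smul (g := fun x : Ed d => x) h1 contDiffOn_id)
    (ContDiffOn.smul (h.log_smooth.sub contDiffOn_const) contDiffOn_const)

theorem gz_smooth (h : LidD i ℓ g U R δ) : ContDiff ℝ ∞ (fun z => g (zc i z)) := by
  rw [← contDiffOn_univ]
  exact h.gs.comp (zc_contDiff i).contDiffOn fun z _ => by
    show 0 < zc i z i
    rw [zc_self]; exact one_pos

theorem gz_pos (h : LidD i ℓ g U R δ) (z : Ed d) : 0 < g (zc i z) :=
  h.gp _ (by rw [zc_self]; exact one_pos)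

theorem psi_smooth (h : LidD i ℓ g U R δ) : ContDiff ℝ ∞ (lidPsi i g) := by
  unfold lidPsi
  refine ContDiff.smul (ContDiff.mul ?_ (h.gz_smooth.inv fun z => (h.gz_pos z).ne')) (zc_contDiff i)
  exact (Real.contDiff_exp).comp (contDiff_coord i).neg

theorem psi_self (h : LidD i ℓ g U R δ) (z : Ed d) :
    lidPsi i g z i = Real.exp (-z i) * (g (zc i z))⁻¹ := by
  simp [lidPsi, zc_self]

theorem psi_pos (h : LidD i ℓ g U R δ) (z : Ed d) : 0 < lidPsi i g z i := by
  rw [h.psi_self]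
  exact mul_pos (Real.exp_pos _) (inv_pos.2 (h.gz_pos z))

theorem g_psi (h : LidD i ℓ g U R δ) (z : Ed d) : g (lidPsi i g z) = Real.exp (-z i) := by
  have h1 := h.gz_pos z
  rw [lidPsi, h.gh _ (by rw [zc_self]; exact one_pos) _
    (mul_pos (Real.exp_pos _) (inv_pos.2 h1))]
  field_simp

theorem psi_phi (h : LidD i ℓ g U R δ) {x : Ed d} (hx : 0 < x i) : lidPsi i g (lidPhi i g x) = x := by
  have h1 := h.gp x hx
  rw [lidPsi, lidPhi_self hx, zc_lidPhi hx, neg_neg, Real.exp_log h1,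
    h.gh x hx _ (inv_pos.2 hx), smul_smul]
  have : g x * ((x i)⁻¹ * g x)⁻¹ * (x i)⁻¹ = 1 := by field_simp
  rw [this, one_smul]

theorem phi_psi (h : LidD i ℓ g U R δ) (z : Ed d) : lidPhi i g (lidPsi i g z) = z := by
  have h1 := h.psi_pos z
  have h2 : (lidPsi i g z i)⁻¹ • lidPsi i g z = zc i z := by
    rw [h.psi_self]; rw [h.psi_self] at h1
    rw [lidPsi, smul_smul, inv_mul_cancel₀ h1.ne', one_smul]
  rw [lidPhi, h2, h.g_psi, Real.log_exp, neg_neg]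
  ext j
  by_cases hj : j = i
  · subst hj; simp [zc]
  · simp [zc, hj]

/-- the straightened set -/
def UU (i : Fin d) (g : Ed d → ℝ) (U : Set (Ed d)) : Set (Ed d) := {z | lidPsi i g z ∈ U}

theorem uu_open (h : LidD i ℓ g U R δ) : IsOpen (UU i g U) := h.uo.preimage h.psi_smooth.continuous

def WW (i : Fin d) (ℓ : ℕ) (z : Ed d) : ℝ := rhoModel d ℓ (zc i z)

theorem ww_good (h : LidD i ℓ g U R δ) : GoodW (UU i g U) (WW i ℓ) := by
  refine ⟨h.uu_open, ((rhoModel_cont ℓ).comp (zc_contDiff i).continuous).continuousOn, fun z hz => ?_⟩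
  refine rhoModel_pos (rhoPrime_pos.1 ?_)
  have h1 := rhoPrime_pos.2 (h.um hz)
  have h2 := h.psi_pos z
  rw [h.psi_self] at h2
  rw [lidPsi, rhoPrime_smul h2.le] at h1
  exact pos_of_mul_pos_right h1 h2.le

theorem refl (h : LidD i ℓ g U R δ) : ReflW (UU i g U) (WW i ℓ) i := by
  refine ⟨h.ww_good, fun z hz hzi lam hl => ?_, fun z hz hzi lam hl => ?_⟩
  · show lidPsi i g (Rl i lam z) ∈ U
    have h1 : lidPsi i g (Rl i lam z) = Real.exp (z i + lam * z i) • lidPsi i g z := by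
      rw [lidPsi, lidPsi, zc_Rl, smul_smul, ← mul_assoc, ← Real.exp_add]
      congr 3
      rw [Rl_apply, if_pos rfl]; ring
    rw [h1]
    refine h.ud _ hz _ (Real.exp_pos _) (Real.exp_le_one_iff.2 ?_)
    nlinarith
  · have h1 := one_le_max_inv hl
    have h2 := h.ww_good.pos z hz
    have h3 : WW i ℓ (Rl i lam z) = WW i ℓ z := by rw [WW, WW, zc_Rl]
    rw [h3]
    constructor <;> nlinarith

def V1 (g : Ed d → ℝ) (U : Set (Ed d)) : Set (Ed d) := U ∩ {x | Real.exp (-2) < g x}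

def V2 (i : Fin d) (g : Ed d → ℝ) (U : Set (Ed d)) : Set (Ed d) := UU i g U ∩ {z | z i < 2}

theorem level_open (h : LidD i ℓ g U R δ) {s : Set ℝ} (hs : IsOpen s) : IsOpen (U ∩ {x | g x ∈ s}) :=
  (h.gs.continuousOn.mono fun x hx => h.ui x hx).isOpen_inter_preimage h.uo hs

theorem v1_open (h : LidD i ℓ g U R δ) : IsOpen (V1 g U) := h.level_open isOpen_Ioi

theorem v2_open (h : LidD i ℓ g U R δ) : IsOpen (V2 i g U) :=
  h.uu_open.inter (isOpen_lt (cont_coord i) continuous_const)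

def K0 (i : Fin d) (R δ : ℝ) : Set (Ed d) := closedBall 0 R ∩ {x | δ ≤ x i}

theorem k0_compact : IsCompact (K0 i R δ) :=
  (isCompact_closedBall _ _).inter_right (isClosed_le continuous_const (cont_coord i))

theorem k0_sub (h : LidD i ℓ g U R δ) : K0 i R δ ⊆ {x | 0 < x i} := fun _ hx => h.hδ.trans_le hx.2

theorem v1_sub (h : LidD i ℓ g U R δ) : V1 g U ⊆ K0 i R δ := fun x hx =>
  ⟨by rw [mem_closedBall_zero_iff]; exact h.ub x hx.1, h.hU x hx.1 hx.2⟩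

theorem maps (h : LidD i ℓ g U R δ) : MapsTo (lidPhi i g) (V1 g U) (V2 i g U) := by
  intro x hx
  have h0 := h.ui x hx.1
  refine ⟨?_, ?_⟩
  · show lidPsi i g (lidPhi i g x) ∈ U
    rw [h.psi_phi h0]; exact hx.1
  · show lidPhi i g x i < 2
    rw [lidPhi_self h0]
    have := (Real.lt_log_iff_exp_lt (h.gp x h0)).2 hx.2
    linarith

theorem maps' (h : LidD i ℓ g U R δ) : MapsTo (lidPsi i g) (V2 i g U) (V1 g U) := by
  intro z hz
  refine ⟨hz.1, ?_⟩
  show Real.exp (-2) < g (lidPsi i g z)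
  rw [h.g_psi]
  have : z i < 2 := hz.2
  exact Real.exp_lt_exp.2 (by linarith)

theorem v2_sub (h : LidD i ℓ g U R δ) : V2 i g U ⊆ lidPhi i g '' K0 i R δ := fun z hz =>
  ⟨_, h.v1_sub (h.maps' hz), h.phi_psi z⟩

theorem k1_compact (h : LidD i ℓ g U R δ) : IsCompact (lidPhi i g '' K0 i R δ) :=
  k0_compact.image_of_continuousOn (h.phi_smooth.continuousOn.mono h.k0_sub)

theorem dif (h : LidD i ℓ g U R δ) :
    Dif (V1 g U) (rhoModel d ℓ) (V2 i g U) (WW i ℓ) (lidPhi i g) (lidPsi i g) where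
  g := GoodW.model h.v1_open (inter_subset_left.trans h.um)
  g' := h.ww_good.mono h.v2_open inter_subset_left
  maps := h.maps
  maps' := h.maps'
  inv x hx := h.psi_phi (h.ui x hx.1)
  inv' z _ := h.phi_psi z
  sm := h.phi_smooth.mono (h.v1_sub.trans h.k0_sub)
  sm' := h.psi_smooth.contDiffOn
  sy a b := KSym.of_compact (half_open i)
    (pderivI_contDiffOn (half_open i) (contDiffOn_euclidean.1 h.phi_smooth b) a) k0_compact h.k0_sub
    h.v1_sub fun x hx => ⟨rhoModel_pos (h.um hx.1), rhoModel_le_one _ _⟩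
  sy' a b := KSym.of_compact isOpen_univ
    (pderivI_contDiffOn isOpen_univ (contDiffOn_euclidean.1 h.psi_smooth.contDiffOn b) a)
    h.k1_compact (subset_univ _)
    h.v2_sub fun x hx => ⟨h.ww_good.pos x hx.1, rhoModel_le_one _ _⟩
  wt := by
    refine ⟨max 1 (max R δ⁻¹), le_max_left _ _, fun x hx => ?_⟩
    have h0 := h.ui x hx.1
    have h1 : x i ≤ R := by
      refine le_trans ?_ (h.ub x hx.1)
      exact (le_abs_self _).trans (by simpa using PiLp.norm_apply_le x i)
    have h2 := h.hU x hx.1 hx.2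
    have h3 : (x i)⁻¹ ≤ δ⁻¹ := inv_anti₀ h.hδ h2
    have h4 := rhoPrime_nonneg ℓ x
    have e : rhoPrime d ℓ ((x i)⁻¹ • x) = (x i)⁻¹ * rhoPrime d ℓ x := rhoPrime_smul (inv_nonneg.2 h0.le)
    have h5 : x i ≤ max 1 (max R δ⁻¹) := h1.trans ((le_max_left _ _).trans (le_max_right _ _))
    have h6 : (x i)⁻¹ ≤ max 1 (max R δ⁻¹) := h3.trans ((le_max_right _ _).trans (le_max_right _ _))
    rw [WW, zc_lidPhi h0, rhoModel_eq, rhoModel_eq, e]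
    constructor
    · refine min_one_le_mul (le_max_left _ _) ?_ (by positivity)
      calc rhoPrime d ℓ x = x i * ((x i)⁻¹ * rhoPrime d ℓ x) := by field_simp
        _ ≤ _ := mul_le_mul_of_nonneg_right h5 (by positivity)
    · exact min_one_le_mul (le_max_left _ _) (mul_le_mul_of_nonneg_right h6 h4) h4

theorem ksym_log (h : LidD i ℓ g U R δ) {f : ℝ → ℝ} (hf : ContDiff ℝ ∞ f) {b c : ℝ} (hc : c < 2)
    (hfc : ∀ t, c ≤ t → f t = b) :
    KSym U (rhoModel d ℓ) 0 (fun x => f (-Real.log (g x))) := by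
  have hpos : ∀ x ∈ U, 0 < rhoModel d ℓ x ∧ rhoModel d ℓ x ≤ 1 :=
    fun x hx => ⟨rhoModel_pos (h.um hx), rhoModel_le_one _ _⟩
  have h1 : KSym (V1 g U) (rhoModel d ℓ) 0 (fun x => f (-Real.log (g x))) :=
    KSym.of_compact (half_open i) (hf.comp_contDiffOn h.log_smooth) k0_compact h.k0_sub h.v1_sub
      fun x hx => hpos x hx.1
  have ho2 : IsOpen (U ∩ {x | g x ∈ Iio (Real.exp (-c))}) := h.level_open isOpen_Iio
  have h2 : KSym (U ∩ {x | g x ∈ Iio (Real.exp (-c))}) (rhoModel d ℓ) 0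
      (fun x => f (-Real.log (g x))) := by
    refine (KSym.const b).congr ho2 fun x hx => ?_
    refine hfc _ ?_
    have := (Real.log_lt_iff_lt_exp (h.gp x (h.ui x hx.1))).2 hx.2
    linarith
  have h3 := h1.union h2 h.v1_open ho2 (fun x hx => (hpos x (hx.elim (·.1) (·.1))).1)
  refine h3.mono fun x hx => ?_
  by_cases hg : Real.exp (-2) < g x
  · exact Or.inl ⟨hx, hg⟩
  · refine Or.inr ⟨hx, ?_⟩
    exact (not_lt.1 hg).trans_lt (Real.exp_lt_exp.2 (by linarith))

theorem supp_log (h : LidD i ℓ g U R δ) {f : ℝ → ℝ} {s : Set ℝ} (hs : IsOpen s)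
    (hfs : ∀ t ∈ s, f t = 0) {x : Ed d} (hx : x ∈ U) (hx' : -Real.log (g x) ∈ s) :
    x ∉ tsupport (fun x => f (-Real.log (g x))) := by
  rw [notMem_tsupport_iff_eventuallyEq]
  have hc : ContinuousAt (fun x => -Real.log (g x)) x :=
    h.log_smooth.continuousOn.continuousAt ((half_open i).mem_nhds (h.ui x hx))
  filter_upwards [hc.preimage_mem_nhds (hs.mem_nhds hx')] with y hy
  exact hfs _ hy

def chi (a t : ℝ) : ℝ := Real.smoothTransition (a - 2 * t)

theorem chi_smooth (a : ℝ) : ContDiff ℝ ∞ (chi a) :=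
  Real.smoothTransition.contDiff.comp (contDiff_const.sub (contDiff_const.mul contDiff_id))

def cochi (t : ℝ) : ℝ := 1 - chi 2 t

theorem chi_one {a t : ℝ} (h : 1 ≤ a - 2 * t) : chi a t = 1 := Real.smoothTransition.one_of_one_le h

theorem chi_zero {a t : ℝ} (h : a - 2 * t ≤ 0) : chi a t = 0 := Real.smoothTransition.zero_of_nonpos h

theorem hasExt (h : LidD i ℓ g U R δ) :
    HasExt (U ∩ {x | g x < 1}) (rhoModel d ℓ) U (rhoModel d ℓ) := by
  have hΩo : IsOpen (U ∩ {x | g x < 1}) := h.level_open isOpen_Iio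
  have gU : GoodW U (rhoModel d ℓ) := GoodW.model h.uo h.um
  have gΩ : GoodW (U ∩ {x | g x < 1}) (rhoModel d ℓ) := gU.mono hΩo inter_subset_left
  have hVo : IsOpen ((U ∩ {x | g x < 1}) ∩ V1 g U) := hΩo.inter h.v1_open
  have gV : GoodW ((U ∩ {x | g x < 1}) ∩ V1 g U) (rhoModel d ℓ) := gΩ.mono hVo inter_subset_left
  have hV2o := upS_open h.v2_open i
  have hUUo := upS_open h.uu_open i
  have gUU : GoodW (upS (UU i g U) i) (WW i ℓ) := h.ww_good.mono hUUo inter_subset_left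
  have dV : Dif ((U ∩ {x | g x < 1}) ∩ V1 g U) (rhoModel d ℓ) (upS (V2 i g U) i) (WW i ℓ)
      (lidPhi i g) (lidPsi i g) := by
    refine h.dif.mono hVo hV2o inter_subset_right inter_subset_left ?_ ?_
    · intro x hx
      refine ⟨h.maps hx.2, ?_⟩
      have h0 := h.ui x hx.1.1
      show 0 < lidPhi i g x i
      rw [lidPhi_self h0]
      have := Real.log_neg (h.gp x h0) hx.1.2
      linarith
    · intro z hz
      have h1 := h.maps' hz.1
      refine ⟨⟨h1.1, ?_⟩, h1⟩
      show g (lidPsi i g z) < 1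
      rw [h.g_psi]
      have : 0 < z i := hz.2
      exact Real.exp_lt_one_iff.2 (by linarith)
  -- cut-off functions
  have k1 : KSym U (rhoModel d ℓ) 0 (fun x => cochi (-Real.log (g x))) :=
    h.ksym_log (contDiff_const.sub (chi_smooth 2)) (b := 1) (c := 1) (by norm_num) fun t ht => by
      rw [cochi, chi_zero (by linarith), sub_zero]
  have k3 : KSym U (rhoModel d ℓ) 0 (fun x => chi 3 (-Real.log (g x))) :=
    h.ksym_log (chi_smooth 3) (b := 0) (c := 3 / 2) (by norm_num) fun t ht => chi_zero (by linarith)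
  have s1 : U ∩ tsupport (fun x => cochi (-Real.log (g x))) ⊆ U ∩ {x | g x < 1} := by
    rintro x ⟨hx, hx'⟩
    refine ⟨hx, ?_⟩
    by_contra hg
    refine h.supp_log (s := Iio (1 / 2)) isOpen_Iio (fun t ht => ?_) hx ?_ hx'
    · have : t < 1 / 2 := ht
      rw [cochi, chi_one (by linarith), sub_self]
    · have := Real.log_nonneg (not_lt.1 hg)
      show -Real.log (g x) < 1 / 2
      linarith
  have s3 : U ∩ tsupport (fun x => chi 3 (-Real.log (g x))) ⊆ V1 g U := by
    rintro x ⟨hx, hx'⟩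
    refine ⟨hx, ?_⟩
    by_contra hg
    refine h.supp_log (s := Ioi (3 / 2)) isOpen_Ioi (fun t ht => ?_) hx ?_ hx'
    · have : 3 / 2 < t := ht
      exact chi_zero (by linarith)
    · have := (Real.log_le_iff_le_exp (h.gp x (h.ui x hx))).2 (not_lt.1 hg)
      show 3 / 2 < -Real.log (g x)
      linarith
  have k2 : KSym (upS (UU i g U) i) (WW i ℓ) 0 (fun z => chi 2 (z i)) := by
    have hsm : ContDiff ℝ ∞ (fun z : Ed d => chi 2 (z i)) := (chi_smooth 2).comp (contDiff_coord i)
    have q1 : KSym (V2 i g U) (WW i ℓ) 0 (fun z => chi 2 (z i)) :=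
      KSym.of_compact isOpen_univ hsm.contDiffOn h.k1_compact (subset_univ _) h.v2_sub
        fun x hx => ⟨h.ww_good.pos x hx.1, rhoModel_le_one _ _⟩
    have ho2 : IsOpen (UU i g U ∩ {z | 1 < z i}) :=
      h.uu_open.inter (isOpen_lt continuous_const (cont_coord i))
    have q2 : KSym (UU i g U ∩ {z | 1 < z i}) (WW i ℓ) 0 (fun z => chi 2 (z i)) := by
      refine (KSym.const 0).congr ho2 fun z hz => chi_zero ?_
      have : 1 < z i := hz.2
      linarith
    refine (q1.union q2 h.v2_open ho2 fun x hx => h.ww_good.pos x (hx.elim (·.1) (·.1))).mono ?_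
    intro z hz
    by_cases h2 : z i < 2
    · exact Or.inl ⟨hz.1, h2⟩
    · exact Or.inr ⟨hz.1, show 1 < z i by linarith⟩
  have s2 : upS (UU i g U) i ∩ tsupport (fun z : Ed d => chi 2 (z i)) ⊆ upS (V2 i g U) i := by
    rintro z ⟨hz, hz'⟩
    refine ⟨⟨hz.1, ?_⟩, hz.2⟩
    by_contra hg
    refine absurd hz' ?_
    rw [notMem_tsupport_iff_eventuallyEq]
    have hg' : 1 < z i := by
      have : ¬ z i < 2 := hg
      linarith
    filter_upwards [(isOpen_lt continuous_const (cont_coord i)).mem_nhds hg'] with y hy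
    have hy' : 1 < y i := hy
    exact chi_zero (by linarith)
  obtain ⟨S, hS, hS'⟩ := HasExt.flat h.refl
  have b1 : Bdd (U ∩ {x | g x < 1}) (rhoModel d ℓ) U (rhoModel d ℓ) _ :=
    Bdd.cut gΩ gU k1 s1 1 le_rfl fun x _ => by simp
  have b2 := Bdd.cut (w := rhoModel d ℓ) (w' := rhoModel d ℓ) h.dif.g gU k3 s3 1 le_rfl fun x _ => by simp
  have b3 := Bdd.restr (w := WW i ℓ) (w' := WW i ℓ) h.ww_good h.dif.g' inter_subset_left 1 le_rfl
    fun x _ => by simp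
  have b4 := Bdd.cut (w := WW i ℓ) (w' := WW i ℓ) dV.g' gUU k2 s2 1 le_rfl fun x _ => by simp
  have b5 := Bdd.restr (w := rhoModel d ℓ) (w' := rhoModel d ℓ) gΩ gV inter_subset_left 1 le_rfl
    fun x _ => by simp
  refine ⟨_, Bdd.add gU b1 (b2.comp (h.dif.bdd.comp (b3.comp (hS.comp (b4.comp
    (dV.symm.bdd.comp b5)))))), ?_⟩
  intro u x hx
  have h0 := h.ui x hx.1
  rw [LinearMap.add_apply, Pi.add_apply, cutL_of_mem hx, LinearMap.comp_apply]
  by_cases hxV : x ∈ V1 g U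
  · rw [cutL_of_mem hxV]
    have hm := dV.maps ⟨hx, hxV⟩
    have hmU : lidPhi i g x ∈ upS (UU i g U) i := ⟨hm.1.1, hm.2⟩
    have e : (pullL (lidPhi i g) ∘ₗ LinearMap.id ∘ₗ S ∘ₗ cutL (upS (V2 i g U) i)
        (fun z : Ed d => chi 2 (z i)) ∘ₗ pullL (lidPsi i g) ∘ₗ LinearMap.id) u x
        = chi 2 (-Real.log (g x)) * u x := by
      change S (cutL (upS (V2 i g U) i) (fun z : Ed d => chi 2 (z i)) (pullL (lidPsi i g) u))
        (lidPhi i g x) = _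
      rw [hS' _ _ hmU, cutL_of_mem hm, lidPhi_self h0]
      change _ * u (lidPsi i g (lidPhi i g x)) = _
      rw [h.psi_phi h0]
    rw [e]
    have : chi 3 (-Real.log (g x)) * chi 2 (-Real.log (g x)) = chi 2 (-Real.log (g x)) := by
      rcases le_total (-Real.log (g x)) 1 with ht | ht
      · rw [chi_one (a := 3) (by linarith), one_mul]
      · rw [chi_zero (a := 2) (by linarith), mul_zero]
    rw [← mul_assoc, this, cochi]; ring
  · rw [cutL_of_notMem hxV]
    have : Real.log (g x) ≤ -2 := by
      rw [Real.log_le_iff_le_exp (h.gp x h0)]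
      by_contra hg
      exact hxV ⟨hx.1, not_le.1 hg⟩
    rw [cochi, chi_zero (by linarith)]; ring

end LidD
end Lid


/-! ### Assembly -/

section Asm
variable {d : ℕ}

theorem HasExt.final {Ω : Set (Ed d)} {w : Ed d → ℝ} {ℓ : ℕ} (hΩ : GoodW Ω w)
    (h : HasExt Ω w (ModelDomain d ℓ) (rhoModel d ℓ)) :
    ∃ E : (Ed d → ℝ) → Ed d → ℝ, IsLinearOp d E ∧
      (∀ u : Ed d → ℝ, LocallyIntegrableOn u Ω volume → E u =ᵐ[volume.restrict Ω] u) ∧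
      ∀ (m : ℕ) (a p : ℝ), 1 ≤ m → 1 ≤ p →
        ∃ C : ℝ, 0 < C ∧ ∀ u : Ed d → ℝ,
          MemK d Ω w m a p u →
            MemKM d ℓ m a p (E u) ∧
              KnormM d ℓ m a p (E u) ≤ C * Knorm d Ω w m a p u := by
  obtain ⟨T, hT, hT'⟩ := h
  refine ⟨T, ⟨fun u v => map_add T u v, fun c u => map_smul T c u⟩, fun u _ => ?_, fun m a p _ hp =>
    Bdd.transfer hΩ (GoodW.model (modelDomain_open ℓ) subset_rfl) hT m a p hp⟩
  filter_upwards [ae_restrict_mem hΩ.op.measurableSet] with x hx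
  exact hT' u x hx

theorem HasExt.bumpCut {Ω U A : Set (Ed d)} {w : Ed d → ℝ} {ℓ : ℕ}
    (h : HasExt Ω w U (rhoModel d ℓ)) (hU : IsOpen U) (hA : IsOpen A) (hAM : A ⊆ ModelDomain d ℓ)
    (hUA : U ⊆ A) (hs : Ω ⊆ U) {r : ℝ} (hr : 0 < r) (hΩ : ∀ x ∈ Ω, ‖x‖ ≤ r)
    (hAU : ∀ x ∈ A, ‖x‖ ≤ 2 * r → x ∈ U) : HasExt Ω w A (rhoModel d ℓ) := by
  let χ : ContDiffBump (0 : Ed d) := ⟨r, 2 * r, hr, by linarith⟩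
  have hpos : ∀ x ∈ A, 0 < rhoModel d ℓ x ∧ rhoModel d ℓ x ≤ 1 :=
    fun x hx => ⟨rhoModel_pos (hAM hx), rhoModel_le_one _ _⟩
  have o1 : IsOpen (A ∩ {x | ‖x‖ < 3 * r}) := hA.inter (isOpen_lt continuous_norm continuous_const)
  have o2 : IsOpen (A ∩ {x | 2 * r < ‖x‖}) := hA.inter (isOpen_lt continuous_const continuous_norm)
  have q1 : KSym (A ∩ {x | ‖x‖ < 3 * r}) (rhoModel d ℓ) 0 χ :=
    KSym.of_compact isOpen_univ χ.contDiff.contDiffOn (isCompact_closedBall (0 : Ed d) (3 * r))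
      (subset_univ _) (fun x hx => by rw [mem_closedBall_zero_iff]; exact (le_of_lt hx.2))
      fun x hx => hpos x hx.1
  have q2 : KSym (A ∩ {x | 2 * r < ‖x‖}) (rhoModel d ℓ) 0 χ := by
    refine (KSym.const 0).congr o2 fun x hx => ?_
    refine χ.zero_of_le_dist ?_
    rw [dist_zero_right]
    exact le_of_lt hx.2
  refine h.cut (GoodW.model hU (hUA.trans hAM)) (GoodW.model hA hAM) hs (χ := χ)
    ((q1.union q2 o1 o2 fun x hx => (hpos x (hx.elim (·.1) (·.1))).1).mono fun x hx => ?_) ?_ ?_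
  · rcases lt_or_ge ‖x‖ (3 * r) with h1 | h1
    · exact Or.inl ⟨hx, h1⟩
    · exact Or.inr ⟨hx, show 2 * r < ‖x‖ by linarith⟩
  · rintro x ⟨hx, hx'⟩
    rw [χ.tsupport_eq, mem_closedBall_zero_iff] at hx'
    exact hAU x hx hx'
  · intro x hx
    refine χ.one_of_mem_closedBall ?_
    rw [mem_closedBall_zero_iff]
    exact hΩ x hx

theorem norm_le_of_box {x : Ed d} {B : ℝ} (hB : 0 ≤ B) (h : ∀ j, |x j| ≤ B) : ‖x‖ ≤ d * B := by
  rw [EuclideanSpace.norm_eq]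
  refine Real.sqrt_le_iff.2 ⟨by positivity, ?_⟩
  calc ∑ j, ‖x j‖ ^ 2 ≤ ∑ _j : Fin d, B ^ 2 := by
        refine Finset.sum_le_sum fun j _ => ?_
        rw [Real.norm_eq_abs]
        have := h j
        gcongr
    _ = d * B ^ 2 := by simp
    _ ≤ (d * B) ^ 2 := by
        rcases Nat.eq_zero_or_pos d with h0 | h0
        · simp [h0]
        · have : (1 : ℝ) ≤ d := by exact_mod_cast h0
          have h2 : 0 ≤ B ^ 2 := sq_nonneg B
          have h3 : (d : ℝ) ≤ d ^ 2 := by nlinarith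
          rw [mul_pow]
          exact mul_le_mul_of_nonneg_right h3 h2

theorem abs_coord_le (x : Ed d) (j : Fin d) : |x j| ≤ ‖x‖ := by
  simpa using PiLp.norm_apply_le x j

theorem HasExt.cube {A : Set (Ed d)} {ℓ : ℕ} (hd : 0 < d) (hA : IsOpen A) (hAM : A ⊆ ModelDomain d ℓ)
    (hpos : ∀ x ∈ A, ∀ j, 0 < x j) (hdil : ∀ x ∈ A, ∀ t : ℝ, 0 < t → t • x ∈ A) :
    HasExt (A ∩ {x | ∀ j, x j < 1}) (rhoModel d ℓ) A (rhoModel d ℓ) := by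
  classical
  set B : ℝ := 2 * d + 1 with hB
  have hd1 : (1 : ℝ) ≤ d := by exact_mod_cast hd
  let UJ : Finset (Fin d) → Set (Ed d) := fun J => A ∩ {x | ∀ j, x j < if j ∈ J then B else 1}
  have hUo : ∀ J, IsOpen (UJ J) := fun J => by
    refine hA.inter ?_
    have : {x : Ed d | ∀ j, x j < if j ∈ J then B else 1} = ⋂ j, {x | x j < if j ∈ J then B else 1} := by
      ext; simp
    rw [this]
    exact isOpen_iInter_of_finite fun j => isOpen_lt (cont_coord j) continuous_const
  have hle : ∀ (J : Finset (Fin d)) (j : Fin d), (if j ∈ J then B else 1) ≤ B := fun J j => by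
    split_ifs <;> linarith
  have hmono : ∀ J J' : Finset (Fin d), J ⊆ J' → UJ J ⊆ UJ J' := fun J J' hJ x hx => by
    refine ⟨hx.1, fun j => (hx.2 j).trans_le ?_⟩
    by_cases h1 : j ∈ J
    · rw [if_pos h1, if_pos (hJ h1)]
    · rw [if_neg h1]; split_ifs <;> linarith
  have step : ∀ J : Finset (Fin d), HasExt (UJ ∅) (rhoModel d ℓ) (UJ J) (rhoModel d ℓ) := by
    intro J
    induction J using Finset.induction_on with
    | empty => exact HasExt.rfl' (GoodW.model (hUo _) (inter_subset_left.trans hAM))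
    | insert i J hi ih =>
      refine ih.trans ?_ (hmono _ _ (Finset.empty_subset J))
      have L : LidD i ℓ (fun x => x i) (UJ (insert i J)) (d * B) (Real.exp (-2)) :=
        { gs := (contDiff_coord i).contDiffOn
          gp := fun x hx => hx
          gh := fun x _ t _ => by simp
          uo := hUo _
          ui := fun x hx => hpos x hx.1 i
          um := inter_subset_left.trans hAM
          ub := fun x hx => norm_le_of_box (by linarith) fun j => by
            rw [abs_of_pos (hpos x hx.1 j)]
            exact (hx.2 j).le.trans (hle _ j)
          ud := fun x hx t ht ht1 => by
            refine ⟨hdil x hx.1 t ht, fun j => ?_⟩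
            refine lt_of_le_of_lt ?_ (hx.2 j)
            have := hpos x hx.1 j
            simp only [PiLp.smul_apply, smul_eq_mul]
            nlinarith
          hδ := Real.exp_pos _
          hU := fun x _ h => h.le }
      have e : UJ (insert i J) ∩ {x | x i < 1} = UJ J := by
        ext x
        constructor
        · rintro ⟨⟨h1, h2⟩, h3⟩
          refine ⟨h1, fun j => ?_⟩
          by_cases hj : j = i
          · subst hj; rw [if_neg hi]; exact h3
          · have := h2 j
            simpa [Finset.mem_insert, hj] using this
        · intro hx
          refine ⟨hmono _ _ (Finset.subset_insert i J) hx, ?_⟩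
          have := hx.2 i
          rwa [if_neg hi] at this
      have := L.hasExt
      rwa [e] at this
  have e0 : UJ ∅ = A ∩ {x | ∀ j, x j < 1} := by simp [UJ]
  have := step Finset.univ
  have hsub := hmono ∅ Finset.univ (Finset.empty_subset _)
  rw [e0] at this hsub
  refine this.bumpCut (hUo _) hA hAM inter_subset_left hsub (r := d) (by linarith) ?_ ?_
  · intro x hx
    have := norm_le_of_box (x := x) (B := 1) zero_le_one fun j => by
      rw [abs_of_pos (hpos x hx.1 j)]; exact (hx.2 j).le
    linarith
  · intro x hx hx'
    refine ⟨hx, fun j => ?_⟩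
    rw [if_pos (Finset.mem_univ j)]
    have := (le_abs_self _).trans (abs_coord_le x j)
    linarith

theorem normsq_split {k : Fin d} (hk : (k : ℕ) = d - 1) (x : Ed d) :
    ‖x‖ ^ 2 = rhoPrime d 1 x ^ 2 + x k ^ 2 := by
  rw [EuclideanSpace.norm_eq, rhoPrime, Real.sq_sqrt (Finset.sum_nonneg fun _ _ => sq_nonneg _),
    Real.sq_sqrt (Finset.sum_nonneg fun _ _ => sq_nonneg _)]
  simp only [Real.norm_eq_abs, sq_abs]
  have h := Finset.sum_filter_add_sum_filter_not Finset.univ (fun i : Fin d => (i : ℕ) < d - 1)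
    (fun i => x i ^ 2)
  rw [← h]
  congr 1
  have : (Finset.univ.filter fun i : Fin d => ¬ (i : ℕ) < d - 1) = {k} := by
    ext i
    simp only [Finset.mem_filter, Finset.mem_univ, true_and, Finset.mem_singleton, Fin.ext_iff]
    have := i.2
    omega
  rw [this, Finset.sum_singleton]

theorem rhoAxis_eq {k : Fin d} (hk : (k : ℕ) = d - 1) : rhoAxis d k = rhoPrime d 1 := by
  funext x
  rw [rhoAxis, rhoPrime]
  congr 2
  ext i
  simp only [Finset.mem_filter, Finset.mem_univ, true_and, ne_eq, Fin.ext_iff]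
  have := i.2
  omega

theorem cone_iff {k : Fin d} (hk : (k : ℕ) = d - 1) {κ : ℝ} (h0 : 0 < κ) (h1 : κ < 1) (x : Ed d) :
    ‖x‖ * κ < x k ↔ (κ / Real.sqrt (1 - κ ^ 2)) * rhoPrime d 1 x < x k := by
  have hp : 0 < 1 - κ ^ 2 := by nlinarith
  set s := Real.sqrt (1 - κ ^ 2) with hs
  have hs0 : 0 < s := Real.sqrt_pos.2 hp
  have hs2 : s ^ 2 = 1 - κ ^ 2 := Real.sq_sqrt hp.le
  have hn := normsq_split hk x
  have hr := rhoPrime_nonneg 1 x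
  have hx := norm_nonneg x
  set ρ := rhoPrime d 1 x
  rw [div_mul_eq_mul_div, div_lt_iff₀ hs0]
  constructor
  · intro h
    have hk0 : 0 < x k := lt_of_le_of_lt (by positivity) h
    refine lt_of_pow_lt_pow_left₀ 2 (by positivity) ?_
    have h2 : (‖x‖ * κ) ^ 2 < x k ^ 2 := by gcongr
    rw [mul_pow, mul_pow, hs2]
    rw [mul_pow, hn] at h2
    linarith
  · intro h
    have hk0 : 0 < x k := by
      have : 0 < x k * s := lt_of_le_of_lt (by positivity) h
      exact pos_of_mul_pos_left this hs0.le
    refine lt_of_pow_lt_pow_left₀ 2 hk0.le ?_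
    have h2 : (κ * ρ) ^ 2 < (x k * s) ^ 2 := by gcongr
    rw [mul_pow, mul_pow, hs2] at h2
    rw [mul_pow, hn]
    linarith

theorem HasExt.weightRestr {Ω : Set (Ed d)} {ℓ : ℕ} (ho : IsOpen Ω) (hs : Ω ⊆ ModelDomain d ℓ)
    {R : ℝ} (hR : 1 ≤ R) (hb : ∀ x ∈ Ω, ‖x‖ ≤ R) :
    GoodW Ω (rhoPrime d ℓ) ∧ HasExt Ω (rhoPrime d ℓ) Ω (rhoModel d ℓ) := by
  have g : GoodW Ω (rhoPrime d ℓ) :=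
    ⟨ho, (rhoPrime_cont ℓ).continuousOn, fun x hx => rhoPrime_pos.2 (hs hx)⟩
  refine ⟨g, HasExt.restr g (GoodW.model ho hs) R hR fun x hx => ?_⟩
  have h1 := (rhoPrime_le_norm ℓ x).trans (hb x hx)
  have h2 := rhoPrime_nonneg ℓ x
  rw [rhoModel_eq]
  constructor
  · rcases le_total 1 (rhoPrime d ℓ x) with h | h
    · rw [min_eq_left h]; linarith
    · rw [min_eq_right h]; nlinarith
  · exact (min_le_right _ _).trans (by nlinarith)

theorem quot_supp {f : ℝ → ℝ} {s : Set ℝ} (hs : IsOpen s) (k : Fin d)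
    (hfs : ∀ t ∈ s, f t = 0) {x : Ed d} (hx : x ∈ ModelDomain d 0) (hx' : x k / ‖x‖ ∈ s) :
    x ∉ tsupport (fun x : Ed d => f (x k / ‖x‖)) := by
  rw [notMem_tsupport_iff_eventuallyEq]
  have hc : ContinuousAt (fun x : Ed d => x k / ‖x‖) x :=
    (cont_coord k).continuousAt.div continuous_norm.continuousAt
      (norm_ne_zero_iff.2 (modelDomain_zero.1 hx))
  filter_upwards [hc.preimage_mem_nhds (hs.mem_nhds hx')] with y hy
  exact hfs _ hy

theorem model_sub (ℓ : ℕ) : ModelDomain d ℓ ⊆ ModelDomain d 0 := fun x hx => by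
  rw [← rhoPrime_pos, rhoPrime_zero]
  exact (rhoPrime_pos.2 hx).trans_le (rhoPrime_le_norm ℓ x)

theorem rho_le_zero (ℓ : ℕ) (x : Ed d) : rhoModel d ℓ x ≤ rhoModel d 0 x := by
  rw [rhoModel_eq, rhoModel_eq, rhoPrime_zero]
  exact min_le_min_left _ (rhoPrime_le_norm ℓ x)

theorem quot_rho {k : Fin d} (hk : (k : ℕ) = d - 1) {κ : ℝ} (h0 : 0 < κ) (h1 : κ < 1) {x : Ed d}
    (h : |x k| ≤ κ * ‖x‖) : ‖x‖ ≤ (Real.sqrt (1 - κ ^ 2))⁻¹ * rhoPrime d 1 x := by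
  have hp : 0 < 1 - κ ^ 2 := by nlinarith
  have hs0 : 0 < Real.sqrt (1 - κ ^ 2) := Real.sqrt_pos.2 hp
  have hs2 := Real.sq_sqrt hp.le
  have hn := normsq_split hk x
  rw [← div_eq_inv_mul, le_div_iff₀ hs0]
  refine le_of_sq_le_sq ?_ (rhoPrime_nonneg 1 x)
  have h2 : |x k| ^ 2 ≤ (κ * ‖x‖) ^ 2 := by gcongr
  rw [sq_abs, mul_pow] at h2
  rw [mul_pow, hs2]
  linarith

end Asm


/-! ### The three cases -/

section Cases
variable {d : ℕ}

theorem HasExt.coneZero {k : Fin d} (hk : (k : ℕ) = d - 1) {κ : ℝ} (h0 : 0 < κ) (h1 : κ < 1)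
    {C : Set (Ed d)} (hC : C = {x | 0 < ‖x‖ ∧ ‖x‖ * κ < x k}) :
    HasExt C (rhoModel d 0) (ModelDomain d 0) (rhoModel d 0) := by
  have hCo : IsOpen C := by
    rw [hC]
    exact (isOpen_lt continuous_const continuous_norm).inter
      (isOpen_lt (continuous_norm.mul continuous_const) (cont_coord k))
  have hCM : C ⊆ ModelDomain d 0 := fun x hx => by
    rw [hC] at hx
    exact modelDomain_zero.2 (norm_pos_iff.1 hx.1)
  have memC : ∀ x ∈ ModelDomain d 0, (x ∈ C ↔ κ < x k / ‖x‖) := fun x hx => by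
    have hn : 0 < ‖x‖ := norm_pos_iff.2 (modelDomain_zero.1 hx)
    rw [hC, lt_div_iff₀ hn, mul_comm]
    exact ⟨fun h => h.2, fun h => ⟨hn, h⟩⟩
  set κ1 := (3 * κ + 1) / 4 with hκ1
  set κ2 := (κ + 1) / 2 with hκ2
  set κ3 := (κ + 3) / 4 with hκ3
  have l1 : κ < κ1 := by linarith
  have l2 : κ1 < κ2 := by linarith
  have l3 : κ2 < κ3 := by linarith
  have l4 : κ3 < 1 := by linarith
  have l5 : κ2 ^ 2 < κ3 ^ 2 := by nlinarith
  let fθ : ℝ → ℝ := fun t => Real.smoothTransition ((κ2 - t) / (κ2 - κ1))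
  let f1 : ℝ → ℝ := fun t => 1 - fθ t
  let f2 : ℝ → ℝ := fun t => Real.smoothTransition ((κ3 ^ 2 - t ^ 2) / (κ3 ^ 2 - κ2 ^ 2))
  have cθ : ContDiff ℝ ∞ fθ :=
    Real.smoothTransition.contDiff.comp ((contDiff_const.sub contDiff_id).div_const _)
  have c1 : ContDiff ℝ ∞ f1 := contDiff_const.sub cθ
  have c2 : ContDiff ℝ ∞ f2 :=
    Real.smoothTransition.contDiff.comp ((contDiff_const.sub (contDiff_id.pow 2)).div_const _)
  have θ1 : ∀ t, t ≤ κ1 → fθ t = 1 := fun t ht => by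
    refine Real.smoothTransition.one_of_one_le ?_
    rw [le_div_iff₀ (by linarith)]; linarith
  have θ0 : ∀ t, κ2 ≤ t → fθ t = 0 := fun t ht => by
    refine Real.smoothTransition.zero_of_nonpos ?_
    exact div_nonpos_of_nonpos_of_nonneg (by linarith) (by linarith)
  have f21 : ∀ t, |t| ≤ κ2 → f2 t = 1 := fun t ht => by
    refine Real.smoothTransition.one_of_one_le ?_
    have : t ^ 2 ≤ κ2 ^ 2 := by rw [← sq_abs]; gcongr
    rw [le_div_iff₀ (by linarith)]; linarith
  have f20 : ∀ t, κ3 < |t| → f2 t = 0 := fun t ht => by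
    refine Real.smoothTransition.zero_of_nonpos ?_
    have : κ3 ^ 2 ≤ t ^ 2 := by rw [← sq_abs t]; gcongr
    exact div_nonpos_of_nonpos_of_nonneg (by linarith) (by linarith)
  have hp : 0 < 1 - κ3 ^ 2 := by nlinarith
  set A := (Real.sqrt (1 - κ3 ^ 2))⁻¹ with hAd
  have hA : 1 ≤ A := by
    refine (one_le_inv₀ (Real.sqrt_pos.2 hp)).2 ?_
    exact Real.sqrt_le_iff.2 ⟨zero_le_one, by nlinarith⟩
  have hwt : ∀ x ∈ ModelDomain d 0, |x k / ‖x‖| ≤ κ3 →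
      ‖x‖ ≤ A * rhoPrime d 1 x ∧ rhoModel d 0 x ≤ A * rhoModel d 1 x := fun x hx hq => by
    have hn : 0 < ‖x‖ := norm_pos_iff.2 (modelDomain_zero.1 hx)
    rw [abs_div, abs_of_pos hn, div_le_iff₀ hn] at hq
    have h := quot_rho hk (by linarith) l4 hq
    refine ⟨h, ?_⟩
    rw [rhoModel_eq, rhoModel_eq, rhoPrime_zero]
    exact min_one_le_mul hA h (rhoPrime_nonneg 1 x)
  have hle : ∀ x : Ed d, rhoModel d 1 x ≤ A * rhoModel d 0 x := fun x => by
    have h1 := rho_le_zero 1 x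
    have h2 : 0 ≤ rhoModel d 0 x := le_min zero_le_one (rhoPrime_nonneg 0 x)
    nlinarith
  have hV : C ∩ ModelDomain d 1 =
      Orth ∅ 1 ∩ {x | (κ / Real.sqrt (1 - κ ^ 2)) * rhoPrime d 1 x < x k} := by
    ext x
    rw [hC]
    constructor
    · rintro ⟨⟨_, h2⟩, h3⟩
      exact ⟨⟨by simp, h3⟩, (cone_iff hk h0 h1 x).1 h2⟩
    · rintro ⟨⟨_, h3⟩, h2⟩
      exact ⟨⟨norm_pos_iff.2 (modelDomain_zero.1 (model_sub 1 h3)), (cone_iff hk h0 h1 x).2 h2⟩, h3⟩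
  have he : HasExt (C ∩ ModelDomain d 1) (rhoModel d 1) (ModelDomain d 1) (rhoModel d 1) := by
    have h := HasExt.cone hk (κ / Real.sqrt (1 - κ ^ 2)) (J := ∅) (by simp)
    have e : Orth (∅ : Finset (Fin d)) 1 = ModelDomain d 1 := by ext x; simp [Orth]
    rw [← hV, e] at h
    exact h
  have hVo : IsOpen (C ∩ ModelDomain d 1) := hCo.inter (modelDomain_open 1)
  refine HasExt.glue (η1 := fun x => f1 (x k / ‖x‖)) (θ := fun x => fθ (x k / ‖x‖))
    (η2 := fun x => f2 (x k / ‖x‖)) (GoodW.model hCo hCM) (GoodW.model (modelDomain_open 0) subset_rfl)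
    (GoodW.model hVo inter_subset_right) (GoodW.model (modelDomain_open 1) subset_rfl) he A hA
    ((quot_hom c1 k).ksym le_rfl) ?_ ?_ ?_ ?_ ?_ ((quot_hom c2 k).ksym le_rfl) ?_ ?_
    inter_subset_right ?_ ?_
  · rintro x ⟨hx, hx'⟩
    rw [memC x hx]
    by_contra hq
    refine quot_supp (s := Iio κ1) isOpen_Iio k (fun t ht => ?_) hx ?_ hx'
    · show 1 - fθ t = 0
      rw [θ1 t (le_of_lt ht), sub_self]
    · show x k / ‖x‖ < κ1
      linarith
  · intro x _
    have h2 : 0 ≤ rhoModel d 0 x := le_min zero_le_one (rhoPrime_nonneg 0 x)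
    constructor <;> nlinarith
  · refine (((quot_hom cθ k).ksym le_rfl).mono (inter_subset_left.trans hCM)).weight le_rfl fun x hx => ?_
    exact ⟨rhoModel_pos hx.2, rho_le_zero 1 x⟩
  · exact fun x hx => hx.1.1
  · rintro x ⟨hx, hx'⟩
    have hx0 := hCM hx.1
    refine ⟨(hwt x hx0 ?_).2, hle x⟩
    have hq := (memC x hx0).1 hx.1
    rw [abs_of_pos (by linarith)]
    by_contra hq'
    refine quot_supp (s := Ioi κ2) isOpen_Ioi k (fun t ht => θ0 t (le_of_lt ht)) hx0 ?_ hx'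
    show κ2 < x k / ‖x‖
    linarith
  · rintro x ⟨hx, hx'⟩
    have hq : |x k / ‖x‖| ≤ κ3 := by
      by_contra hq
      exact quot_supp (s := {t | κ3 < |t|}) (isOpen_lt continuous_const continuous_abs) k
        (fun t ht => f20 t ht) hx (not_le.1 hq) hx'
    have h := (hwt x hx hq).1
    have hn : 0 < ‖x‖ := norm_pos_iff.2 (modelDomain_zero.1 hx)
    rw [← rhoPrime_pos]
    exact pos_of_mul_pos_right (hn.trans_le h) (by linarith)
  · rintro x ⟨hx, hx'⟩
    have hq : |x k / ‖x‖| ≤ κ3 := by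
      by_contra hq
      exact quot_supp (s := {t | κ3 < |t|}) (isOpen_lt continuous_const continuous_abs) k
        (fun t ht => f20 t ht) hx (not_le.1 hq) hx'
    exact ⟨hle x, (hwt x hx hq).2⟩
  · intro x hx _
    have hq := (memC x (hCM hx)).1 hx
    show 1 - fθ (x k / ‖x‖) + f2 (x k / ‖x‖) * fθ (x k / ‖x‖) = 1
    rcases le_total (x k / ‖x‖) κ2 with h | h
    · rw [f21 _ (by rw [abs_of_pos (by linarith)]; exact h)]; ring
    · rw [θ0 _ h]; ring
  · intro x hx hxV
    have hx1 : x ∉ ModelDomain d 1 := fun h => hxV ⟨hx, h⟩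
    refine ⟨?_, hx1⟩
    have hr : rhoPrime d 1 x = 0 := by
      by_contra h
      exact hx1 (rhoPrime_pos.1 (lt_of_le_of_ne (rhoPrime_nonneg 1 x) (Ne.symm h)))
    have hn : 0 < ‖x‖ := norm_pos_iff.2 (modelDomain_zero.1 (hCM hx))
    have hs := normsq_split hk x
    rw [hr] at hs
    have hq := (memC x (hCM hx)).1 hx
    rw [lt_div_iff₀ hn] at hq
    have hk0 : 0 < x k := lt_trans (by positivity) hq
    have : x k = ‖x‖ := (pow_left_inj₀ hk0.le hn.le two_ne_zero).1 (by rw [hs]; ring)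
    show 1 - fθ (x k / ‖x‖) = 1
    rw [this, div_self hn.ne', θ0 1 (by linarith), sub_zero]

theorem caseI {k : Fin d} (hk : (k : ℕ) = d - 1) {κ : ℝ} (h0 : 0 < κ) (h1 : κ < 1)
    {C : Set (Ed d)} (hC : C = {x | 0 < ‖x‖ ∧ ‖x‖ * κ < x k}) :
    GoodW (C ∩ ball 0 1) (fun x => ‖x‖) ∧
    HasExt (C ∩ ball 0 1) (fun x => ‖x‖) (ModelDomain d 0) (rhoModel d 0) := by
  have hCo : IsOpen C := by
    rw [hC]
    exact (isOpen_lt continuous_const continuous_norm).inter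
      (isOpen_lt (continuous_norm.mul continuous_const) (cont_coord k))
  have hCM : C ⊆ ModelDomain d 0 := fun x hx => by
    rw [hC] at hx
    exact modelDomain_zero.2 (norm_pos_iff.1 hx.1)
  have hCk : ∀ x ∈ C, 0 < x k := fun x hx => by
    rw [hC] at hx
    exact lt_trans (mul_pos hx.1 h0) hx.2
  have e : (fun x : Ed d => ‖x‖) = rhoPrime d 0 := by funext x; rw [rhoPrime_zero]
  have hb := HasExt.weightRestr (Ω := C ∩ ball 0 1) (ℓ := 0) (hCo.inter isOpen_ball)
    (inter_subset_left.trans hCM) le_rfl fun x hx => (mem_ball_zero_iff.1 hx.2).le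
  rw [e]
  refine ⟨hb.1, hb.2.trans ?_ subset_rfl⟩
  have L : LidD k 0 (fun x => ‖x‖) (C ∩ ball 0 3) 3 (Real.exp (-2) * κ) :=
    { gs := fun x hx => (contDiffAt_norm ℝ (fun h : x = 0 => by
        have hx' : 0 < x k := hx
        rw [h] at hx'
        simp at hx')).contDiffWithinAt
      gp := fun x hx => hx.trans_le ((le_abs_self _).trans (abs_coord_le x k))
      gh := fun x _ t ht => by rw [norm_smul, Real.norm_of_nonneg ht.le]
      uo := hCo.inter isOpen_ball
      ui := fun x hx => hCk x hx.1
      um := inter_subset_left.trans hCM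
      ub := fun x hx => (mem_ball_zero_iff.1 hx.2).le
      ud := fun x hx t ht ht1 => by
        have hx1 := hx.1
        have hx2 := mem_ball_zero_iff.1 hx.2
        rw [hC] at hx1
        have e1 : ‖t • x‖ = t * ‖x‖ := by rw [norm_smul, Real.norm_of_nonneg ht.le]
        refine ⟨?_, ?_⟩
        · rw [hC]
          refine ⟨by rw [e1]; exact mul_pos ht hx1.1, ?_⟩
          rw [e1, mul_assoc]
          simpa using mul_lt_mul_of_pos_left hx1.2 ht
        · rw [mem_ball_zero_iff, e1]
          nlinarith [norm_nonneg x]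
      hδ := mul_pos (Real.exp_pos _) h0
      hU := fun x hx h => by
        have hx1 := hx.1
        rw [hC] at hx1
        exact (mul_le_mul_of_nonneg_right h.le h0.le).trans hx1.2.le }
  have h2 := L.hasExt
  have e2 : C ∩ ball 0 3 ∩ {x : Ed d | ‖x‖ < 1} = C ∩ ball 0 1 := by
    ext x
    simp only [mem_inter_iff, mem_ball_zero_iff, mem_setOf_eq]
    constructor
    · rintro ⟨⟨a, b⟩, c⟩; exact ⟨a, c⟩
    · rintro ⟨a, c⟩; exact ⟨⟨a, by linarith⟩, c⟩
  rw [e2] at h2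
  have h3 := h2.bumpCut (hCo.inter isOpen_ball) hCo hCM inter_subset_left
    (inter_subset_inter_right _ (ball_subset_ball (by norm_num))) one_pos
    (fun x hx => (mem_ball_zero_iff.1 hx.2).le)
    (fun x hx hx' => ⟨hx, mem_ball_zero_iff.2 (by linarith)⟩)
  exact h3.trans (HasExt.coneZero hk h0 h1 hC) inter_subset_left

theorem caseII {k : Fin d} (hd : 2 ≤ d) (hk : (k : ℕ) = d - 1) {κ : ℝ} (h0 : 0 < κ) (h1 : κ < 1)
    {C : Set (Ed d)} (hC : C = {x | 0 < ‖x‖ ∧ ‖x‖ * κ < x k}) :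
    GoodW (C ∩ unitCube d) (rhoAxis d k) ∧
    HasExt (C ∩ unitCube d) (rhoAxis d k) (ModelDomain d 1) (rhoModel d 1) := by
  classical
  set c := κ / Real.sqrt (1 - κ ^ 2) with hc
  have hc0 : 0 < c := div_pos h0 (Real.sqrt_pos.2 (by nlinarith))
  set J : Finset (Fin d) := Finset.univ.erase k with hJ
  set A : Set (Ed d) := Orth J 1 ∩ {x | c * rhoPrime d 1 x < x k} with hA
  have hAo : IsOpen A := (Orth_open J 1).inter
    (isOpen_lt (continuous_const.mul (rhoPrime_cont 1)) (cont_coord k))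
  have hAM : A ⊆ ModelDomain d 1 := inter_subset_left.trans inter_subset_right
  have hpos : ∀ x ∈ A, ∀ j, 0 < x j := fun x hx j => by
    by_cases hj : j = k
    · subst hj
      exact lt_of_le_of_lt (mul_nonneg hc0.le (rhoPrime_nonneg 1 x)) hx.2
    · exact hx.1.1 j (by simp [hJ, hj])
  have hdil : ∀ x ∈ A, ∀ t : ℝ, 0 < t → t • x ∈ A := fun x hx t ht => by
    refine ⟨⟨fun j hj => ?_, ?_⟩, ?_⟩
    · have := hx.1.1 j hj
      simpa using mul_pos ht this
    · rw [← rhoPrime_pos, rhoPrime_smul ht.le]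
      exact mul_pos ht (rhoPrime_pos.2 (hAM hx))
    · show c * rhoPrime d 1 (t • x) < (t • x) k
      rw [rhoPrime_smul ht.le]
      have := mul_lt_mul_of_pos_left (show c * rhoPrime d 1 x < x k from hx.2) ht
      simp only [PiLp.smul_apply, smul_eq_mul]
      linarith
  have e : C ∩ unitCube d = A ∩ {x | ∀ j, x j < 1} := by
    ext x
    constructor
    · rintro ⟨hx, hx'⟩
      rw [hC] at hx
      refine ⟨⟨⟨fun j _ => (hx' j).1, ?_⟩, (cone_iff hk h0 h1 x).1 hx.2⟩, fun j => (hx' j).2⟩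
      exact fun h => (hx' ⟨0, by omega⟩).1.ne' (h ⟨0, by omega⟩ (by simp; omega))
    · rintro ⟨hx, hx'⟩
      refine ⟨?_, fun j => ⟨hpos x hx j, hx' j⟩⟩
      rw [hC]
      exact ⟨norm_pos_iff.2 (modelDomain_zero.1 (model_sub 1 (hAM hx))), (cone_iff hk h0 h1 x).2 hx.2⟩
  have ho : IsOpen (A ∩ {x : Ed d | ∀ j, x j < 1}) := by
    refine hAo.inter ?_
    have : {x : Ed d | ∀ j, x j < 1} = ⋂ j, {x | x j < 1} := by ext; simp
    rw [this]
    exact isOpen_iInter_of_finite fun j => isOpen_lt (cont_coord j) continuous_const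
  have hd1 : (1 : ℝ) ≤ d := by exact_mod_cast (by omega : 1 ≤ d)
  have hb := HasExt.weightRestr (ℓ := 1) ho (inter_subset_left.trans hAM) hd1 fun x hx => by
    have := norm_le_of_box (x := x) (B := 1) zero_le_one fun j => by
      rw [abs_of_pos (hpos x hx.1 j)]; exact (hx.2 j).le
    linarith
  rw [e, rhoAxis_eq hk]
  refine ⟨hb.1, hb.2.trans ?_ subset_rfl⟩
  refine (HasExt.cube (by omega) hAo hAM hpos hdil).trans ?_ inter_subset_left
  exact (HasExt.cone hk c (by simp [hJ])).trans (HasExt.orth J 1) inter_subset_left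

theorem caseIII {ℓ : ℕ} (hld : ℓ < d) :
    GoodW (unitCube d) (rhoPrime d ℓ) ∧
    HasExt (unitCube d) (rhoPrime d ℓ) (ModelDomain d ℓ) (rhoModel d ℓ) := by
  set A : Set (Ed d) := Orth Finset.univ ℓ with hA
  have hAo : IsOpen A := Orth_open _ ℓ
  have hAM : A ⊆ ModelDomain d ℓ := inter_subset_right
  have hpos : ∀ x ∈ A, ∀ j, 0 < x j := fun x hx j => hx.1 j (Finset.mem_univ j)
  have hdil : ∀ x ∈ A, ∀ t : ℝ, 0 < t → t • x ∈ A := fun x hx t ht => by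
    refine ⟨fun j hj => ?_, ?_⟩
    · have := hx.1 j hj
      simpa using mul_pos ht this
    · rw [← rhoPrime_pos, rhoPrime_smul ht.le]
      exact mul_pos ht (rhoPrime_pos.2 (hAM hx))
  have e : unitCube d = A ∩ {x | ∀ j, x j < 1} := by
    ext x
    constructor
    · intro hx'
      refine ⟨⟨fun j _ => (hx' j).1, ?_⟩, fun j => (hx' j).2⟩
      exact fun h => (hx' ⟨0, by omega⟩).1.ne' (h ⟨0, by omega⟩ (by simp; omega))
    · rintro ⟨hx, hx'⟩
      exact fun j => ⟨hpos x hx j, hx' j⟩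
  have ho : IsOpen (A ∩ {x : Ed d | ∀ j, x j < 1}) := by
    refine hAo.inter ?_
    have : {x : Ed d | ∀ j, x j < 1} = ⋂ j, {x | x j < 1} := by ext; simp
    rw [this]
    exact isOpen_iInter_of_finite fun j => isOpen_lt (cont_coord j) continuous_const
  have hd1 : (1 : ℝ) ≤ d := by exact_mod_cast (by omega : 1 ≤ d)
  have hb := HasExt.weightRestr (ℓ := ℓ) ho (inter_subset_left.trans hAM) hd1 fun x hx => by
    have := norm_le_of_box (x := x) (B := 1) zero_le_one fun j => by
      rw [abs_of_pos (hpos x hx.1 j)]; exact (hx.2 j).le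
    linarith
  rw [e]
  refine ⟨hb.1, hb.2.trans ?_ subset_rfl⟩
  exact (HasExt.cube (by omega) hAo hAM hpos hdil).trans (HasExt.orth _ ℓ) inter_subset_left

end Cases


/-- Proposition `extension` (Stein's extension operator in the Kondratiev scale).
(i) For the truncated smooth cone `K` with `M = {0}` there is a linear operator `E`,
with `Eu = u` a.e. on `K` for every locally integrable `u`, which is bounded from
`𝒦^m_{a,p}(K,{0})` to `𝒦^m_{a,p}(ℝ^d,{0})` simultaneously for all `m, a, p`.
(ii) The same for the nonsmooth cone `P` with edge `Γ`, mapping into `𝒦^m_{a,p}(ℝ^d,ℝ_*)`.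
(iii) The same for the unit cube `I` with face `M_ℓ`, mapping into `𝒦^m_{a,p}(ℝ^d,ℝ^ℓ_*)`. -/
theorem statement0 (d : ℕ) (hd : 2 ≤ d) (γ : ℝ) (hγ : γ ∈ Set.Ioo (0 : ℝ) Real.pi)
    (k : Fin d) (hk : (k : ℕ) = d - 1) (ℓ : ℕ) (hl1 : 1 ≤ ℓ) (hld : ℓ < d)
    (K P I₀ : Set (Ed d))
    (hK : K = smoothConeInf d k γ ∩ Metric.ball 0 1)
    (hP : P = smoothConeInf d k γ ∩ unitCube d)
    (hI : I₀ = unitCube d) :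
    -- (i) extension from the truncated smooth cone (Case I)
    (∃ E : (Ed d → ℝ) → Ed d → ℝ, IsLinearOp d E ∧
      (∀ u : Ed d → ℝ, LocallyIntegrableOn u K volume → E u =ᵐ[volume.restrict K] u) ∧
      ∀ (m : ℕ) (a p : ℝ), 1 ≤ m → 1 ≤ p →
        ∃ C : ℝ, 0 < C ∧ ∀ u : Ed d → ℝ,
          MemK d K (fun x => ‖x‖) m a p u →
            MemKM d 0 m a p (E u) ∧
              KnormM d 0 m a p (E u) ≤ C * Knorm d K (fun x => ‖x‖) m a p u) ∧
    -- (ii) extension from the specific nonsmooth cone (Case II)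
    (∃ E : (Ed d → ℝ) → Ed d → ℝ, IsLinearOp d E ∧
      (∀ u : Ed d → ℝ, LocallyIntegrableOn u P volume → E u =ᵐ[volume.restrict P] u) ∧
      ∀ (m : ℕ) (a p : ℝ), 1 ≤ m → 1 ≤ p →
        ∃ C : ℝ, 0 < C ∧ ∀ u : Ed d → ℝ,
          MemK d P (rhoAxis d k) m a p u →
            MemKM d 1 m a p (E u) ∧
              KnormM d 1 m a p (E u) ≤ C * Knorm d P (rhoAxis d k) m a p u) ∧
    -- (iii) extension from the unit cube with face `M_ℓ` (Case III)
    (∃ E : (Ed d → ℝ) → Ed d → ℝ, IsLinearOp d E ∧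
      (∀ u : Ed d → ℝ, LocallyIntegrableOn u I₀ volume → E u =ᵐ[volume.restrict I₀] u) ∧
      ∀ (m : ℕ) (a p : ℝ), 1 ≤ m → 1 ≤ p →
        ∃ C : ℝ, 0 < C ∧ ∀ u : Ed d → ℝ,
          MemK d I₀ (rhoPrime d ℓ) m a p u →
            MemKM d ℓ m a p (E u) ∧
              KnormM d ℓ m a p (E u) ≤ C * Knorm d I₀ (rhoPrime d ℓ) m a p u) := by
  have h0 : 0 < Real.cos (γ / 2) := Real.cos_pos_of_mem_Ioo
    ⟨by linarith [hγ.1, Real.pi_pos], by linarith [hγ.2]⟩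
  have h1 : Real.cos (γ / 2) < 1 := by
    have := Real.cos_lt_cos_of_nonneg_of_le_pi_div_two (x := 0) (y := γ / 2) le_rfl
      (by linarith [hγ.2]) (by linarith [hγ.1])
    rwa [Real.cos_zero] at this
  subst hK hP hI
  have c1 := caseI hk h0 h1 (C := smoothConeInf d k γ) rfl
  have c2 := caseII hd hk h0 h1 (C := smoothConeInf d k γ) rfl
  have c3 := caseIII hld
  exact ⟨HasExt.final c1.1 c1.2, HasExt.final c2.1 c2.2, HasExt.final c3.1 c3.2⟩

end
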